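/- For each z ∈ I_ℤ, the map a ↦ (P_EGᴼ(a), Q_EGᴼ(a)) is a bijection from the set R_inv^+(z) of primed involution words for z to the set of pairs (P, Q) of shifted tableaux of the same shape in which P is increasing with no primed entries on the main diagonal and row(P) ∈ R_inv^+(z), and Q is standard. -/

import Mathlib

/-! ## Primed letters: the alphabet `ℤ ⊔ ℤ'`, with `i' = i - 1/2`.
A letter is encoded by its "ceiling" together with a flag recording whether it is primed. -/

structure Letter where
  ceil : ℤ
  primed : Bool
deriving DecidableEq, Repr

instance : Inhabited Letter := ⟨⟨0, false⟩⟩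

/-- The order `⋯ < 1' < 1 < 2' < 2 < ⋯`. -/
instance : LinearOrder Letter :=
  LinearOrder.lift' (fun x : Letter => toLex (x.ceil, !x.primed))
    (fun a b h => by
      have h' : (a.ceil, !a.primed) = (b.ceil, !b.primed) := toLex.injective h
      obtain ⟨ac, ap⟩ := a
      obtain ⟨bc, bp⟩ := b
      simp only [Prod.mk.injEq] at h'
      obtain ⟨h1, h2⟩ := h'
      cases ap <;> cases bp <;> simp_all)

/-- A primed word. -/
abbrev PWord := List Letter

def Letter.unprime (x : Letter) : Letter := ⟨x.ceil, false⟩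

def Letter.succL (x : Letter) : Letter := ⟨x.ceil + 1, x.primed⟩

/-- `unprime` of a primed word: replace each letter `x` by `⌈x⌉`. -/
def unprimeWord (a : PWord) : List ℤ := a.map Letter.ceil

/-- `unprime` of a primed word, as a primed word with no primes. -/
def unprimeP (a : PWord) : PWord := a.map Letter.unprime

/-! ## Involution words -/

/-- The simple transposition `s_i = (i, i+1)` of `ℤ`. -/
def sPerm (i : ℤ) : Equiv.Perm ℤ := Equiv.swap i (i + 1)

/-- The Demazure product `s_{w_1} ∘ s_{w_2} ∘ ⋯ ∘ s_{w_k}` of a word, computed by the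
defining recursion `σ ∘ s_i = σ·s_i` if `σ(i) < σ(i+1)` and `σ ∘ s_i = σ` otherwise. -/
def heckeProd (w : List ℤ) : Equiv.Perm ℤ :=
  w.foldl (fun σ i => if σ i < σ (i + 1) then σ * sPerm i else σ) 1

/-- `s_{a_n} ∘ ⋯ ∘ s_{a_2} ∘ s_{a_1} ∘ s_{a_2} ∘ ⋯ ∘ s_{a_n}` for `a = a_1 a_2 ⋯ a_n`. -/
def invHecke (a : List ℤ) : Equiv.Perm ℤ := heckeProd (a.reverse ++ a.tail)

/-- Membership in `I_ℤ`: a finitely supported involution of `ℤ`. -/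
def IZ (z : Equiv.Perm ℤ) : Prop := {x : ℤ | z x ≠ x}.Finite ∧ z * z = 1

/-- The set of involution words of `z`. -/
def Rinv (z : Equiv.Perm ℤ) : Set (List ℤ) :=
  {a | invHecke a = z ∧ ∀ b : List ℤ, invHecke b = z → a.length ≤ b.length}

/-- 0-based index `k` is a commutation in the word `a` (this corresponds to the 1-based
index `k+1`): `a_{k+1}` and `a_{k+1} + 1` are both fixed points of
`s_{a_k} ∘ ⋯ ∘ s_{a_1} ∘ ⋯ ∘ s_{a_k}`. -/
def IsCommutation (a : List ℤ) (k : ℕ) : Prop :=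
  ∃ x, a[k]? = some x ∧ invHecke (a.take k) x = x ∧ invHecke (a.take k) (x + 1) = x + 1

/-- The set of primed involution words of `z`. -/
def RinvPlus (z : Equiv.Perm ℤ) : Set PWord :=
  {a | unprimeWord a ∈ Rinv z ∧
     ∀ (k : ℕ) (x : Letter), a[k]? = some x → x.primed = true →
       IsCommutation (unprimeWord a) k}

/-! ## Shifted tableaux.
A shifted tableau is recorded as its list of rows, from the first (bottom) row upward;
the entry at 0-based index `k` of 0-based row `r` occupies the box in row `r+1` and
column `r+1+k` of the shifted diagram. -/

abbrev STab := List (List Letter)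

/-- A strict partition, recorded as its (strictly decreasing) list of positive parts. -/
def IsStrictPartition (sh : List ℕ) : Prop :=
  List.Chain' (fun a b => b < a) sh ∧ ∀ m ∈ sh, 0 < m

def shapeOf {α : Type*} (T : List (List α)) : List ℕ := T.map List.length

/-- The rows form the shifted diagram of a strict partition. -/
def IsShifted {α : Type*} (T : List (List α)) : Prop := IsStrictPartition (shapeOf T)

/-- The entry of `T` in (0-based) row `r` and column `c` of the shifted diagram. -/
def entryG? {α : Type*} (T : List (List α)) (r c : ℕ) : Option α :=
  if r ≤ c then (T[r]?).bind (fun row => row[c - r]?) else none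

def entry? (T : STab) (r c : ℕ) : Option Letter := entryG? T r c

def setRowG {α : Type*} (T : List (List α)) (r : ℕ) (row : List α) : List (List α) :=
  if r < T.length then T.set r row else T ++ [row]

def setEntryG {α : Type*} (T : List (List α)) (r c : ℕ) (x : α) : List (List α) :=
  T.set r ((T.getD r []).set (c - r) x)

def numCols {α : Type*} (T : List (List α)) : ℕ := (T.getD 0 []).length

/-- Row reading word: rows left to right, starting with the last (top) row. -/
def rowWord (T : STab) : PWord := T.reverse.flatten

/-- Column reading word: columns top to bottom, starting with the first column. -/
def colWord (T : STab) : PWord :=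
  (List.range (numCols T)).flatMap (fun c =>
    ((List.range (c + 1)).reverse).filterMap (fun r => entry? T r c))

def unprimeT (T : STab) : STab := T.map (List.map Letter.unprime)

/-- Remove the primes from all main-diagonal entries. -/
def unprimeDiagT (T : STab) : STab :=
  T.map (fun row =>
    match row with
    | [] => []
    | x :: rest => Letter.unprime x :: rest)

/-- Rows and columns are strictly increasing. -/
def IsIncreasing (T : STab) : Prop :=
  (∀ r c x y, entry? T r c = some x → entry? T r (c + 1) = some y → x < y) ∧
  (∀ r c x y, entry? T r c = some x → entry? T (r + 1) c = some y → x < y)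

/-- No primed entries on the main diagonal. -/
def NoDiagPrimes (T : STab) : Prop :=
  ∀ r x, entry? T r r = some x → x.primed = false

/-- Entries positive, rows and columns weakly increasing, no primed entry repeated
in a row and no unprimed entry repeated in a column. -/
def IsSemistandard (T : STab) : Prop :=
  (∀ x ∈ T.flatten, 0 < x.ceil) ∧
  (∀ r c x y, entry? T r c = some x → entry? T r (c + 1) = some y → x ≤ y) ∧
  (∀ r c x y, entry? T r c = some x → entry? T (r + 1) c = some y → x ≤ y) ∧
  (∀ r c c' x, c < c' → entry? T r c = some x → entry? T r c' = some x →
    x.primed = false) ∧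
  (∀ r r' c x, r < r' → entry? T r c = some x → entry? T r' c = some x →
    x.primed = true)

/-- Increasing, with exactly one of `i` or `i'` as an entry for each `i = 1, …, n`,
where `n` is the number of boxes. -/
def IsStandard (T : STab) : Prop :=
  IsIncreasing T ∧
  ∀ i : ℤ, 1 ≤ i → i ≤ (T.flatten.length : ℤ) →
    T.flatten.countP (fun x => decide (x.ceil = i)) = 1
/-! ## Orthogonal Edelman–Greene insertion -/

/-- "Switching the primes" of a pair: reverse the primes on both letters if exactly one
of them is unprimed, and leave them unchanged otherwise. -/
def switchPrimes (x y : Letter) : Letter × Letter :=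
  if x.primed = y.primed then (x, y)
  else (⟨x.ceil, !x.primed⟩, ⟨y.ceil, !y.primed⟩)

/-- Column-insertion stage of orthogonal Edelman–Greene insertion:
insert letter `w` into column `c` of `T` (then continue into later columns). -/
def egCol : ℕ → STab → ℕ → Letter → STab × Bool
  | 0, T, _, _ => (T, true)
  | fuel + 1, T, c, w =>
    let occ := (List.range (c + 1)).filterMap (fun r => (entry? T r c).map (fun x => (r, x)))
    match occ.findIdx? (fun p => decide (w.ceil < p.2.ceil)) with
    | none =>
        -- place `w` in the first empty box of the column
        let r := occ.length
        let w' := if r = c ∧ w.primed then Letter.unprime w else w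
        (setRowG T r ((T.getD r []) ++ [w']), if r = c then w.primed else true)
    | some kM =>
        let km := (occ.findIdx? (fun p => decide (w.ceil ≤ p.2.ceil))).getD kM
        let im := (occ.getD km (0, default)).1
        let m := (occ.getD km (0, default)).2
        if km = kM then
          if im = c then
            -- m = M on the main diagonal
            egCol fuel (setEntryG T im c (Letter.unprime w)) (c + 1) ⟨m.ceil, w.primed⟩
          else
            -- m = M off the main diagonal
            egCol fuel (setEntryG T im c w) (c + 1) m
        else
          -- m < M : switch the primes on m and M, insert w+1 into the next column
          let iM := (occ.getD kM (0, default)).1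
          let M := (occ.getD kM (0, default)).2
          let p := switchPrimes m M
          egCol fuel (setEntryG (setEntryG T im c p.1) iM c p.2) (c + 1) (Letter.succL w)

/-- Row-insertion stage of orthogonal Edelman–Greene insertion:
insert letter `w` into row `r` of `T`. -/
def egRow : ℕ → STab → ℕ → Letter → STab × Bool
  | 0, T, _, _ => (T, true)
  | fuel + 1, T, r, w =>
    let row := T.getD r []
    match row.findIdx? (fun x => decide (w.ceil < x.ceil)) with
    | none =>
        if row.isEmpty ∧ w.primed then (setRowG T r [Letter.unprime w], true)
        else (setRowG T r (row ++ [w]), false)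
    | some kM =>
        let km := (row.findIdx? (fun x => decide (w.ceil ≤ x.ceil))).getD kM
        let m := row.getD km default
        if km = kM then
          if km = 0 then
            -- m = M on the main diagonal
            egCol fuel (setRowG T r (row.set 0 (Letter.unprime w))) (r + 1)
              ⟨m.ceil, w.primed⟩
          else
            -- m = M off the main diagonal
            egRow fuel (setRowG T r (row.set km w)) (r + 1) m
        else
          -- m < M : switch primes; insert w+1 into the next column (if m is on the
          -- main diagonal) or the next row (otherwise)
          let M := row.getD kM default
          let p := switchPrimes m M
          let row' := (row.set km p.1).set kM p.2
          if km = 0 then egCol fuel (setRowG T r row') (r + 1) (Letter.succL w)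
          else egRow fuel (setRowG T r row') (r + 1) (Letter.succL w)

/-- `T ←ᴼ u` together with the flag recording whether the insertion ended in
column insertion. -/
def egInsert (T : STab) (u : Letter) : STab × Bool :=
  egRow (T.flatten.length + T.length + 2) T 0 u

/-- The orthogonal Edelman–Greene insertion tableau `P_EGᴼ(a)`. -/
def PEG (a : PWord) : STab := a.foldl (fun T u => (egInsert T u).1) []

/-- Add the recording letter `x` to `Q` in the unique box of `Pnew` not in `Pold`. -/
def addBox (Q Pold Pnew : STab) (x : Letter) : STab :=
  match (List.range Pnew.length).find?
      (fun r => decide ((Pold.getD r []).length ≠ (Pnew.getD r []).length)) with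
  | some r => setRowG Q r ((Q.getD r []) ++ [x])
  | none => Q

def QEGaux : STab → STab → ℕ → PWord → STab
  | _, Q, _, [] => Q
  | P, Q, n, u :: rest =>
      let res := egInsert P u
      QEGaux res.1 (addBox Q P res.1 ⟨(n : ℤ), res.2⟩) (n + 1) rest

/-- The orthogonal Edelman–Greene recording tableau `Q_EGᴼ(a)`. -/
def QEG (a : PWord) : STab := QEGaux [] [] 1 a

/-! ## Orthogonal Coxeter–Knuth operators -/

def ock1 (x : Letter) : Letter := ⟨x.ceil, !x.primed⟩

def ock2 (x y : Letter) : Letter × Letter := (⟨y.ceil, x.primed⟩, ⟨x.ceil, y.primed⟩)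

def ock3 (x y z : Letter) : Letter × Letter × Letter :=
  if x.ceil = z.ceil ∧ (x.ceil - y.ceil = 1 ∨ y.ceil - x.ceil = 1) then
    if x.primed = false ∧ y.primed = false ∧ z.primed = false then
      -- XYX ↔ YXY
      (⟨y.ceil, false⟩, ⟨x.ceil, false⟩, ⟨y.ceil, false⟩)
    else if x.primed = true ∧ y.primed = false ∧ z.primed = false then
      -- X'YX ↦ YXY'
      (⟨y.ceil, false⟩, ⟨x.ceil, false⟩, ⟨y.ceil, true⟩)
    else if x.primed = false ∧ y.primed = false ∧ z.primed = true then
      -- YXY' ↦ X'YX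
      (⟨y.ceil, true⟩, ⟨x.ceil, false⟩, ⟨y.ceil, false⟩)
    else (x, y, z)
  else if (x.ceil < z.ceil ∧ z.ceil < y.ceil) ∨ (y.ceil < z.ceil ∧ z.ceil < x.ceil) then
    -- ACB ↔ CAB
    (y, x, z)
  else if (y.ceil < x.ceil ∧ x.ceil < z.ceil) ∨ (z.ceil < x.ceil ∧ x.ceil < y.ceil) then
    -- BCA ↔ BAC
    (x, z, y)
  else (x, y, z)

/-- The operator `ock_i` for `i ∈ ℤ`. -/
def ockW (i : ℤ) (a : PWord) : PWord :=
  if i = -1 then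
    match a with
    | [] => []
    | x :: rest => ock1 x :: rest
  else if i = 0 then
    match a with
    | x :: y :: rest => (ock2 x y).1 :: (ock2 x y).2 :: rest
    | _ => a
  else if 1 ≤ i ∧ i + 2 ≤ (a.length : ℤ) then
    let k := (i - 1).toNat
    match a[k]?, a[k + 1]?, a[k + 2]? with
    | some x, some y, some z =>
        a.take k ++ [(ock3 x y z).1, (ock3 x y z).2.1, (ock3 x y z).2.2] ++ a.drop (k + 3)
    | _, _, _ => a
  else a

/-- Orthogonal Coxeter–Knuth equivalence: generated by `a ∼ ock_i(a)` for all `i ∈ ℤ`. -/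
def OckEquiv : PWord → PWord → Prop :=
  Relation.EqvGen (fun a b => ∃ i : ℤ, b = ockW i a)
/-! ## Descents -/

/-- Descent set of a primed word (as a set of 1-based positions). -/
def DesWord (a : PWord) : Set ℤ :=
  {i | ∃ k : ℕ, i = (k : ℤ) + 1 ∧ ∃ x y, a[k]? = some x ∧ a[k + 1]? = some y ∧ y < x}

/-- Descent set of a standard shifted tableau. -/
def DesT (T : STab) : Set ℤ :=
  {i | 0 < i ∧ (
    (∃ r c r' c', entry? T r c = some ⟨i, false⟩ ∧
        entry? T r' c' = some ⟨i + 1, false⟩ ∧ r < r') ∨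
    (∃ r c r' c', entry? T r c = some ⟨i, true⟩ ∧
        entry? T r' c' = some ⟨i + 1, true⟩ ∧ c < c') ∨
    (∃ r c r' c', entry? T r c = some ⟨i, false⟩ ∧
        entry? T r' c' = some ⟨i + 1, true⟩))}

/-! ## Dual equivalence operators on standard shifted tableaux -/

def numPrimes (T : STab) : ℕ := T.flatten.countP (fun x => x.primed)

/-- The entries of column `c`, read from bottom to top (increasing). -/
def colLetters (T : STab) (c : ℕ) : PWord :=
  (List.range (c + 1)).filterMap (fun r => entry? T r c)

/-- The shifted reading word `unprime(C_q R_q ⋯ C_1 R_1)`. -/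
def shword (T : STab) : List ℤ :=
  (((List.range (numCols T)).reverse).flatMap (fun idx =>
    (colLetters T idx).filter (fun x => x.primed) ++
      ((T.getD idx []).filter (fun x => !x.primed)))).map Letter.ceil

def idxOfZ (v : ℤ) : List ℤ → ℕ
  | [] => 0
  | x :: r => if x = v then 0 else idxOfZ v r + 1

def positionsOf (T : STab) : List (ℕ × ℕ) :=
  (List.range T.length).flatMap (fun r =>
    (List.range (T.getD r []).length).map (fun k => (r, r + k)))

/-- The box `□_v` of `T` containing `v` or `v'`. -/
def boxOf (T : STab) (v : ℤ) : Option (ℕ × ℕ) :=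
  (positionsOf T).find? (fun p =>
    match entry? T p.1 p.2 with
    | some x => decide (x.ceil = v)
    | none => false)

/-- Reverse the prime of the entry in position `(r, c)`. -/
def togglePos (T : STab) (r c : ℕ) : STab :=
  match entry? T r c with
  | some x => setEntryG T r c ⟨x.ceil, !x.primed⟩
  | none => T

/-- Switch the primes of the entries in the two given positions. -/
def switchAt (T : STab) (p q : ℕ × ℕ) : STab :=
  match entry? T p.1 p.2, entry? T q.1 q.2 with
  | some x, some y =>
      if x.primed = y.primed then T else togglePos (togglePos T p.1 p.2) q.1 q.2
  | _, _ => T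

/-- The row index of `□_v` if it is a main-diagonal box. -/
def diagBox? (T : STab) (v : ℤ) : Option ℕ :=
  (boxOf T v).bind (fun p => if p.1 = p.2 then some p.1 else none)

def switchDiag (T T' : STab) (u v : ℤ) : STab :=
  match diagBox? T u, diagBox? T v with
  | some r, some s => switchAt T' (r, r) (s, s)
  | _, _ => T'

/-- The operator `𝔰_i`. -/
def sOp (i : ℤ) (T : STab) : STab :=
  match boxOf T i, boxOf T (i + 1) with
  | some (r1, c1), some (r2, c2) =>
      if r1 ≠ r2 ∧ c1 ≠ c2 then
        -- swap i ↔ i+1 and i' ↔ (i+1)'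
        setEntryG (setEntryG T r1 c1 ⟨i + 1, ((entry? T r1 c1).getD default).primed⟩)
          r2 c2 ⟨i, ((entry? T r2 c2).getD default).primed⟩
      else if r1 ≠ c1 ∧ r2 ≠ c2 then
        -- same row or column, neither box diagonal: reverse both primes
        togglePos (togglePos T r1 c1) r2 c2
      else
        -- same row or column, one box diagonal
        let T1 := if r1 = c1 then togglePos T r2 c2 else togglePos T r1 c1
        let T2 :=
          if 1 ≤ i - 1 ∧ (diagBox? T (i - 1)).isSome ∧ (diagBox? T (i + 1)).isSome then
            switchDiag T T1 (i - 1) (i + 1)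
          else T1
        if i + 2 ≤ (T.flatten.length : ℤ) ∧ (diagBox? T i).isSome ∧
            (diagBox? T (i + 2)).isSome then
          switchDiag T T2 i (i + 2)
        else T2
  | _, _ => T

def btwn (a m b : ℕ) : Prop := (a < m ∧ m < b) ∨ (b < m ∧ m < a)

instance (a m b : ℕ) : Decidable (btwn a m b) := by unfold btwn; infer_instance

/-- The dual equivalence operator `𝔡_i` for `i ∈ ℤ`. -/
def dOp (i : ℤ) (T : STab) : STab :=
  if ¬(1 ≤ i + 2 ∧ i + 2 ≤ (T.flatten.length : ℤ)) then T
  else if i = -1 then togglePos T 0 0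
  else if i = 0 then togglePos T 0 1
  else
    let w := shword T
    if btwn (idxOfZ i w) (idxOfZ (i + 2) w) (idxOfZ (i + 1) w) then sOp i T
    else if btwn (idxOfZ (i + 1) w) (idxOfZ i w) (idxOfZ (i + 2) w) then sOp (i + 1) T
    else T

/-! ## Marked cycles -/

/-- The 2-cycles of `z`, as ordered pairs `(i, j)` with `i < j = z(i)`. -/
def cycSet (z : Equiv.Perm ℤ) : Set (ℤ × ℤ) := {p | p.1 < p.2 ∧ z p.1 = p.2}

/-- `s_{a_n} ⋯ s_{a_{k+2}} s_{a_{k+1}}` (ordinary product; 0-based index `k`). -/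
def suffixPerm (a : List ℤ) (k : ℕ) : Equiv.Perm ℤ :=
  ((a.drop (k + 1)).reverse.map sPerm).prod

/-- `γ_{k+1}(a)` as an ordered pair (junk value `(0,0)` off the commutation set). -/
def gammaPair (a : List ℤ) (k : ℕ) : ℤ × ℤ :=
  match a[k]? with
  | some x => (min (suffixPerm a k x) (suffixPerm a k (x + 1)),
               max (suffixPerm a k x) (suffixPerm a k (x + 1)))
  | none => (0, 0)
/-! ## Increasing factorization sequences and Schur Q-functions -/

/-- `Incr_∞(R_inv^+(z))`: sequences of weakly increasing primed words, all but
finitely many empty, whose concatenation is a primed involution word for `z`. -/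
def IncrSeq (z : Equiv.Perm ℤ) : Set (ℕ → PWord) :=
  {φ | (∀ n, List.Chain' (· ≤ ·) (φ n)) ∧
    ∃ N, (∀ n, N ≤ n → φ n = []) ∧ ((List.range N).map φ).flatten ∈ RinvPlus z}

/-- Least bound past which a sequence of words is empty. -/
noncomputable def seqBound (φ : ℕ → PWord) : ℕ := sInf {N | ∀ n, N ≤ n → φ n = []}

/-- The concatenation `a^1 a^2 ⋯` of a sequence of words. -/
noncomputable def concatSeq (φ : ℕ → PWord) : PWord :=
  ((List.range (seqBound φ)).map φ).flatten

/-- `ℓ(a^1) + ⋯ + ℓ(a^i)`. -/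
def prefLen (φ : ℕ → PWord) (i : ℕ) : ℕ := (((List.range i).map φ).map List.length).sum

/-- The minimal `i ≥ 1` with `j ≤ ℓ(a^1) + ⋯ + ℓ(a^i)`. -/
noncomputable def relabel (φ : ℕ → PWord) (j : ℤ) : ℤ :=
  ((sInf {i : ℕ | 1 ≤ i ∧ j ≤ (prefLen φ i : ℤ)} : ℕ) : ℤ)

/-- The semistandard recording tableau `Q_EGᴼ(φ)`. -/
noncomputable def QEGseq (φ : ℕ → PWord) : STab :=
  (QEG (concatSeq φ)).map (List.map (fun x => (⟨relabel φ x.ceil, x.primed⟩ : Letter)))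

/-- The insertion tableau `P_EGᴼ(φ)`. -/
noncomputable def PEGseq (φ : ℕ → PWord) : STab := PEG (concatSeq φ)

/-- The Schur Q-function of a strict partition: the coefficient of the monomial with
exponent vector `d` is the number of semistandard shifted tableaux `T` of the given
shape with `x^T = x^d`. -/
noncomputable def SchurQ (sh : List ℕ) : MvPowerSeries ℤ ℤ :=
  fun d => (({T : STab | shapeOf T = sh ∧ IsSemistandard T ∧
    ∀ i : ℤ, d i = T.flatten.countP (fun x => decide (x.ceil = i))} : Set STab).ncard : ℤ)

/-- `Q_z = Σ_{φ ∈ Incr_∞(R_inv^+(z))} x^φ`. -/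
noncomputable def Qz (z : Equiv.Perm ℤ) : MvPowerSeries ℤ ℤ :=
  fun d => (({φ : ℕ → PWord | φ ∈ IncrSeq z ∧
    (∀ i : ℕ, d ((i : ℤ) + 1) = (φ i).length) ∧
    (∀ j : ℤ, j ≤ 0 → d j = 0)} : Set (ℕ → PWord)).ncard : ℤ)

/-! ## Dominant involutions -/

/-- The shifted diagram `SD_λ ⊆ ℤ × ℤ` of a strict partition. -/
def SDset (sh : List ℕ) : Set (ℤ × ℤ) :=
  {p | ∃ i j : ℕ, 1 ≤ i ∧ i ≤ sh.length ∧ 1 ≤ j ∧ j ≤ sh.getD (i - 1) 0 ∧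
    p.1 = (i : ℤ) ∧ p.2 = (i : ℤ) + (j : ℤ) - 1}

/-- The involution Rothe diagram `D̂(z) = {(i,j) : z(i) > j ≤ i < z(j)}`. -/
def invRothe (z : Equiv.Perm ℤ) : Set (ℤ × ℤ) :=
  {p | p.2 < z p.1 ∧ p.2 ≤ p.1 ∧ p.1 < z p.2}

/-- The tableau `T_λ` with entry `i + j - 1` in box `(i, j)` of `SD_λ`. -/
def Tlam (sh : List ℕ) : STab :=
  (List.range sh.length).map (fun r =>
    (List.range (sh.getD r 0)).map (fun k =>
      (⟨2 * (r : ℤ) + (k : ℤ) + 1, false⟩ : Letter)))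

/-- The permutation `i + m ↦ w(i) + m` (fixing everything outside `m + support`). -/
def shiftPerm (m : ℕ) (w : Equiv.Perm ℤ) : Equiv.Perm ℤ :=
  (Equiv.addLeft (m : ℤ)).permCongr w

/-- `z ∈ S_m`: `z` fixes every point outside `[1, m]`. -/
def SupportedOn (z : Equiv.Perm ℤ) (m : ℕ) : Prop :=
  ∀ x : ℤ, x < 1 ∨ (m : ℤ) < x → z x = x
/-! ## Primed compatible sequences -/

/-- A primed compatible sequence, recorded as the list of its columns `(index; value)`. -/
def IsPrimedCompatible (φ : List (ℕ × Letter)) : Prop :=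
  (∀ p ∈ φ, 0 < p.1 ∧ 0 < p.2.ceil) ∧
  List.Chain' (fun p q : ℕ × Letter => p.1 ≤ q.1 ∧ (p.1 = q.1 → p.2 ≤ q.2)) φ ∧
  (∀ (k l : ℕ) (p : ℕ × Letter), k < l → φ[k]? = some p → φ[l]? = some p →
    p.2.primed = false)

def IsIndexStrict (φ : List (ℕ × Letter)) : Prop :=
  List.Chain' (fun p q : ℕ × Letter => p.1 < q.1) φ

/-! ## Sagan–Worley insertion (orthogonal and symplectic versions) -/

/-- Whether `u` bumps `v`: strict comparison when inserting an unprimed letter into a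
row or a primed letter into a column, weak comparison otherwise. -/
def swBump (isRow : Bool) (u v : Letter) : Bool :=
  if (isRow && !u.primed) || (!isRow && u.primed) then decide (u < v) else decide (u ≤ v)

/-- Column stage of orthogonal Sagan–Worley insertion. -/
def swColO : ℕ → STab → ℕ → Letter → STab × Bool
  | 0, T, _, _ => (T, true)
  | fuel + 1, T, c, u =>
    let occ := (List.range (c + 1)).filterMap (fun r => (entry? T r c).map (fun x => (r, x)))
    match occ.find? (fun p => swBump false u p.2) with
    | none =>
        let r := occ.length
        let u' := if r = c ∧ u.primed then Letter.unprime u else u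
        (setRowG T r ((T.getD r []) ++ [u']), true)
    | some p =>
        if p.1 = c then
          if u.ceil = p.2.ceil then swColO fuel T (c + 1) (Letter.unprime p.2)
          else
            let q := switchPrimes u p.2
            swColO fuel (setEntryG T p.1 c q.1) (c + 1) q.2
        else swColO fuel (setEntryG T p.1 c u) (c + 1) p.2

/-- Row stage of orthogonal Sagan–Worley insertion. -/
def swRowO : ℕ → STab → ℕ → Letter → STab × Bool
  | 0, T, _, _ => (T, true)
  | fuel + 1, T, r, u =>
    let row := T.getD r []
    match row.findIdx? (fun v => swBump true u v) with
    | none =>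
        if row.isEmpty ∧ u.primed then (setRowG T r [Letter.unprime u], true)
        else (setRowG T r (row ++ [u]), false)
    | some k =>
        let v := row.getD k default
        if k = 0 then
          if u.ceil = v.ceil then swColO fuel T (r + 1) (Letter.unprime v)
          else
            let q := switchPrimes u v
            swColO fuel (setRowG T r (row.set 0 q.1)) (r + 1) q.2
        else swRowO fuel (setRowG T r (row.set k u)) (r + 1) v

def swInsertO (T : STab) (u : Letter) : STab × Bool :=
  swRowO (T.flatten.length + T.length + 2) T 0 u

/-- Column stage of symplectic (original) Sagan–Worley insertion. -/
def swColSp : ℕ → STab → ℕ → Letter → STab × Bool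
  | 0, T, _, _ => (T, true)
  | fuel + 1, T, c, u =>
    let occ := (List.range (c + 1)).filterMap (fun r => (entry? T r c).map (fun x => (r, x)))
    match occ.find? (fun p => swBump false u p.2) with
    | none => (setRowG T occ.length ((T.getD occ.length []) ++ [u]), true)
    | some p =>
        if p.1 = c then
          if u.ceil = p.2.ceil then swColSp fuel T (c + 1) (Letter.unprime p.2)
          else swColSp fuel (setEntryG T p.1 c u) (c + 1) p.2
        else swColSp fuel (setEntryG T p.1 c u) (c + 1) p.2

/-- Row stage of symplectic (original) Sagan–Worley insertion. -/
def swRowSp : ℕ → STab → ℕ → Letter → STab × Bool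
  | 0, T, _, _ => (T, true)
  | fuel + 1, T, r, u =>
    let row := T.getD r []
    match row.findIdx? (fun v => swBump true u v) with
    | none => (setRowG T r (row ++ [u]), false)
    | some k =>
        let v := row.getD k default
        if k = 0 then
          if u.ceil = v.ceil then swColSp fuel T (r + 1) (Letter.unprime v)
          else swColSp fuel (setRowG T r (row.set 0 u)) (r + 1) v
        else swRowSp fuel (setRowG T r (row.set k u)) (r + 1) v

def swInsertSp (T : STab) (u : Letter) : STab × Bool :=
  swRowSp (T.flatten.length + T.length + 2) T 0 u

def PSWO (φ : List (ℕ × Letter)) : STab := φ.foldl (fun T p => (swInsertO T p.2).1) []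

def PSWSp (φ : List (ℕ × Letter)) : STab := φ.foldl (fun T p => (swInsertSp T p.2).1) []

def QSWaux (ins : STab → Letter → STab × Bool) : STab → STab → List (ℕ × Letter) → STab
  | _, Q, [] => Q
  | P, Q, p :: rest =>
      let res := ins P p.2
      QSWaux ins res.1 (addBox Q P res.1 ⟨(p.1 : ℤ), res.2⟩) rest

def QSWO (φ : List (ℕ × Letter)) : STab := QSWaux swInsertO [] [] φ

def QSWSp (φ : List (ℕ × Letter)) : STab := QSWaux swInsertSp [] [] φ

/-- Entry `A_{ij}` of the circled matrix of `φ` (forgetting the circles). -/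
def cmEntry (φ : List (ℕ × Letter)) (i j : ℕ) : ℕ :=
  φ.countP (fun p => decide (p.1 = i ∧ p.2.ceil = (j : ℤ)))

/-! ## Shifted mixed insertion (orthogonal and symplectic versions) -/

/-- Tableaux whose entries are signed letters `(ε, u)`, `ε ∈ {+, -}`
(`true` records the sign `-`). -/
abbrev MTab := List (List (Bool × Letter))

def extractO (U : MTab) : STab :=
  U.map (fun row =>
    match row with
    | [] => []
    | (e, x) :: rest => (if e then (⟨x.ceil, true⟩ : Letter) else x) :: rest.map Prod.snd)

def extractSp (U : MTab) : STab := U.map (List.map Prod.snd)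

/-- One mixed insertion, of the pair `β` into row (`isCol = false`) or column
(`isCol = true`) number `idx`; returns the tableau and the added box. -/
def hmIns (sympl : Bool) : ℕ → MTab → Bool → ℕ → Bool × Letter → MTab × (ℕ × ℕ)
  | 0, T, _, _, _ => (T, (0, 0))
  | fuel + 1, T, isCol, idx, β =>
    if isCol then
      let c := idx
      let occ := (List.range (c + 1)).filterMap
        (fun r => (entryG? T r c).map (fun x => (r, x)))
      match occ.find? (fun p => decide (β.2 < p.2.2)) with
      | none =>
          let r := occ.length
          (setRowG T r ((T.getD r []) ++ [β]), (r, c))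
      | some p =>
          if p.1 = c then
            hmIns sympl fuel
              (setEntryG T p.1 c (if sympl then (p.2.1, β.2) else β)) true (c + 1)
              (if sympl then (β.1, ⟨p.2.2.ceil, true⟩) else (p.2.1, ⟨p.2.2.ceil, true⟩))
          else
            hmIns sympl fuel (setEntryG T p.1 c (p.2.1, β.2)) p.2.2.primed
              (if p.2.2.primed then c + 1 else p.1 + 1) (β.1, p.2.2)
    else
      let r := idx
      let row := T.getD r []
      match row.findIdx? (fun p => decide (β.2 < p.2)) with
      | none => (setRowG T r (row ++ [β]), (r, r + row.length))
      | some k =>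
          let q := row.getD k default
          if k = 0 then
            hmIns sympl fuel
              (setRowG T r (row.set 0 (if sympl then (q.1, β.2) else β))) true (r + 1)
              (if sympl then (β.1, ⟨q.2.ceil, true⟩) else (q.1, ⟨q.2.ceil, true⟩))
          else
            hmIns sympl fuel (setRowG T r (row.set k (q.1, β.2))) q.2.primed
              (if q.2.primed then r + k + 1 else r + 1) (β.1, q.2)

def hmInsert (sympl : Bool) (T : MTab) (x : Letter) : MTab × (ℕ × ℕ) :=
  hmIns sympl (2 * T.flatten.length + 4) T false 0 (x.primed, ⟨x.ceil, false⟩)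

def hmAuxCS (sympl : Bool) : MTab → STab → List (ℕ × Letter) → MTab × STab
  | U, Q, [] => (U, Q)
  | U, Q, p :: rest =>
      let res := hmInsert sympl U p.2
      let pos := res.2
      let sgn := ((entryG? res.1 pos.1 pos.2).map Prod.fst).getD false
      let pr : Bool := if sympl then sgn else (decide (pos.1 ≠ pos.2) && sgn)
      hmAuxCS sympl res.1
        (setRowG Q pos.1 ((Q.getD pos.1 []) ++ [(⟨(p.1 : ℤ), pr⟩ : Letter)])) rest

def PHMO (φ : List (ℕ × Letter)) : STab := extractO (hmAuxCS false [] [] φ).1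
def QHMO (φ : List (ℕ × Letter)) : STab := (hmAuxCS false [] [] φ).2
def PHMSp (φ : List (ℕ × Letter)) : STab := extractSp (hmAuxCS true [] [] φ).1
def QHMSp (φ : List (ℕ × Letter)) : STab := (hmAuxCS true [] [] φ).2

/-- A primed word, identified with the primed compatible sequence with
index row `1, 2, …, n`. -/
def wordCS (a : PWord) : List (ℕ × Letter) :=
  ((List.range a.length).zip a).map (fun p => (p.1 + 1, p.2))

/-! ## The transpose of a primed compatible sequence -/

def insSortedCS (p : ℕ × Letter) : List (ℕ × Letter) → List (ℕ × Letter)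
  | [] => [p]
  | q :: rest =>
      if p.1 < q.1 ∨ (p.1 = q.1 ∧ p.2 ≤ q.2) then p :: q :: rest
      else q :: insSortedCS p rest

def sortCS (l : List (ℕ × Letter)) : List (ℕ × Letter) := l.foldr insSortedCS []

/-- `φ^⊤`: move each prime from the value to the index above it, interchange the two
rows, and reorder the columns lexicographically. -/
def transposeCS (φ : List (ℕ × Letter)) : List (ℕ × Letter) :=
  sortCS (φ.map (fun p => (p.2.ceil.toNat, (⟨(p.1 : ℤ), p.2.primed⟩ : Letter))))

theorem sPerm_apply (i x : ℤ) :
    sPerm i x = if x = i then i + 1 else if x = i + 1 then i else x :=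
  Equiv.swap_apply_def i (i + 1) x

theorem sPerm_inv (i : ℤ) : (sPerm i)⁻¹ = sPerm i := Equiv.swap_inv i (i + 1)

theorem sPerm_lt_iff {j x y : ℤ} (h1 : ¬ (x = j ∧ y = j + 1)) (h2 : ¬ (x = j + 1 ∧ y = j)) :
    sPerm j x < sPerm j y ↔ x < y := by
  simp only [sPerm_apply]
  split_ifs <;> omega

/-- Right Demazure multiplication by `s_i`. -/
def rightHecke (σ : Equiv.Perm ℤ) (i : ℤ) : Equiv.Perm ℤ :=
  if σ i < σ (i + 1) then σ * sPerm i else σ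

/-- Left Demazure multiplication by `s_i`. -/
def leftHecke (i : ℤ) (σ : Equiv.Perm ℤ) : Equiv.Perm ℤ :=
  if σ⁻¹ i < σ⁻¹ (i + 1) then sPerm i * σ else σ

theorem leftHecke_eq (i : ℤ) (σ : Equiv.Perm ℤ) : leftHecke i σ = (rightHecke σ⁻¹ i)⁻¹ := by
  unfold leftHecke rightHecke
  split_ifs <;> simp [sPerm_inv]

theorem leftHecke_rightHecke (i j : ℤ) (σ : Equiv.Perm ℤ) :
    leftHecke i (rightHecke σ j) = rightHecke (leftHecke i σ) j := by
  have key : ∀ x, σ⁻¹ (σ x) = x := fun x => by simp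
  have key' : ∀ x, σ (σ⁻¹ x) = x := fun x => by simp
  by_cases hA : σ j = i ∧ σ (j + 1) = i + 1
  · obtain ⟨h1, h2⟩ := hA
    have h3 : σ⁻¹ i = j := by rw [← h1, key]
    have h4 : σ⁻¹ (i + 1) = j + 1 := by rw [← h2, key]
    have e : σ * sPerm j = sPerm i * σ := by
      ext x
      simp only [Equiv.Perm.mul_apply, sPerm_apply]
      have := key x
      by_cases hx : x = j
      · subst hx; simp [h1, h2]
      · by_cases hx' : x = j + 1
        · subst hx'; simp [h1, h2]
        · have n1 : σ x ≠ i := fun h => hx (by rw [← this, h, h3])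
          have n2 : σ x ≠ i + 1 := fun h => hx' (by rw [← this, h, h4])
          simp [hx, hx', n1, n2]
    have l1 : rightHecke σ j = sPerm i * σ := by
      unfold rightHecke; rw [if_pos (by omega), e]
    have l2 : leftHecke i σ = sPerm i * σ := by
      unfold leftHecke; rw [if_pos (by omega)]
    rw [l1, l2]
    unfold leftHecke rightHecke
    rw [if_neg, if_neg]
    · simp [h1, h2, sPerm_apply]
    · rw [← e]
      rw [mul_inv_rev, sPerm_inv, Equiv.Perm.mul_apply, Equiv.Perm.mul_apply, h3, h4]
      simp [sPerm_apply]
  by_cases hB : σ j = i + 1 ∧ σ (j + 1) = i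
  · obtain ⟨h1, h2⟩ := hB
    have h3 : σ⁻¹ (i + 1) = j := by rw [← h1, key]
    have h4 : σ⁻¹ i = j + 1 := by rw [← h2, key]
    have l1 : rightHecke σ j = σ := by
      unfold rightHecke; rw [if_neg (by omega)]
    have l2 : leftHecke i σ = σ := by
      unfold leftHecke; rw [if_neg (by omega)]
    rw [l1, l2, l1]
  have hA' : ¬ (σ⁻¹ i = j ∧ σ⁻¹ (i + 1) = j + 1) := by
    rintro ⟨h1, h2⟩
    exact hA ⟨by rw [← h1, key'], by rw [← h2, key']⟩
  have hB' : ¬ (σ⁻¹ i = j + 1 ∧ σ⁻¹ (i + 1) = j) := by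
    rintro ⟨h1, h2⟩
    exact hB ⟨by rw [← h2, key'], by rw [← h1, key']⟩
  have c1 : (σ * sPerm j)⁻¹ i < (σ * sPerm j)⁻¹ (i + 1) ↔ σ⁻¹ i < σ⁻¹ (i + 1) := by
    simp only [mul_inv_rev, sPerm_inv, Equiv.Perm.mul_apply]
    exact sPerm_lt_iff hA' hB'
  have c2 : (sPerm i * σ) j < (sPerm i * σ) (j + 1) ↔ σ j < σ (j + 1) := by
    simp only [Equiv.Perm.mul_apply]
    exact sPerm_lt_iff hA hB
  unfold rightHecke
  rw [leftHecke, leftHecke]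
  by_cases p : σ j < σ (j + 1) <;> by_cases q : σ⁻¹ i < σ⁻¹ (i + 1)
  · rw [if_pos p, if_pos q, if_pos (c1.2 q), if_pos (c2.2 p), mul_assoc]
  · rw [if_pos p, if_neg q, if_neg (fun h => q (c1.1 h)), if_pos p]
  · rw [if_neg p, if_pos q, if_neg (fun h => p (c2.1 h))]
  · rw [if_neg p, if_neg q, if_neg p]

theorem rightHecke_comm (σ : Equiv.Perm ℤ) {i j : ℤ} (h : i + 2 ≤ j ∨ j + 2 ≤ i) :
    rightHecke (rightHecke σ i) j = rightHecke (rightHecke σ j) i := by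
  have e : sPerm i * sPerm j = sPerm j * sPerm i := by
    ext x
    simp only [Equiv.Perm.mul_apply, sPerm_apply]
    split_ifs <;> omega
  have v1 : sPerm i j = j := by rw [sPerm_apply]; split_ifs <;> omega
  have v2 : sPerm i (j + 1) = j + 1 := by rw [sPerm_apply]; split_ifs <;> omega
  have v3 : sPerm j i = i := by rw [sPerm_apply]; split_ifs <;> omega
  have v4 : sPerm j (i + 1) = i + 1 := by rw [sPerm_apply]; split_ifs <;> omega
  unfold rightHecke
  by_cases p : σ j < σ (j + 1) <;> by_cases q : σ i < σ (i + 1) <;>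
    simp [p, q, v1, v2, v3, v4, mul_assoc, e]

theorem rightHecke_braid (σ : Equiv.Perm ℤ) (i : ℤ) :
    rightHecke (rightHecke (rightHecke σ i) (i + 1)) i =
      rightHecke (rightHecke (rightHecke σ (i + 1)) i) (i + 1) := by
  have e : sPerm i * (sPerm (i + 1) * sPerm i) = sPerm (i + 1) * (sPerm i * sPerm (i + 1)) := by
    ext x
    simp only [Equiv.Perm.mul_apply, sPerm_apply]
    split_ifs <;> omega
  have v1 : sPerm i i = i + 1 := by simp [sPerm_apply]
  have v2 : sPerm i (i + 1) = i := by simp [sPerm_apply]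
  have v3 : sPerm i (i + 1 + 1) = i + 1 + 1 := by rw [sPerm_apply]; split_ifs <;> omega
  have v4 : sPerm (i + 1) i = i := by rw [sPerm_apply]; split_ifs <;> omega
  have v5 : sPerm (i + 1) (i + 1) = i + 1 + 1 := by simp [sPerm_apply]
  have v6 : sPerm (i + 1) (i + 1 + 1) = i + 1 := by simp [sPerm_apply]
  have n1 : σ i ≠ σ (i + 1) := fun h => by simpa using σ.injective h
  have n2 : σ (i + 1) ≠ σ (i + 1 + 1) := fun h => by simpa using σ.injective h
  have n3 : σ i ≠ σ (i + 1 + 1) := fun h => by have := σ.injective h; omega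
  unfold rightHecke
  by_cases p : σ i < σ (i + 1) <;> by_cases q : σ (i + 1) < σ (i + 1 + 1) <;>
    by_cases r : σ i < σ (i + 1 + 1) <;>
    first
    | (exfalso; omega)
    | (simp [p, q, r, v1, v2, v3, v4, v5, v6, mul_assoc, e]; done)
    | (simp [p, q, r, v1, v2, v3, v4, v5, v6, mul_assoc]; intro h; exfalso; omega)

theorem leftHecke_comm (σ : Equiv.Perm ℤ) {i j : ℤ} (h : i + 2 ≤ j ∨ j + 2 ≤ i) :
    leftHecke j (leftHecke i σ) = leftHecke i (leftHecke j σ) := by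
  simp [leftHecke_eq, rightHecke_comm _ h]

theorem leftHecke_braid (σ : Equiv.Perm ℤ) (i : ℤ) :
    leftHecke i (leftHecke (i + 1) (leftHecke i σ)) =
      leftHecke (i + 1) (leftHecke i (leftHecke (i + 1) σ)) := by
  simp [leftHecke_eq, rightHecke_braid]

/-- Demazure conjugation by `s_i`. -/
def invStep (z : Equiv.Perm ℤ) (i : ℤ) : Equiv.Perm ℤ := leftHecke i (rightHecke z i)

theorem heckeProd_snoc (w : List ℤ) (i : ℤ) :
    heckeProd (w ++ [i]) = rightHecke (heckeProd w) i := by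
  simp only [heckeProd, List.foldl_append, List.foldl_cons, List.foldl_nil]
  rfl

theorem heckeProd_cons (i : ℤ) (w : List ℤ) :
    heckeProd (i :: w) = leftHecke i (heckeProd w) := by
  induction w using List.reverseRecOn with
  | nil =>
    simp [heckeProd, leftHecke]
  | append_singleton w j ih =>
    rw [← List.cons_append, heckeProd_snoc, heckeProd_snoc, ih, leftHecke_rightHecke]

theorem invHecke_snoc (a : List ℤ) (i : ℤ) :
    invHecke (a ++ [i]) = invStep (invHecke a) i := by
  cases a with
  | nil =>
    simp [invHecke, invStep, heckeProd, rightHecke, leftHecke, sPerm_apply, sPerm_inv]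
  | cons x a =>
    simp only [invHecke, invStep]
    rw [← heckeProd_snoc, ← heckeProd_cons]
    simp

theorem invHecke_nil : invHecke [] = 1 := by simp [invHecke, heckeProd]

theorem invHecke_eq_foldl (a : List ℤ) : invHecke a = a.foldl invStep 1 := by
  induction a using List.reverseRecOn with
  | nil => simp [invHecke_nil]
  | append_singleton a i ih => rw [invHecke_snoc, ih]; simp

theorem invHecke_append (a b : List ℤ) : invHecke (a ++ b) = b.foldl invStep (invHecke a) := by
  simp [invHecke_eq_foldl]

theorem invStep_inv (z : Equiv.Perm ℤ) (i : ℤ) (hz : z⁻¹ = z) :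
    (invStep z i)⁻¹ = invStep z i := by
  conv_rhs => rw [invStep, leftHecke_rightHecke]
  rw [invStep, leftHecke_eq, inv_inv, leftHecke_eq, hz]

theorem invHecke_inv (a : List ℤ) : (invHecke a)⁻¹ = invHecke a := by
  induction a using List.reverseRecOn with
  | nil => simp [invHecke_nil]
  | append_singleton a i ih => rw [invHecke_snoc]; exact invStep_inv _ _ ih

theorem invStep_comm (z : Equiv.Perm ℤ) {i j : ℤ} (h : i + 2 ≤ j ∨ j + 2 ≤ i) :
    invStep (invStep z i) j = invStep (invStep z j) i := by
  unfold invStep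
  rw [← leftHecke_rightHecke, ← leftHecke_rightHecke, leftHecke_comm _ h, rightHecke_comm _ h]

theorem invStep_braid (z : Equiv.Perm ℤ) (i : ℤ) :
    invStep (invStep (invStep z i) (i + 1)) i =
      invStep (invStep (invStep z (i + 1)) i) (i + 1) := by
  unfold invStep
  simp only [← leftHecke_rightHecke]
  rw [leftHecke_braid, rightHecke_braid]

theorem invStep_of_lt_of_fixed {z : Equiv.Perm ℤ} {i : ℤ} (hz : z⁻¹ = z)
    (h1 : z i = i) (h2 : z (i + 1) = i + 1) : invStep z i = z * sPerm i := by
  rw [invStep, rightHecke, if_pos (by omega), leftHecke, if_neg]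
  rw [mul_inv_rev, hz, sPerm_inv, Equiv.Perm.mul_apply, Equiv.Perm.mul_apply, h1, h2]
  simp [sPerm_apply]

theorem invStep_of_lt {z : Equiv.Perm ℤ} {i : ℤ} (hz : z⁻¹ = z) (h : z i < z (i + 1))
    (h1 : ¬ (z i = i ∧ z (i + 1) = i + 1)) : invStep z i = sPerm i * z * sPerm i := by
  rw [invStep, rightHecke, if_pos h, leftHecke, if_pos, mul_assoc]
  simp only [mul_inv_rev, hz, sPerm_inv, Equiv.Perm.mul_apply]
  rw [sPerm_lt_iff h1]
  · exact h
  · omega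

theorem invStep_of_not_lt {z : Equiv.Perm ℤ} {i : ℤ} (hz : z⁻¹ = z) (h : ¬ z i < z (i + 1)) :
    invStep z i = z := by
  rw [invStep, rightHecke, if_neg h, leftHecke, if_neg (by rwa [hz])]

theorem invStep_apply {z : Equiv.Perm ℤ} {i : ℤ} (hz : z⁻¹ = z) (h : z i < z (i + 1)) (x : ℤ) :
    invStep z i x = if z i = i ∧ z (i + 1) = i + 1 then z (sPerm i x)
      else sPerm i (z (sPerm i x)) := by
  split_ifs with h1
  · rw [invStep_of_lt_of_fixed hz h1.1 h1.2]; rfl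
  · rw [invStep_of_lt hz h h1]; rfl

/-- Whether the letter `x` may follow a primed involution word for `y`. -/
def StepOk (y : Equiv.Perm ℤ) (x : Letter) : Prop :=
  y x.ceil < y (x.ceil + 1) ∧ (x.primed = true → y x.ceil = x.ceil ∧ y (x.ceil + 1) = x.ceil + 1)

instance (y : Equiv.Perm ℤ) (x : Letter) : Decidable (StepOk y x) := by
  unfold StepOk; infer_instance

/-- The involution reached from `y` by reading a primed word, if every step is permitted. -/
def run (y : Equiv.Perm ℤ) : PWord → Option (Equiv.Perm ℤ)
  | [] => some y
  | x :: a => if StepOk y x then run (invStep y x.ceil) a else none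

theorem run_append (y : Equiv.Perm ℤ) (a b : PWord) :
    run y (a ++ b) = (run y a).bind (fun y' => run y' b) := by
  induction a generalizing y with
  | nil => rfl
  | cons x a ih =>
    simp only [List.cons_append, run]
    split_ifs
    · exact ih _
    · rfl

theorem run_inv {y y' : Equiv.Perm ℤ} {a : PWord} (hy : y⁻¹ = y) (h : run y a = some y') :
    y'⁻¹ = y' := by
  induction a generalizing y with
  | nil => simp only [run, Option.some.injEq] at h; rw [← h, hy]
  | cons x a ih =>
    simp only [run] at h
    split_ifs at h
    exact ih (invStep_inv _ _ hy) h

theorem run_eq_foldl {y y' : Equiv.Perm ℤ} {a : PWord} (h : run y a = some y') :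
    (unprimeWord a).foldl invStep y = y' := by
  induction a generalizing y with
  | nil => simpa [run, unprimeWord] using h
  | cons x a ih =>
    simp only [run] at h
    split_ifs at h
    exact ih h

theorem invHecke_of_run {y : Equiv.Perm ℤ} {a : PWord} (h : run 1 a = some y) :
    invHecke (unprimeWord a) = y := by
  rw [invHecke_eq_foldl, run_eq_foldl h]

theorem run_isSome_iff (y : Equiv.Perm ℤ) (a : PWord) :
    (run y a).isSome ↔ ∀ (k : ℕ) (x : Letter), a[k]? = some x →
      StepOk ((unprimeWord (a.take k)).foldl invStep y) x := by
  induction a generalizing y with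
  | nil => simp [run]
  | cons x a ih =>
    simp only [run]
    constructor
    · intro h k u hu
      split_ifs at h with h1
      · cases k with
        | zero => simp at hu; subst hu; simpa [unprimeWord] using h1
        | succ k => exact (ih _).1 h k u (by simpa using hu)
      · simp at h
    · intro h
      have h0 := h 0 x rfl
      simp only [List.take_zero, unprimeWord, List.map_nil, List.foldl_nil] at h0
      rw [if_pos h0, ih]
      exact fun k u hu => h (k + 1) u (by simpa using hu)

theorem mem_RinvPlus_iff {z : Equiv.Perm ℤ} {a : PWord} :
    a ∈ RinvPlus z ↔
      run 1 a = some z ∧ ∀ b : List ℤ, invHecke b = z → a.length ≤ b.length := by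
  constructor
  · rintro ⟨⟨h1, h2⟩, h3⟩
    have h4 : ∀ b : List ℤ, invHecke b = z → a.length ≤ b.length := fun b hb => by
      simpa [unprimeWord] using h2 b hb
    refine ⟨?_, h4⟩
    have h5 : (run 1 a).isSome := by
      rw [run_isSome_iff]
      intro k x hx
      have hk : k < a.length := by
        by_contra hk
        rw [List.getElem?_eq_none (by omega)] at hx
        simp at hx
      have hspl : unprimeWord a =
          unprimeWord (a.take k) ++ [x.ceil] ++ unprimeWord (a.drop (k + 1)) := by
        simp only [unprimeWord, List.append_assoc]
        conv_lhs => rw [← List.take_append_drop k a, List.drop_eq_getElem_cons hk]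
        rw [List.getElem?_eq_getElem hk] at hx
        simp at hx
        simp [hx]
      refine ⟨?_, fun hp => ?_⟩
      · rw [← invHecke_eq_foldl]
        by_contra hcon
        have := h4 (unprimeWord (a.take k) ++ unprimeWord (a.drop (k + 1))) (by
          rw [← h1, hspl, invHecke_append, invHecke_append, invHecke_append]
          simp only [List.foldl_cons, List.foldl_nil]
          rw [invStep_of_not_lt (invHecke_inv _) hcon])
        simp [unprimeWord] at this
        omega
      · obtain ⟨u, hu, hu1, hu2⟩ := h3 k x hx hp
        have : u = x.ceil := by
          simp [unprimeWord, hx] at hu; exact hu.symm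
        subst this
        rw [← invHecke_eq_foldl]
        simp only [unprimeWord, List.map_take] at *
        exact ⟨hu1, hu2⟩
    obtain ⟨y, hy⟩ := Option.isSome_iff_exists.1 h5
    rw [hy, ← invHecke_of_run hy, h1]
  · rintro ⟨h1, h2⟩
    refine ⟨⟨invHecke_of_run h1, fun b hb => by simpa [unprimeWord] using h2 b hb⟩, ?_⟩
    intro k x hx hp
    have h3 := (run_isSome_iff 1 a).1 (by rw [h1]; rfl) k x hx
    rw [← invHecke_eq_foldl] at h3
    refine ⟨x.ceil, by simp [unprimeWord, hx], ?_⟩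
    simpa only [unprimeWord, List.map_take] using h3.2 hp

/-- Words that can be exchanged in the middle of any primed involution word. -/
def Eqv (a b : PWord) : Prop :=
  a.length = b.length ∧ ∀ y : Equiv.Perm ℤ, y⁻¹ = y → run y a = run y b

theorem Eqv.refl (a : PWord) : Eqv a a := ⟨rfl, fun _ _ => rfl⟩

theorem Eqv.symm {a b : PWord} (h : Eqv a b) : Eqv b a :=
  ⟨h.1.symm, fun y hy => (h.2 y hy).symm⟩

theorem Eqv.trans {a b c : PWord} (h : Eqv a b) (h' : Eqv b c) : Eqv a c :=
  ⟨h.1.trans h'.1, fun y hy => (h.2 y hy).trans (h'.2 y hy)⟩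

theorem Eqv.append {a a' b b' : PWord} (h : Eqv a a') (h' : Eqv b b') :
    Eqv (a ++ b) (a' ++ b') := by
  refine ⟨by simp [h.1, h'.1], fun y hy => ?_⟩
  rw [run_append, run_append, h.2 y hy]
  cases hr : run y a' with
  | none => rfl
  | some y' => exact h'.2 y' (run_inv hy hr)

theorem Eqv.cons (x : Letter) {a b : PWord} (h : Eqv a b) : Eqv (x :: a) (x :: b) :=
  (Eqv.refl [x]).append h

/-- Words that can be exchanged at the start of any primed involution word. -/
def EqvFront (a b : PWord) : Prop := a.length = b.length ∧ run 1 a = run 1 b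

theorem EqvFront.symm {a b : PWord} (h : EqvFront a b) : EqvFront b a := ⟨h.1.symm, h.2.symm⟩

theorem EqvFront.trans {a b c : PWord} (h : EqvFront a b) (h' : EqvFront b c) : EqvFront a c :=
  ⟨h.1.trans h'.1, h.2.trans h'.2⟩

theorem Eqv.front {a b : PWord} (h : Eqv a b) : EqvFront a b := ⟨h.1, h.2 1 inv_one⟩

theorem EqvFront.append {a a' b b' : PWord} (h : EqvFront a a') (h' : Eqv b b') :
    EqvFront (a ++ b) (a' ++ b') := by
  refine ⟨by simp [h.1, h'.1], ?_⟩
  rw [run_append, run_append, h.2]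
  cases hr : run 1 a' with
  | none => rfl
  | some y' => exact h'.2 y' (run_inv inv_one hr)

theorem EqvFront.mem_iff {a b : PWord} (h : EqvFront a b) (z : Equiv.Perm ℤ) :
    a ∈ RinvPlus z ↔ b ∈ RinvPlus z := by
  rw [mem_RinvPlus_iff, mem_RinvPlus_iff, h.1, h.2]

theorem Perm.apply_eq_iff_of_inv {y : Equiv.Perm ℤ} (hy : y⁻¹ = y) (p q : ℤ) :
    y p = q ↔ y q = p := by
  constructor <;> rintro rfl <;> nth_rewrite 1 [← hy] <;> simp

/-- Letters whose ceilings differ by at least two. -/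
def Far (x y : Letter) : Prop := x.ceil + 2 ≤ y.ceil ∨ y.ceil + 2 ≤ x.ceil

theorem Far.symm {x y : Letter} (h : Far x y) : Far y x := Or.symm h

theorem stepOk_swap_aux {y : Equiv.Perm ℤ} (hy : y⁻¹ = y) {a b : Letter} (h : Far a b)
    (h1 : StepOk y a) (h2 : StepOk (invStep y a.ceil) b) :
    StepOk y b ∧ StepOk (invStep y b.ceil) a := by
  obtain ⟨a, pa⟩ := a
  obtain ⟨b, pb⟩ := b
  simp only [StepOk, Far] at *
  have i1 := Perm.apply_eq_iff_of_inv hy a a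
  have i2 := Perm.apply_eq_iff_of_inv hy a b
  have i3 := Perm.apply_eq_iff_of_inv hy a (b + 1)
  have i4 := Perm.apply_eq_iff_of_inv hy (a + 1) b
  have i5 := Perm.apply_eq_iff_of_inv hy (a + 1) (b + 1)
  have j1 : y b ≠ y (b + 1) := fun h => by simpa using y.injective h
  rw [invStep_apply hy h1.1, invStep_apply hy h1.1] at h2
  have e1 : sPerm a b = b := by rw [sPerm_apply]; split_ifs <;> omega
  have e2 : sPerm a (b + 1) = b + 1 := by rw [sPerm_apply]; split_ifs <;> omega
  have e3 : sPerm b a = a := by rw [sPerm_apply]; split_ifs <;> omega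
  have e4 : sPerm b (a + 1) = a + 1 := by rw [sPerm_apply]; split_ifs <;> omega
  rw [e1, e2] at h2
  obtain ⟨h1, h1'⟩ := h1
  obtain ⟨h2, h2'⟩ := h2
  have k1 : y b < y (b + 1) := by
    simp only [sPerm_apply] at h2
    split_ifs at h2 <;> omega
  refine ⟨⟨k1, fun hp => ?_⟩, ?_⟩
  · have := h2' hp
    simp only [sPerm_apply] at this
    split_ifs at this <;> omega
  · rw [invStep_apply hy k1, invStep_apply hy k1, e3, e4]
    have hns : ¬ (y b = a ∧ y (b + 1) = a + 1) := by
      rintro ⟨q1, q2⟩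
      have q3 := i2.2 q1
      rw [q1, q2, if_neg (fun q => by omega)] at h2
      simp [sPerm_apply] at h2
      split_ifs at h2 <;> omega
    refine ⟨?_, fun hp => ?_⟩
    · split_ifs
      · exact h1
      · rw [sPerm_lt_iff (fun q => hns ⟨i2.1 q.1, i5.1 q.2⟩) (fun q => by rw [q.1, q.2] at h1; omega)]
        exact h1
    · obtain ⟨h3, h4⟩ := h1' hp
      rw [h3, h4, e3, e4]
      simp

theorem Eqv.swap {a b : Letter} (h : Far a b) : Eqv [a, b] [b, a] := by
  refine ⟨rfl, fun y hy => ?_⟩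
  simp only [run]
  by_cases h1 : StepOk y a ∧ StepOk (invStep y a.ceil) b
  · have h2 := stepOk_swap_aux hy h h1.1 h1.2
    rw [if_pos h1.1, if_pos h1.2, if_pos h2.1, if_pos h2.2, invStep_comm _ h]
  · have h2 : ¬ (StepOk y b ∧ StepOk (invStep y b.ceil) a) :=
      fun h3 => h1 (stepOk_swap_aux hy h.symm h3.1 h3.2)
    trans none <;> split_ifs <;> first | rfl | (exfalso; tauto)

theorem invStep_low {y : Equiv.Perm ℤ} (hy : y⁻¹ = y) {i : ℤ} (h : y i < y (i + 1)) :
    (y i = i ∧ y (i + 1) = i + 1 ∧ invStep y i i = i + 1 ∧ invStep y i (i + 1) = i ∧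
      invStep y i (i + 1 + 1) = y (i + 1 + 1)) ∨
    (¬ (y i = i ∧ y (i + 1) = i + 1) ∧ invStep y i i = sPerm i (y (i + 1)) ∧
      invStep y i (i + 1) = sPerm i (y i) ∧
      invStep y i (i + 1 + 1) = sPerm i (y (i + 1 + 1))) := by
  have v1 : sPerm i i = i + 1 := by simp [sPerm_apply]
  have v2 : sPerm i (i + 1) = i := by simp [sPerm_apply]
  have v3 : sPerm i (i + 1 + 1) = i + 1 + 1 := by rw [sPerm_apply]; split_ifs <;> omega
  simp only [invStep_apply hy h, v1, v2, v3]
  by_cases h1 : y i = i ∧ y (i + 1) = i + 1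
  · left; simp [h1]
  · right; simp [h1]

theorem invStep_high {y : Equiv.Perm ℤ} (hy : y⁻¹ = y) {i : ℤ} (h : y (i + 1) < y (i + 1 + 1)) :
    (y (i + 1) = i + 1 ∧ y (i + 1 + 1) = i + 1 + 1 ∧ invStep y (i + 1) i = y i ∧
      invStep y (i + 1) (i + 1) = i + 1 + 1 ∧ invStep y (i + 1) (i + 1 + 1) = i + 1) ∨
    (¬ (y (i + 1) = i + 1 ∧ y (i + 1 + 1) = i + 1 + 1) ∧
      invStep y (i + 1) i = sPerm (i + 1) (y i) ∧
      invStep y (i + 1) (i + 1) = sPerm (i + 1) (y (i + 1 + 1)) ∧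
      invStep y (i + 1) (i + 1 + 1) = sPerm (i + 1) (y (i + 1))) := by
  have v4 : sPerm (i + 1) i = i := by rw [sPerm_apply]; split_ifs <;> omega
  have v5 : sPerm (i + 1) (i + 1) = i + 1 + 1 := by simp [sPerm_apply]
  have v6 : sPerm (i + 1) (i + 1 + 1) = i + 1 := by simp [sPerm_apply]
  simp only [invStep_apply hy h, v4, v5, v6]
  by_cases h1 : y (i + 1) = i + 1 ∧ y (i + 1 + 1) = i + 1 + 1
  · left; simp [h1]
  · right; simp [h1]

theorem sPerm_cases (i x : ℤ) : (x = i ∧ sPerm i x = i + 1) ∨ (x = i + 1 ∧ sPerm i x = i) ∨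
    (x ≠ i ∧ x ≠ i + 1 ∧ sPerm i x = x) := by
  rw [sPerm_apply]; split_ifs <;> omega

/-- The local form of an involution on three consecutive points. -/
theorem involution_three {y : Equiv.Perm ℤ} (hy : y⁻¹ = y) (i : ℤ) :
    (y i = i + 1 ↔ y (i + 1) = i) ∧ (y i = i + 1 + 1 ↔ y (i + 1 + 1) = i) ∧
    (y (i + 1) = i + 1 + 1 ↔ y (i + 1 + 1) = i + 1) ∧ y i ≠ y (i + 1) ∧
    y (i + 1) ≠ y (i + 1 + 1) ∧ y i ≠ y (i + 1 + 1) := by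
  refine ⟨Perm.apply_eq_iff_of_inv hy _ _, Perm.apply_eq_iff_of_inv hy _ _,
    Perm.apply_eq_iff_of_inv hy _ _, fun h => ?_, fun h => ?_, fun h => ?_⟩ <;>
  · have := y.injective h
    omega

/-- The involutions after which `i, i+1, i` and `i+1, i, i+1` are both permitted. -/
def BraidOk (y : Equiv.Perm ℤ) (i : ℤ) : Prop :=
  y i < y (i + 1) ∧ y (i + 1) < y (i + 1 + 1) ∧
    ¬ (y i = i ∧ y (i + 1) = i + 1 ∧ y (i + 1 + 1) = i + 1 + 1)

theorem braidOk_of_low {y : Equiv.Perm ℤ} (hy : y⁻¹ = y) {i : ℤ} (h1 : y i < y (i + 1))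
    (h2 : invStep y i (i + 1) < invStep y i (i + 1 + 1))
    (h3 : invStep (invStep y i) (i + 1) i < invStep (invStep y i) (i + 1) (i + 1)) :
    BraidOk y i := by
  obtain ⟨e1, e2, e3, n1, n2, n3⟩ := involution_three hy i
  have q1 := invStep_low hy h1
  have q2 := invStep_high (invStep_inv y i hy) h2
  have s1 := sPerm_cases i (y i)
  have s2 := sPerm_cases i (y (i + 1))
  have s3 := sPerm_cases i (y (i + 1 + 1))
  have s4 := sPerm_cases (i + 1) (invStep y i i)
  have s6 := sPerm_cases (i + 1) (invStep y i (i + 1 + 1))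
  unfold BraidOk
  refine ⟨h1, ?_, ?_⟩
  · rcases q1 with q1 | q1 <;> rcases q2 with q2 | q2 <;> omega
  · rintro ⟨f1, f2, f3⟩
    rcases q1 with q1 | q1 <;> rcases q2 with q2 | q2 <;> omega

theorem braidOk_of_high {y : Equiv.Perm ℤ} (hy : y⁻¹ = y) {i : ℤ} (h1 : y (i + 1) < y (i + 1 + 1))
    (h2 : invStep y (i + 1) i < invStep y (i + 1) (i + 1))
    (h3 : invStep (invStep y (i + 1)) i (i + 1) < invStep (invStep y (i + 1)) i (i + 1 + 1)) :
    BraidOk y i := by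
  obtain ⟨e1, e2, e3, n1, n2, n3⟩ := involution_three hy i
  have q1 := invStep_high hy h1
  have q2 := invStep_low (invStep_inv y (i + 1) hy) h2
  have s1 := sPerm_cases (i + 1) (y i)
  have s2 := sPerm_cases (i + 1) (y (i + 1))
  have s3 := sPerm_cases (i + 1) (y (i + 1 + 1))
  have s4 := sPerm_cases i (invStep y (i + 1) i)
  have s6 := sPerm_cases i (invStep y (i + 1) (i + 1 + 1))
  unfold BraidOk
  refine ⟨?_, h1, ?_⟩
  · rcases q1 with q1 | q1 <;> rcases q2 with q2 | q2 <;> omega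
  · rintro ⟨f1, f2, f3⟩
    rcases q1 with q1 | q1 <;> rcases q2 with q2 | q2 <;> omega

theorem BraidOk.low {y : Equiv.Perm ℤ} (hy : y⁻¹ = y) {i : ℤ} (h : BraidOk y i) :
    invStep y i (i + 1) < invStep y i (i + 1 + 1) ∧
    ¬ (invStep y i (i + 1) = i + 1 ∧ invStep y i (i + 1 + 1) = i + 1 + 1) ∧
    invStep (invStep y i) (i + 1) i < invStep (invStep y i) (i + 1) (i + 1) ∧
    (invStep (invStep y i) (i + 1) i = i ∧ invStep (invStep y i) (i + 1) (i + 1) = i + 1 ↔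
      y (i + 1) = i + 1 ∧ y (i + 1 + 1) = i + 1 + 1) := by
  obtain ⟨h1, h2, h3⟩ := h
  obtain ⟨e1, e2, e3, n1, n2, n3⟩ := involution_three hy i
  have q1 := invStep_low hy h1
  have s1 := sPerm_cases i (y i)
  have s2 := sPerm_cases i (y (i + 1))
  have s3 := sPerm_cases i (y (i + 1 + 1))
  have k1 : invStep y i (i + 1) < invStep y i (i + 1 + 1) := by
    rcases q1 with q1 | q1 <;> omega
  have q2 := invStep_high (invStep_inv y i hy) k1
  have s4 := sPerm_cases (i + 1) (invStep y i i)
  have s6 := sPerm_cases (i + 1) (invStep y i (i + 1 + 1))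
  refine ⟨k1, ?_, ?_, ?_⟩
  · rcases q1 with q1 | q1 <;> omega
  · rcases q1 with q1 | q1 <;> rcases q2 with q2 | q2 <;> omega
  · constructor
    · rintro ⟨f1, f2⟩
      rcases q1 with q1 | q1 <;> rcases q2 with q2 | q2 <;> omega
    · rintro ⟨f1, f2⟩
      rcases q1 with q1 | q1 <;> rcases q2 with q2 | q2 <;> omega

theorem BraidOk.high {y : Equiv.Perm ℤ} (hy : y⁻¹ = y) {i : ℤ} (h : BraidOk y i) :
    invStep y (i + 1) i < invStep y (i + 1) (i + 1) ∧
    ¬ (invStep y (i + 1) i = i ∧ invStep y (i + 1) (i + 1) = i + 1) ∧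
    invStep (invStep y (i + 1)) i (i + 1) < invStep (invStep y (i + 1)) i (i + 1 + 1) ∧
    (invStep (invStep y (i + 1)) i (i + 1) = i + 1 ∧
        invStep (invStep y (i + 1)) i (i + 1 + 1) = i + 1 + 1 ↔
      y i = i ∧ y (i + 1) = i + 1) := by
  obtain ⟨h1, h2, h3⟩ := h
  obtain ⟨e1, e2, e3, n1, n2, n3⟩ := involution_three hy i
  have q1 := invStep_high hy h2
  have s1 := sPerm_cases (i + 1) (y i)
  have s2 := sPerm_cases (i + 1) (y (i + 1))
  have s3 := sPerm_cases (i + 1) (y (i + 1 + 1))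
  have k1 : invStep y (i + 1) i < invStep y (i + 1) (i + 1) := by
    rcases q1 with q1 | q1 <;> omega
  have q2 := invStep_low (invStep_inv y (i + 1) hy) k1
  have s4 := sPerm_cases i (invStep y (i + 1) i)
  have s6 := sPerm_cases i (invStep y (i + 1) (i + 1 + 1))
  refine ⟨k1, ?_, ?_, ?_⟩
  · rcases q1 with q1 | q1 <;> omega
  · rcases q1 with q1 | q1 <;> rcases q2 with q2 | q2 <;> omega
  · constructor
    · rintro ⟨f1, f2⟩
      rcases q1 with q1 | q1 <;> rcases q2 with q2 | q2 <;> omega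
    · rintro ⟨f1, f2⟩
      rcases q1 with q1 | q1 <;> rcases q2 with q2 | q2 <;> omega

theorem run_low_high_low {y : Equiv.Perm ℤ} (hy : y⁻¹ = y) (i : ℤ) (p s q : Bool) :
    (run y [⟨i, q⟩, ⟨i + 1, s⟩, ⟨i, p⟩]).isSome ↔ BraidOk y i ∧ s = false ∧
      (q = true → y i = i ∧ y (i + 1) = i + 1) ∧
      (p = true → y (i + 1) = i + 1 ∧ y (i + 1 + 1) = i + 1 + 1) := by
  simp only [run]
  constructor
  · intro h
    split_ifs at h with h1 h2 h3
    · have hb := braidOk_of_low hy h1.1 h2.1 h3.1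
      have hl := hb.low hy
      refine ⟨hb, ?_, h1.2, fun hp => hl.2.2.2.1 (h3.2 hp)⟩
      cases s
      · rfl
      · exact absurd (h2.2 rfl) hl.2.1
    all_goals simp at h
  · rintro ⟨hb, rfl, h1, h2⟩
    have hl := hb.low hy
    have k1 : StepOk y ⟨i, q⟩ := ⟨hb.1, h1⟩
    have k2 : StepOk (invStep y i) ⟨i + 1, false⟩ := ⟨hl.1, by simp⟩
    have k3 : StepOk (invStep (invStep y i) (i + 1)) ⟨i, p⟩ :=
      ⟨hl.2.2.1, fun hp => hl.2.2.2.2 (h2 hp)⟩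
    rw [if_pos k1, if_pos k2, if_pos k3]
    rfl

theorem run_high_low_high {y : Equiv.Perm ℤ} (hy : y⁻¹ = y) (i : ℤ) (p s q : Bool) :
    (run y [⟨i + 1, p⟩, ⟨i, s⟩, ⟨i + 1, q⟩]).isSome ↔ BraidOk y i ∧ s = false ∧
      (q = true → y i = i ∧ y (i + 1) = i + 1) ∧
      (p = true → y (i + 1) = i + 1 ∧ y (i + 1 + 1) = i + 1 + 1) := by
  simp only [run]
  constructor
  · intro h
    split_ifs at h with h1 h2 h3
    · have hb := braidOk_of_high hy h1.1 h2.1 h3.1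
      have hl := hb.high hy
      refine ⟨hb, ?_, fun hp => hl.2.2.2.1 (h3.2 hp), h1.2⟩
      cases s
      · rfl
      · exact absurd (h2.2 rfl) hl.2.1
    all_goals simp at h
  · rintro ⟨hb, rfl, h1, h2⟩
    have hl := hb.high hy
    have k1 : StepOk y ⟨i + 1, p⟩ := ⟨hb.2.1, h2⟩
    have k2 : StepOk (invStep y (i + 1)) ⟨i, false⟩ := ⟨hl.1, by simp⟩
    have k3 : StepOk (invStep (invStep y (i + 1)) i) ⟨i + 1, q⟩ :=
      ⟨hl.2.2.1, fun hp => hl.2.2.2.2 (h1 hp)⟩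
    rw [if_pos k1, if_pos k2, if_pos k3]
    rfl

theorem run_eq_of_isSome_iff {y y' : Equiv.Perm ℤ} {a b : PWord}
    (h : (run y a).isSome ↔ (run y' b).isSome)
    (h' : (unprimeWord a).foldl invStep y = (unprimeWord b).foldl invStep y') :
    run y a = run y' b := by
  cases ha : run y a with
  | none =>
    cases hb : run y' b with
    | none => rfl
    | some v => rw [ha, hb] at h; simp at h
  | some u =>
    cases hb : run y' b with
    | none => rw [ha, hb] at h; simp at h
    | some v => rw [← run_eq_foldl ha, ← run_eq_foldl hb, h']

theorem Eqv.braid (i : ℤ) (p q : Bool) :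
    Eqv [⟨i, q⟩, ⟨i + 1, false⟩, ⟨i, p⟩] [⟨i + 1, p⟩, ⟨i, false⟩, ⟨i + 1, q⟩] := by
  refine ⟨rfl, fun y hy => run_eq_of_isSome_iff ?_ (invStep_braid y i)⟩
  rw [run_low_high_low hy, run_high_low_high hy]

/-- Words that are not factors of any primed involution word. -/
def Dead (a : PWord) : Prop := ∀ y : Equiv.Perm ℤ, y⁻¹ = y → run y a = none

theorem Dead.not_mem {a : PWord} (h : Dead a) (z : Equiv.Perm ℤ) (A B : PWord) :
    A ++ (a ++ B) ∉ RinvPlus z := by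
  rw [mem_RinvPlus_iff, run_append]
  rintro ⟨h1, -⟩
  cases hr : run 1 A with
  | none => rw [hr] at h1; simp at h1
  | some y =>
    rw [hr, Option.bind_some, run_append, h y (run_inv inv_one hr)] at h1
    simp at h1

theorem dead_pair (i : ℤ) (p q : Bool) : Dead [⟨i, p⟩, ⟨i, q⟩] := by
  intro y hy
  simp only [run]
  split_ifs with h1 h2
  · exfalso
    have k1 : y i < y (i + 1) := h1.1
    have k2 : invStep y i i < invStep y i (i + 1) := h2.1
    have := invStep_low hy k1
    have s1 := sPerm_cases i (y i)
    have s2 := sPerm_cases i (y (i + 1))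
    obtain ⟨e1, e2, e3, n1, n2, n3⟩ := involution_three hy i
    rcases this with this | this <;> omega
  all_goals rfl

theorem dead_braid_primed {i j : ℤ} (h : j = i + 1 ∨ i = j + 1) (p q : Bool) :
    Dead [⟨i, q⟩, ⟨j, true⟩, ⟨i, p⟩] := by
  intro y hy
  rcases h with rfl | rfl
  · have := run_low_high_low hy i p true q
    simpa using this
  · have := run_high_low_high hy j q true p
    simpa using this

/-- Words that do not start any primed involution word. -/
theorem not_mem_of_front {a : PWord} (h : run 1 a = none) (z : Equiv.Perm ℤ) (B : PWord) :
    a ++ B ∉ RinvPlus z := by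
  rw [mem_RinvPlus_iff, run_append, h]
  simp

theorem run_one_braid {i j : ℤ} (h : j = i + 1 ∨ i = j + 1) (p s q : Bool) :
    run 1 [⟨i, q⟩, ⟨j, s⟩, ⟨i, p⟩] = none := by
  rcases h with rfl | rfl
  · have := run_low_high_low inv_one i p s q
    simpa [BraidOk] using this
  · have := run_high_low_high inv_one j q s p
    simpa [BraidOk] using this

theorem invStep_one (i : ℤ) : invStep 1 i = sPerm i := by
  rw [invStep_of_lt_of_fixed inv_one rfl rfl, one_mul]

theorem stepOk_one (x : Letter) : StepOk 1 x := ⟨by simp, by simp⟩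

theorem run_one_adjacent {i j : ℤ} (h : j = i + 1 ∨ i = j + 1) (p q : Bool) :
    (run 1 [⟨i, p⟩, ⟨j, q⟩]).isSome ↔ q = false := by
  have v1 := sPerm_cases i j
  have v2 := sPerm_cases i (j + 1)
  simp only [run, invStep_one]
  rw [if_pos (stepOk_one _)]
  constructor
  · intro h1
    split_ifs at h1 with h2
    · cases q
      · rfl
      · have h3 : sPerm i j = j ∧ sPerm i (j + 1) = j + 1 := h2.2 rfl
        omega
    · simp at h1
  · rintro rfl
    have k : StepOk (sPerm i) ⟨j, false⟩ := by
      refine ⟨?_, by simp⟩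
      dsimp only
      omega
    rw [if_pos k]
    rfl

theorem run_one_far {i j : ℤ} (h : i + 2 ≤ j ∨ j + 2 ≤ i) (p q : Bool) :
    (run 1 [⟨i, p⟩, ⟨j, q⟩]).isSome := by
  have v1 := sPerm_cases i j
  have v2 := sPerm_cases i (j + 1)
  simp only [run, invStep_one]
  have k : StepOk (sPerm i) ⟨j, q⟩ := by
    refine ⟨?_, fun _ => ?_⟩ <;> dsimp only <;> omega
  rw [if_pos (stepOk_one _), if_pos k]
  rfl

theorem sPerm_braid (i : ℤ) :
    sPerm i * (sPerm (i + 1) * sPerm i) = sPerm (i + 1) * (sPerm i * sPerm (i + 1)) := by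
  ext x
  simp only [Equiv.Perm.mul_apply, sPerm_apply]
  split_ifs <;> omega

theorem EqvFront.swap {i j : ℤ} (h : i ≠ j) (p q : Bool) :
    EqvFront [⟨i, p⟩, ⟨j, q⟩] [⟨j, p⟩, ⟨i, q⟩] := by
  refine ⟨rfl, ?_⟩
  by_cases hf : i + 2 ≤ j ∨ j + 2 ≤ i
  · refine run_eq_of_isSome_iff ?_ (invStep_comm 1 hf)
    simp [run_one_far hf, run_one_far hf.symm]
  · refine run_eq_of_isSome_iff ?_ ?_
    · rw [run_one_adjacent (by omega), run_one_adjacent (by omega)]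
    · simp only [unprimeWord, List.map_cons, List.map_nil, List.foldl_cons, List.foldl_nil,
        invStep_one]
      have v1 := sPerm_cases i j
      have v2 := sPerm_cases i (j + 1)
      have v3 := sPerm_cases j i
      have v4 := sPerm_cases j (i + 1)
      rw [invStep_of_lt (sPerm_inv i) (by omega) (by omega),
        invStep_of_lt (sPerm_inv j) (by omega) (by omega)]
      rcases (show j = i + 1 ∨ i = j + 1 by omega) with rfl | rfl
      · rw [mul_assoc, mul_assoc, sPerm_braid]
      · rw [mul_assoc, mul_assoc, sPerm_braid]

theorem invStep_fixed {y : Equiv.Perm ℤ} (hy : y⁻¹ = y) {i x : ℤ} (h : y x = x)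
    (h1 : x ≠ i) (h2 : x ≠ i + 1) : invStep y i x = x := by
  have hs : sPerm i x = x := by rw [sPerm_apply, if_neg h1, if_neg h2]
  by_cases hl : y i < y (i + 1)
  · rw [invStep_apply hy hl, hs, h, hs, ite_self]
  · rw [invStep_of_not_lt hy hl, h]

theorem run_fixed {y y' : Equiv.Perm ℤ} (hy : y⁻¹ = y) {a : PWord} (hr : run y a = some y')
    {x : ℤ} (h : y x = x) (ha : ∀ u ∈ a, x ≠ u.ceil ∧ x ≠ u.ceil + 1) : y' x = x := by
  induction a generalizing y with
  | nil => simp only [run, Option.some.injEq] at hr; rw [← hr, h]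
  | cons u a ih =>
    simp only [run] at hr
    split_ifs at hr
    have hu := ha u (by simp)
    exact ih (invStep_inv _ _ hy) hr (invStep_fixed hy h hu.1 hu.2)
      (fun v hv => ha v (by simp [hv]))

theorem EqvFront.toggle (d : ℤ) (p q : Bool) : EqvFront [⟨d, p⟩] [⟨d, q⟩] := by
  refine ⟨rfl, ?_⟩
  simp [run, stepOk_one]

theorem Eqv.move (x : Letter) {l : PWord} (h : ∀ u ∈ l, Far x u) : Eqv (x :: l) (l ++ [x]) := by
  induction l with
  | nil => exact Eqv.refl _
  | cons u l ih =>
    have h1 : Eqv ([x, u] ++ l) ([u, x] ++ l) := (Eqv.swap (h u (by simp))).append (Eqv.refl l)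
    exact h1.trans ((ih fun v hv => h v (by simp [hv])).cons u)

theorem Eqv.of_perm {ι : Type*} (f : ι → Option Letter) {R₁ R₂ : ι → ι → Prop} {l₁ l₂ : List ι}
    (hp : l₁.Perm l₂) (h₁ : l₁.Pairwise R₁) (h₂ : l₂.Pairwise R₂)
    (hc : ∀ x ∈ l₁, ∀ y ∈ l₁, ∀ a b, f x = some a → f y = some b → R₁ x y → R₂ y x → Far a b) :
    Eqv (l₁.filterMap f) (l₂.filterMap f) := by
  induction l₁ generalizing l₂ with
  | nil => rw [hp.nil_eq]; exact Eqv.refl _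
  | cons x l₁ ih =>
    obtain ⟨s, t, rfl⟩ := List.append_of_mem (hp.subset List.mem_cons_self)
    have hp' : l₁.Perm (s ++ t) := (hp.trans List.perm_middle).cons_inv
    rw [List.pairwise_cons] at h₁
    rw [List.pairwise_append, List.pairwise_cons] at h₂
    obtain ⟨h2a, ⟨h2b, h2c⟩, h2d⟩ := h₂
    have ih' := ih hp' h₁.2
      (List.pairwise_append.2 ⟨h2a, h2c, fun a ha b hb => h2d a ha b (by simp [hb])⟩)
      (fun u hu v hv => hc u (by simp [hu]) v (by simp [hv]))
    cases hx : f x with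
    | none => simpa [List.filterMap_cons, hx] using ih'
    | some a =>
      have e1 : (x :: l₁).filterMap f = a :: l₁.filterMap f := by simp [hx]
      have e2 : (s ++ x :: t).filterMap f = (s.filterMap f ++ [a]) ++ t.filterMap f := by
        simp [hx]
      rw [List.filterMap_append] at ih'
      rw [e1, e2]
      refine (ih'.cons a).trans (((Eqv.move a ?_)).append (Eqv.refl (t.filterMap f)))
      intro b hb
      obtain ⟨y, hy, hyb⟩ := List.mem_filterMap.1 hb
      have hy' : y ∈ l₁ := hp'.symm.subset (by simp [hy])
      exact hc x (by simp) y (by simp [hy']) a b hx hyb (h₁.1 y hy') (h2d y hy x (by simp))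

theorem mem_RinvPlus_prefix {z : Equiv.Perm ℤ} {a b : PWord} (h : a ++ b ∈ RinvPlus z) :
    a ∈ RinvPlus (invHecke (unprimeWord a)) := by
  rw [mem_RinvPlus_iff] at h ⊢
  obtain ⟨h1, h2⟩ := h
  rw [run_append] at h1
  cases hr : run 1 a with
  | none => rw [hr] at h1; simp at h1
  | some y =>
    rw [hr, Option.bind_some] at h1
    refine ⟨by rw [invHecke_of_run hr], fun c hc => ?_⟩
    have := h2 (c ++ unprimeWord b) (by
      rw [invHecke_append, hc, invHecke_of_run hr, run_eq_foldl h1])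
    simp [unprimeWord] at this
    exact this

theorem length_eq_of_mem {z : Equiv.Perm ℤ} {a b : PWord} (ha : a ∈ RinvPlus z)
    (hb : b ∈ RinvPlus z) : a.length = b.length := by
  have h1 := ha.1.2 _ hb.1.1
  have h2 := hb.1.2 _ ha.1.1
  simp only [unprimeWord, List.length_map] at h1 h2
  omega

theorem mem_RinvPlus_transfer {z₀ z : Equiv.Perm ℤ} {a b : PWord} (ha : a ∈ RinvPlus z₀)
    (hb : b ∈ RinvPlus z₀) (c : PWord) : a ++ c ∈ RinvPlus z → b ++ c ∈ RinvPlus z := by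
  have hl := length_eq_of_mem ha hb
  intro h
  rw [mem_RinvPlus_iff] at ha hb h ⊢
  rw [run_append, ha.1] at h
  rw [run_append, hb.1]
  simpa [hl] using h

theorem eq_of_mem_RinvPlus {z z' : Equiv.Perm ℤ} {a : PWord} (h : a ∈ RinvPlus z)
    (h' : a ∈ RinvPlus z') : z = z' := h.1.1.symm.trans h'.1.1

/-- Row bumping away from the main diagonal. -/
theorem Eqv.row_bump {l r : PWord} {m w : Letter} (hl : ∀ x ∈ l, x.ceil < w.ceil)
    (hw : w.ceil < m.ceil) (hr : ∀ x ∈ r, m.ceil < x.ceil) :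
    Eqv (l ++ m :: r ++ [w]) (m :: (l ++ w :: r)) := by
  have h1 : Eqv (r ++ [w]) (w :: r) := (Eqv.move w fun u hu => by
    have := hr u hu
    unfold Far
    omega).symm
  have h2 : Eqv (l ++ [m]) (m :: l) := (Eqv.move m fun u hu => by
    have := hl u hu
    unfold Far
    omega).symm
  simpa using h2.append h1

/-- Row insertion of a letter whose ceiling is already present. -/
theorem Eqv.row_eq {l r : PWord} {i : ℤ} (p q : Bool) (hl : ∀ x ∈ l, x.ceil < i)
    (hr : ∀ x ∈ r, i + 1 < x.ceil) :
    Eqv (l ++ ⟨i, q⟩ :: ⟨i + 1, false⟩ :: r ++ [⟨i, p⟩])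
      (⟨i + 1, p⟩ :: (l ++ ⟨i, false⟩ :: ⟨i + 1, q⟩ :: r)) := by
  have h1 : Eqv (r ++ [⟨i, p⟩]) (⟨i, p⟩ :: r) := (Eqv.move ⟨i, p⟩ fun u hu => by
    have := hr u hu
    unfold Far
    dsimp only
    omega).symm
  have h2 : Eqv (l ++ [⟨i + 1, p⟩]) (⟨i + 1, p⟩ :: l) := (Eqv.move ⟨i + 1, p⟩ fun u hu => by
    have := hl u hu
    unfold Far
    dsimp only
    omega).symm
  have h3 := ((Eqv.refl l).append (((Eqv.refl [⟨i, q⟩, ⟨i + 1, false⟩]).append h1)))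
  have h4 := (Eqv.refl l).append ((Eqv.braid i p q).append (Eqv.refl r))
  have h5 := h2.append (Eqv.refl (⟨i, false⟩ :: ⟨i + 1, q⟩ :: r))
  simp only [List.append_assoc, List.cons_append, List.nil_append] at h3 h4 h5 ⊢
  exact (h3.trans h4).trans h5

/-- Column bumping away from the main diagonal. -/
theorem Eqv.col_bump {u l : PWord} {m w : Letter} (hl : ∀ x ∈ l, x.ceil < w.ceil)
    (hw : w.ceil < m.ceil) (hu : ∀ x ∈ u, m.ceil < x.ceil) :
    Eqv (w :: (u ++ m :: l)) (u ++ w :: l ++ [m]) := by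
  have h1 : Eqv (w :: u) (u ++ [w]) := Eqv.move w fun x hx => by
    have := hu x hx
    unfold Far
    omega
  have h2 : Eqv (m :: l) (l ++ [m]) := Eqv.move m fun x hx => by
    have := hl x hx
    unfold Far
    omega
  simpa using h1.append h2

/-- Column insertion of a letter whose ceiling is already present. -/
theorem Eqv.col_eq {u l : PWord} {i : ℤ} (p q : Bool) (hl : ∀ x ∈ l, x.ceil < i)
    (hu : ∀ x ∈ u, i + 1 < x.ceil) :
    Eqv (⟨i, p⟩ :: (u ++ ⟨i + 1, false⟩ :: ⟨i, q⟩ :: l))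
      (u ++ ⟨i + 1, q⟩ :: ⟨i, false⟩ :: l ++ [⟨i + 1, p⟩]) := by
  have h1 : Eqv (⟨i, p⟩ :: u) (u ++ [⟨i, p⟩]) := Eqv.move ⟨i, p⟩ fun x hx => by
    have := hu x hx
    unfold Far
    dsimp only
    omega
  have h2 : Eqv (⟨i + 1, p⟩ :: l) (l ++ [⟨i + 1, p⟩]) := Eqv.move ⟨i + 1, p⟩ fun x hx => by
    have := hl x hx
    unfold Far
    dsimp only
    omega
  have h3 := h1.append (Eqv.refl (⟨i + 1, false⟩ :: ⟨i, q⟩ :: l))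
  have h4 := (Eqv.refl u).append ((Eqv.braid i q p).append (Eqv.refl l))
  have h5 := (Eqv.refl u).append ((Eqv.refl [⟨i + 1, q⟩, ⟨i, false⟩]).append h2)
  simp only [List.append_assoc, List.cons_append, List.nil_append] at h3 h4 h5 ⊢
  exact (h3.trans h4).trans h5

/-- A filling of the quadrant; empty boxes carry `none`. -/
abbrev Filling := ℕ → ℕ → Option Letter

/-- Change the entry of a filling in one box. -/
def Filling.upd (e : Filling) (r c : ℕ) (x : Option Letter) : Filling :=
  fun r' c' => if r' = r ∧ c' = c then x else e r' c'

theorem Filling.upd_self (e : Filling) (r c : ℕ) (x : Option Letter) : e.upd r c x r c = x := by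
  simp [Filling.upd]

theorem Filling.upd_of_ne (e : Filling) {r c r' c' : ℕ} (x : Option Letter)
    (h : r' ≠ r ∨ c' ≠ c) : e.upd r c x r' c' = e r' c' := by
  simp only [Filling.upd]
  rw [if_neg]
  omega

theorem Filling.upd_upd (e : Filling) (r c : ℕ) (x y : Option Letter) :
    (e.upd r c x).upd r c y = e.upd r c y := by
  funext r' c'
  simp only [Filling.upd]
  split_ifs <;> rfl

theorem Filling.upd_eq_self (e : Filling) {r c : ℕ} {x : Option Letter} (h : e r c = x) :
    e.upd r c x = e := by
  funext r' c'
  simp only [Filling.upd]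
  split_ifs with h'
  · rw [h'.1, h'.2, h]
  · rfl

/-- The filling is an increasing shifted tableau without primes on the main diagonal, where
entries are compared through their ceilings. -/
structure Good (e : Filling) : Prop where
  le : ∀ r c x, e r c = some x → r ≤ c
  left : ∀ r c x, r ≤ c → e r (c + 1) = some x → ∃ y, e r c = some y ∧ y.ceil < x.ceil
  down : ∀ r c x, e (r + 1) c = some x → ∃ y, e r c = some y ∧ y.ceil < x.ceil
  diag : ∀ r x, e r r = some x → x.primed = false

theorem Good.row {e : Filling} (h : Good e) {r c c' : ℕ} {x : Letter} (hr : r ≤ c) (hc : c ≤ c')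
    (hx : e r c' = some x) : ∃ y, e r c = some y ∧ y.ceil + (c' - c : ℤ) ≤ x.ceil := by
  induction c', hc using Nat.le_induction generalizing x with
  | base => exact ⟨x, hx, by omega⟩
  | succ n hn ih =>
    obtain ⟨y, hy, hyx⟩ := h.left r n x (by omega) hx
    obtain ⟨y', hy', h'⟩ := ih hy
    exact ⟨y', hy', by push_cast; omega⟩

theorem Good.col {e : Filling} (h : Good e) {r r' c : ℕ} {x : Letter} (hr : r ≤ r')
    (hx : e r' c = some x) : ∃ y, e r c = some y ∧ y.ceil + (r' - r : ℤ) ≤ x.ceil := by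
  induction r', hr using Nat.le_induction generalizing x with
  | base => exact ⟨x, hx, by omega⟩
  | succ n hn ih =>
    obtain ⟨y, hy, hyx⟩ := h.down n c x hx
    obtain ⟨y', hy', h'⟩ := ih hy
    exact ⟨y', hy', by push_cast; omega⟩

/-- Entries of a good filling grow at least as fast as the distance between boxes. -/
theorem Good.dist {e : Filling} (h : Good e) {r r' c c' : ℕ} {x y : Letter} (hr : r ≤ r')
    (hc : c ≤ c') (hx : e r c = some x) (hy : e r' c' = some y) :
    x.ceil + (r' - r : ℤ) + (c' - c : ℤ) ≤ y.ceil := by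
  obtain ⟨u, hu, h1⟩ := h.col hr hy
  obtain ⟨v, hv, h2⟩ := h.row (h.le r c x hx) hc hu
  rw [hx, Option.some_inj] at hv
  subst hv
  omega

theorem Good.box {e : Filling} (h : Good e) {r r' c c' : ℕ} {y : Letter} (hr : r ≤ r')
    (hc : c ≤ c') (hrc : r ≤ c) (hy : e r' c' = some y) : ∃ x, e r c = some x := by
  obtain ⟨u, hu, -⟩ := h.col hr hy
  obtain ⟨v, hv, -⟩ := h.row hrc hc hu
  exact ⟨v, hv⟩

theorem Good.upd {e : Filling} (h : Good e) {r c : ℕ} {x : Letter} (hrc : r ≤ c)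
    (hl : ∀ c', c = c' + 1 → r ≤ c' → ∃ y, e r c' = some y ∧ y.ceil < x.ceil)
    (hd : ∀ r', r = r' + 1 → ∃ y, e r' c = some y ∧ y.ceil < x.ceil)
    (hr : ∀ y, e r (c + 1) = some y → x.ceil < y.ceil)
    (hu : ∀ y, e (r + 1) c = some y → x.ceil < y.ceil)
    (hx : r = c → x.primed = false) : Good (e.upd r c (some x)) where
  le r' c' y hy := by
    simp only [Filling.upd] at hy
    split_ifs at hy with h'
    · omega
    · exact h.le _ _ _ hy
  left r' c' y hrc' hy := by
    simp only [Filling.upd] at hy ⊢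
    split_ifs at hy with h1
    · rw [if_neg (by omega)]
      cases hy
      rw [h1.1]
      exact hl c' h1.2.symm (by omega)
    · split_ifs with h2
      · rw [h2.1, h2.2] at hy
        exact ⟨x, rfl, hr y hy⟩
      · exact h.left _ _ _ hrc' hy
  down r' c' y hy := by
    simp only [Filling.upd] at hy ⊢
    split_ifs at hy with h1
    · rw [if_neg (by omega)]
      cases hy
      rw [h1.2]
      exact hd r' h1.1.symm
    · split_ifs with h2
      · rw [h2.1, h2.2] at hy
        exact ⟨x, rfl, hu y hy⟩
      · exact h.down _ _ _ hy
  diag r' y hy := by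
    simp only [Filling.upd] at hy
    split_ifs at hy with h1
    · cases hy
      exact hx (by omega)
    · exact h.diag _ _ hy

/-- Removing an outer corner. -/
theorem Good.remove {e : Filling} (h : Good e) {r c : ℕ} (hr : e r (c + 1) = none)
    (hu : e (r + 1) c = none) : Good (e.upd r c none) where
  le r' c' y hy := by
    simp only [Filling.upd] at hy
    split_ifs at hy
    exact h.le _ _ _ hy
  left r' c' y hrc' hy := by
    simp only [Filling.upd] at hy ⊢
    split_ifs at hy with h1
    rw [if_neg]
    · exact h.left _ _ _ hrc' hy
    · rintro ⟨rfl, rfl⟩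
      rw [hr] at hy
      cases hy
  down r' c' y hy := by
    simp only [Filling.upd] at hy ⊢
    split_ifs at hy with h1
    rw [if_neg]
    · exact h.down _ _ _ hy
    · rintro ⟨rfl, rfl⟩
      rw [hu] at hy
      cases hy
  diag r' y hy := by
    simp only [Filling.upd] at hy
    split_ifs at hy
    exact h.diag _ _ hy

theorem Good.of_ceil {e e' : Filling} (h : Good e)
    (hc : ∀ r c, (e' r c).map Letter.ceil = (e r c).map Letter.ceil)
    (hd : ∀ r x, e' r r = some x → x.primed = false) : Good e' := by
  have key : ∀ {r c x}, e' r c = some x → ∃ y, e r c = some y ∧ y.ceil = x.ceil := by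
    intro r c x hx
    have := hc r c
    rw [hx] at this
    cases he : e r c with
    | none => rw [he] at this; cases this
    | some y => rw [he] at this; simp at this; exact ⟨y, rfl, this.symm⟩
  have key' : ∀ {r c x}, e r c = some x → ∃ y, e' r c = some y ∧ y.ceil = x.ceil := by
    intro r c x hx
    have := hc r c
    rw [hx] at this
    cases he : e' r c with
    | none => rw [he] at this; cases this
    | some y => rw [he] at this; simp at this; exact ⟨y, rfl, this⟩
  refine ⟨fun r c x hx => ?_, fun r c x hrc hx => ?_, fun r c x hx => ?_, hd⟩
  · obtain ⟨y, hy, -⟩ := key hx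
    exact h.le _ _ _ hy
  · obtain ⟨y, hy, h1⟩ := key hx
    obtain ⟨u, hu, h2⟩ := h.left _ _ _ hrc hy
    obtain ⟨v, hv, h3⟩ := key' hu
    exact ⟨v, hv, by omega⟩
  · obtain ⟨y, hy, h1⟩ := key hx
    obtain ⟨u, hu, h2⟩ := h.down _ _ _ hy
    obtain ⟨v, hv, h3⟩ := key' hu
    exact ⟨v, hv, by omega⟩

/-! ### Reading words of fillings -/

/-- The letters among `f 0, …, f (n - 1)`. -/
def seqW (n : ℕ) (f : ℕ → Option Letter) : PWord := (List.range n).filterMap f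

/-- The letters among `f a, …, f (a + n - 1)`. -/
def tailW (a n : ℕ) (f : ℕ → Option Letter) : PWord := (List.range' a n).filterMap f

theorem mem_seqW {n : ℕ} {f : ℕ → Option Letter} {x : Letter} :
    x ∈ seqW n f ↔ ∃ i < n, f i = some x := by
  simp [seqW]

theorem mem_tailW {a n : ℕ} {f : ℕ → Option Letter} {x : Letter} (h : x ∈ tailW a n f) :
    ∃ i, a ≤ i ∧ i < a + n ∧ f i = some x := by
  obtain ⟨i, hi, hx⟩ := List.mem_filterMap.1 h
  rw [List.mem_range'_1] at hi
  exact ⟨i, hi.1, hi.2, hx⟩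

theorem seqW_congr {n : ℕ} {f g : ℕ → Option Letter} (h : ∀ i < n, f i = g i) :
    seqW n f = seqW n g :=
  List.filterMap_congr fun i hi => h i (List.mem_range.1 hi)

theorem tailW_congr {a n : ℕ} {f g : ℕ → Option Letter} (h : ∀ i, a ≤ i → f i = g i) :
    tailW a n f = tailW a n g :=
  List.filterMap_congr fun i hi => h i (List.mem_range'_1.1 hi).1

theorem seqW_eq_append (a n : ℕ) (f : ℕ → Option Letter) :
    seqW (a + n) f = seqW a f ++ tailW a n f := by
  have h := List.range'_append (s := 0) (m := a) (n := n) (step := 1)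
  rw [one_mul, zero_add] at h
  rw [seqW, seqW, tailW, ← List.filterMap_append, List.range_eq_range', List.range_eq_range', h]

theorem tailW_cons {a n : ℕ} {f : ℕ → Option Letter} {x : Letter} (h : f a = some x) :
    tailW a (n + 1) f = x :: tailW (a + 1) n f := by
  rw [tailW, List.range'_succ, List.filterMap_cons_some h, tailW]

theorem tailW_cons_none {a n : ℕ} {f : ℕ → Option Letter} (h : f a = none) :
    tailW a (n + 1) f = tailW (a + 1) n f := by
  rw [tailW, List.range'_succ, List.filterMap_cons_none h, tailW]

theorem tailW_eq_nil {a n : ℕ} {f : ℕ → Option Letter} (h : ∀ i, a ≤ i → f i = none) :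
    tailW a n f = [] := by
  rw [tailW, List.filterMap_eq_nil_iff]
  exact fun i hi => h i (List.mem_range'_1.1 hi).1

theorem seqW_eq_nil {n : ℕ} {f : ℕ → Option Letter} (h : ∀ i < n, f i = none) :
    seqW n f = [] := by
  rw [seqW, List.filterMap_eq_nil_iff]
  exact fun i hi => h i (List.mem_range.1 hi)

theorem seqW_split {a n : ℕ} {f : ℕ → Option Letter} {x : Letter} (han : a < n)
    (h : f a = some x) : seqW n f = seqW a f ++ x :: tailW (a + 1) (n - a - 1) f := by
  obtain ⟨m, rfl⟩ : ∃ m, n = a + (m + 1) := ⟨n - a - 1, by omega⟩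
  rw [seqW_eq_append, tailW_cons h]
  congr 3
  omega

theorem seqW_split₂ {a n : ℕ} {f : ℕ → Option Letter} {x y : Letter} (han : a + 1 < n)
    (h : f a = some x) (h' : f (a + 1) = some y) :
    seqW n f = seqW a f ++ x :: y :: tailW (a + 2) (n - a - 2) f := by
  obtain ⟨m, rfl⟩ : ∃ m, n = a + (m + 1 + 1) := ⟨n - a - 2, by omega⟩
  rw [seqW_eq_append, tailW_cons h, tailW_cons h']
  congr 4
  omega

theorem seqW_split_none {a n : ℕ} {f : ℕ → Option Letter} (han : a ≤ n)
    (h : ∀ i, a ≤ i → f i = none) : seqW n f = seqW a f := by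
  obtain ⟨m, rfl⟩ : ∃ m, n = a + m := ⟨n - a, by omega⟩
  rw [seqW_eq_append, tailW_eq_nil h, List.append_nil]

/-- The word `s (n - 1) ⋯ s 1 s 0`. -/
def downW (s : ℕ → PWord) : ℕ → PWord
  | 0 => []
  | n + 1 => s n ++ downW s n

/-- The word `s (a + n - 1) ⋯ s (a + 1) s a`. -/
def downTailW (s : ℕ → PWord) (a : ℕ) : ℕ → PWord
  | 0 => []
  | n + 1 => s (a + n) ++ downTailW s a n

/-- The word `s 0 s 1 ⋯ s (n - 1)`. -/
def upW (s : ℕ → PWord) : ℕ → PWord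
  | 0 => []
  | n + 1 => upW s n ++ s n

/-- The word `s a s (a + 1) ⋯ s (a + n - 1)`. -/
def upTailW (s : ℕ → PWord) (a : ℕ) : ℕ → PWord
  | 0 => []
  | n + 1 => upTailW s a n ++ s (a + n)

theorem downW_add (s : ℕ → PWord) (a n : ℕ) : downW s (a + n) = downTailW s a n ++ downW s a := by
  induction n with
  | zero => rfl
  | succ n ih => rw [← Nat.add_assoc, downW, ih, downTailW, List.append_assoc]

theorem upW_add (s : ℕ → PWord) (a n : ℕ) : upW s (a + n) = upW s a ++ upTailW s a n := by
  induction n with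
  | zero => simp [upTailW]
  | succ n ih => rw [← Nat.add_assoc, upW, ih, upTailW, List.append_assoc]

theorem downTailW_succ (s : ℕ → PWord) (a n : ℕ) :
    downTailW s a (n + 1) = downTailW s (a + 1) n ++ s a := by
  induction n with
  | zero => simp [downTailW]
  | succ n ih =>
    rw [downTailW, ih, downTailW, List.append_assoc]
    congr 2
    omega

theorem upTailW_succ (s : ℕ → PWord) (a n : ℕ) :
    upTailW s a (n + 1) = s a ++ upTailW s (a + 1) n := by
  induction n with
  | zero => simp [upTailW]
  | succ n ih =>
    rw [upTailW, ih, upTailW, List.append_assoc]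
    congr 3
    omega

theorem downW_congr {s t : ℕ → PWord} {n : ℕ} (h : ∀ i < n, s i = t i) : downW s n = downW t n := by
  induction n with
  | zero => rfl
  | succ n ih => rw [downW, downW, h n (by omega), ih fun i hi => h i (by omega)]

theorem downTailW_congr {s t : ℕ → PWord} {a n : ℕ} (h : ∀ i, a ≤ i → s i = t i) :
    downTailW s a n = downTailW t a n := by
  induction n with
  | zero => rfl
  | succ n ih => rw [downTailW, downTailW, h _ (by omega), ih]

theorem upW_congr {s t : ℕ → PWord} {n : ℕ} (h : ∀ i < n, s i = t i) : upW s n = upW t n := by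
  induction n with
  | zero => rfl
  | succ n ih => rw [upW, upW, h n (by omega), ih fun i hi => h i (by omega)]

theorem upTailW_congr {s t : ℕ → PWord} {a n : ℕ} (h : ∀ i, a ≤ i → s i = t i) :
    upTailW s a n = upTailW t a n := by
  induction n with
  | zero => rfl
  | succ n ih => rw [upTailW, upTailW, h _ (by omega), ih]

theorem mem_downTailW {s : ℕ → PWord} {a n : ℕ} {x : Letter} (h : x ∈ downTailW s a n) :
    ∃ i, a ≤ i ∧ i < a + n ∧ x ∈ s i := by
  induction n with
  | zero => simp [downTailW] at h
  | succ n ih =>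
    rw [downTailW, List.mem_append] at h
    rcases h with h | h
    · exact ⟨a + n, by omega, by omega, h⟩
    · obtain ⟨i, h1, h2, h3⟩ := ih h
      exact ⟨i, h1, by omega, h3⟩

theorem downTailW_eq_nil {s : ℕ → PWord} {a n : ℕ} (h : ∀ i, a ≤ i → s i = []) :
    downTailW s a n = [] := by
  induction n with
  | zero => rfl
  | succ n ih => rw [downTailW, ih, h _ (by omega)]; rfl

/-- Row `r` of the filling, read from left to right. -/
def rowW (n : ℕ) (e : Filling) (r : ℕ) : PWord := seqW n (e r)

/-- Column `c` of the filling, read from top to bottom. -/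
def colW (n : ℕ) (e : Filling) (c : ℕ) : PWord := (seqW n fun r => e r c).reverse

/-- The rows of the filling with the letter `w` read between rows `k` and `k - 1`. -/
def readRow (n : ℕ) (e : Filling) (k : ℕ) (w : Letter) : PWord :=
  downTailW (rowW n e) k (n - k) ++ w :: downW (rowW n e) k

/-- The columns of the filling with the letter `w` read between columns `k - 1` and `k`. -/
def readCol (n : ℕ) (e : Filling) (k : ℕ) (w : Letter) : PWord :=
  upW (colW n e) k ++ w :: upTailW (colW n e) k (n - k)

theorem rowW_upd_of_ne (n : ℕ) (e : Filling) {r r' c : ℕ} (x : Option Letter) (h : r' ≠ r) :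
    rowW n (e.upd r c x) r' = rowW n e r' :=
  seqW_congr fun _ _ => e.upd_of_ne x (Or.inl h)

theorem colW_upd_of_ne (n : ℕ) (e : Filling) {r c c' : ℕ} (x : Option Letter) (h : c' ≠ c) :
    colW n (e.upd r c x) c' = colW n e c' :=
  congrArg List.reverse (seqW_congr fun _ _ => e.upd_of_ne x (Or.inr h))

theorem downTailW_split (s : ℕ → PWord) {k n : ℕ} (h : k < n) :
    downTailW s k (n - k) = downTailW s (k + 1) (n - (k + 1)) ++ s k := by
  obtain ⟨m, rfl⟩ : ∃ m, n = k + 1 + m := ⟨n - k - 1, by omega⟩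
  rw [show k + 1 + m - k = m + 1 by omega, downTailW_succ, Nat.add_sub_cancel_left]

theorem upTailW_split (s : ℕ → PWord) {k n : ℕ} (h : k < n) :
    upTailW s k (n - k) = s k ++ upTailW s (k + 1) (n - (k + 1)) := by
  obtain ⟨m, rfl⟩ : ∃ m, n = k + 1 + m := ⟨n - k - 1, by omega⟩
  rw [show k + 1 + m - k = m + 1 by omega, upTailW_succ, Nat.add_sub_cancel_left]

theorem downW_eq_flatMap (s : ℕ → PWord) (n : ℕ) :
    downW s n = (List.range n).reverse.flatMap s := by
  induction n with
  | zero => rfl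
  | succ n ih => rw [downW, ih, List.range_succ]; simp

theorem upW_eq_flatMap (s : ℕ → PWord) (n : ℕ) : upW s n = (List.range n).flatMap s := by
  induction n with
  | zero => rfl
  | succ n ih => rw [upW, ih, List.range_succ]; simp

/-- The row and column reading words agree up to commutations when letters in boxes in
strictly northeast relation commute. -/
theorem eqv_rows_cols {n : ℕ} {f : Filling}
    (h : ∀ r c r' c' a b, f r c = some a → f r' c' = some b → r < r' → c < c' → Far a b) :
    Eqv (downW (rowW n f) n) (upW (colW n f) n) := by
  let g : ℕ × ℕ → Option Letter := fun p => f p.1 p.2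
  let L₁ : List (ℕ × ℕ) :=
    (List.range n).reverse.flatMap fun r => (List.range n).map fun c => (r, c)
  let L₂ : List (ℕ × ℕ) :=
    (List.range n).flatMap fun c => ((List.range n).map fun r => (r, c)).reverse
  let R₁ : ℕ × ℕ → ℕ × ℕ → Prop := fun p q => q.1 < p.1 ∨ (p.1 = q.1 ∧ p.2 < q.2)
  let R₂ : ℕ × ℕ → ℕ × ℕ → Prop := fun p q => p.2 < q.2 ∨ (p.2 = q.2 ∧ q.1 < p.1)
  have e₁ : downW (rowW n f) n = L₁.filterMap g := by
    rw [downW_eq_flatMap, List.filterMap_flatMap]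
    congr 1
    funext r
    simp [rowW, seqW, g, List.filterMap_map]
  have e₂ : upW (colW n f) n = L₂.filterMap g := by
    rw [upW_eq_flatMap, List.filterMap_flatMap]
    congr 1
    funext r
    simp [colW, seqW, g, List.filterMap_map, List.filterMap_reverse]
  have h₁ : L₁.Pairwise R₁ := by
    rw [List.pairwise_flatMap]
    refine ⟨fun r _ => ?_, ?_⟩
    · rw [List.pairwise_map]
      exact List.pairwise_lt_range.imp fun hab => Or.inr ⟨rfl, hab⟩
    · rw [List.pairwise_reverse]
      refine List.pairwise_lt_range.imp fun {a b} hab x hx y hy => ?_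
      simp only [List.mem_map] at hx hy
      obtain ⟨_, -, rfl⟩ := hx
      obtain ⟨_, -, rfl⟩ := hy
      exact Or.inl hab
  have h₂ : L₂.Pairwise R₂ := by
    rw [List.pairwise_flatMap]
    refine ⟨fun r _ => ?_, ?_⟩
    · rw [List.pairwise_reverse, List.pairwise_map]
      exact List.pairwise_lt_range.imp fun hab => Or.inr ⟨rfl, hab⟩
    · refine List.pairwise_lt_range.imp fun {a b} hab x hx y hy => ?_
      simp only [List.mem_reverse, List.mem_map] at hx hy
      obtain ⟨_, -, rfl⟩ := hx
      obtain ⟨_, -, rfl⟩ := hy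
      exact Or.inl hab
  have hp : L₁.Perm L₂ := by
    refine (List.perm_ext_iff_of_nodup (h₁.imp ?_) (h₂.imp ?_)).2 fun p => ?_
    · rintro p q hpq rfl
      simp [R₁] at hpq
    · rintro p q hpq rfl
      simp [R₂] at hpq
    · simp [L₁, L₂, Prod.ext_iff, and_comm]
  rw [e₁, e₂]
  refine Eqv.of_perm g hp h₁ h₂ fun p _ q _ a b ha hb hpq hqp => ?_
  refine (h q.1 q.2 p.1 p.2 b a hb ha ?_ ?_).symm
  · simp only [R₁, R₂] at hpq hqp
    omega
  · simp only [R₁, R₂] at hpq hqp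
    omega

theorem Good.far {e : Filling} (h : Good e) {r r' c c' : ℕ} {x y : Letter} (hr : r < r')
    (hc : c < c') (hx : e r c = some x) (hy : e r' c' = some y) : Far x y := by
  have := h.dist hr.le hc.le hx hy
  left
  omega

theorem readRow_bump {n k c : ℕ} {e : Filling} {m w : Letter} (hk : k < n) (hc : c < n)
    (hm : e k c = some m) (hw : w.ceil < m.ceil)
    (hl : ∀ c' < c, ∀ x, e k c' = some x → x.ceil < w.ceil)
    (hr : ∀ c', c < c' → ∀ x, e k c' = some x → m.ceil < x.ceil) :
    Eqv (readRow n e k w) (readRow n (e.upd k c (some w)) (k + 1) m) := by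
  have h1 : rowW n e k = seqW c (e k) ++ m :: tailW (c + 1) (n - c - 1) (e k) := seqW_split hc hm
  have h2 : rowW n (e.upd k c (some w)) k =
      seqW c (e k) ++ w :: tailW (c + 1) (n - c - 1) (e k) := by
    rw [rowW, seqW_split hc (e.upd_self k c _)]
    congr 1
    · exact seqW_congr fun i hi => e.upd_of_ne _ (by omega)
    · congr 1
      exact tailW_congr fun i hi => e.upd_of_ne _ (by omega)
  have h3 := Eqv.row_bump (l := seqW c (e k)) (r := tailW (c + 1) (n - c - 1) (e k)) (m := m)
    (w := w) (fun x hx => by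
      obtain ⟨i, hi, hx⟩ := mem_seqW.1 hx
      exact hl i hi x hx) hw (fun x hx => by
      obtain ⟨i, hi, -, hx⟩ := mem_tailW hx
      exact hr i hi x hx)
  rw [readRow, readRow, downTailW_split _ hk, h1, downW, h2,
    downTailW_congr (t := rowW n e) fun i hi => rowW_upd_of_ne n e _ (by omega),
    downW_congr (t := rowW n e) fun i hi => rowW_upd_of_ne n e _ (by omega)]
  have h4 := (Eqv.refl (downTailW (rowW n e) (k + 1) (n - (k + 1)))).append
    (h3.append (Eqv.refl (downW (rowW n e) k)))
  simpa using h4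

theorem readRow_eq {n k c : ℕ} {e : Filling} {i : ℤ} (p : Bool) {q : Bool} (hk : k < n)
    (hc : c + 1 < n) (hx : e k c = some ⟨i, q⟩) (hy : e k (c + 1) = some ⟨i + 1, false⟩)
    (hl : ∀ c' < c, ∀ x, e k c' = some x → x.ceil < i)
    (hr : ∀ c', c + 1 < c' → ∀ x, e k c' = some x → i + 1 < x.ceil) :
    Eqv (readRow n e k ⟨i, p⟩)
      (readRow n ((e.upd k c (some ⟨i, false⟩)).upd k (c + 1) (some ⟨i + 1, q⟩)) (k + 1)
        ⟨i + 1, p⟩) := by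
  have h1 : rowW n e k = seqW c (e k) ++ ⟨i, q⟩ :: ⟨i + 1, false⟩ ::
      tailW (c + 2) (n - c - 2) (e k) := seqW_split₂ hc hx hy
  have h2 : rowW n ((e.upd k c (some ⟨i, false⟩)).upd k (c + 1) (some ⟨i + 1, q⟩)) k =
      seqW c (e k) ++ ⟨i, false⟩ :: ⟨i + 1, q⟩ :: tailW (c + 2) (n - c - 2) (e k) := by
    rw [rowW, seqW_split₂ (x := ⟨i, false⟩) (y := ⟨i + 1, q⟩) hc
      (by rw [Filling.upd_of_ne _ _ (by omega), Filling.upd_self]) (Filling.upd_self _ _ _ _)]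
    congr 1
    · exact seqW_congr fun i hi => by
        rw [Filling.upd_of_ne _ _ (by omega), Filling.upd_of_ne _ _ (by omega)]
    · congr 2
      exact tailW_congr fun i hi => by
        rw [Filling.upd_of_ne _ _ (by omega), Filling.upd_of_ne _ _ (by omega)]
  have h3 := Eqv.row_eq (l := seqW c (e k)) (r := tailW (c + 2) (n - c - 2) (e k)) p q
    (fun x hx => by
      obtain ⟨j, hj, hx⟩ := mem_seqW.1 hx
      exact hl j hj x hx) (fun x hx => by
      obtain ⟨j, hj, -, hx⟩ := mem_tailW hx
      exact hr j hj x hx)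
  rw [readRow, readRow, downTailW_split _ hk, h1, downW, h2,
    downTailW_congr (s := rowW n
      ((e.upd k c (some ⟨i, false⟩)).upd k (c + 1) (some ⟨i + 1, q⟩))) (t := rowW n e) (fun i hi => by
      rw [rowW_upd_of_ne n _ _ (by omega), rowW_upd_of_ne n e _ (by omega)]),
    downW_congr (s := rowW n
      ((e.upd k c (some ⟨i, false⟩)).upd k (c + 1) (some ⟨i + 1, q⟩))) (t := rowW n e) (fun i hi => by
      rw [rowW_upd_of_ne n _ _ (by omega), rowW_upd_of_ne n e _ (by omega)])]
  have h4 := (Eqv.refl (downTailW (rowW n e) (k + 1) (n - (k + 1)))).append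
    (h3.append (Eqv.refl (downW (rowW n e) k)))
  simpa using h4

theorem readCol_bump {n k r : ℕ} {e : Filling} {m w : Letter} (hk : k < n) (hr : r < n)
    (hm : e r k = some m) (hw : w.ceil < m.ceil)
    (hl : ∀ r' < r, ∀ x, e r' k = some x → x.ceil < w.ceil)
    (hu : ∀ r', r < r' → ∀ x, e r' k = some x → m.ceil < x.ceil) :
    Eqv (readCol n e k w) (readCol n (e.upd r k (some w)) (k + 1) m) := by
  have h1 : colW n e k = (tailW (r + 1) (n - r - 1) (fun i => e i k)).reverse ++
      m :: (seqW r fun i => e i k).reverse := by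
    rw [colW, seqW_split (f := fun i => e i k) hr hm]
    simp
  have h2 : colW n (e.upd r k (some w)) k =
      (tailW (r + 1) (n - r - 1) (fun i => e i k)).reverse ++
        w :: (seqW r fun i => e i k).reverse := by
    rw [colW, seqW_split (f := fun i => e.upd r k (some w) i k) hr (e.upd_self r k _)]
    rw [seqW_congr (g := fun i => e i k) fun i hi => e.upd_of_ne _ (by omega),
      tailW_congr (g := fun i => e i k) fun i hi => e.upd_of_ne _ (by omega)]
    simp
  have h3 := Eqv.col_bump (l := (seqW r fun i => e i k).reverse)
    (u := (tailW (r + 1) (n - r - 1) (fun i => e i k)).reverse) (m := m)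
    (w := w) (fun x hx => by
      obtain ⟨i, hi, hx⟩ := mem_seqW.1 (List.mem_reverse.1 hx)
      exact hl i hi x hx) hw (fun x hx => by
      obtain ⟨i, hi, -, hx⟩ := mem_tailW (List.mem_reverse.1 hx)
      exact hu i hi x hx)
  rw [readCol, readCol, upTailW_split _ hk, h1, upW, h2,
    upTailW_congr (t := colW n e) fun i hi => colW_upd_of_ne n e _ (by omega),
    upW_congr (t := colW n e) fun i hi => colW_upd_of_ne n e _ (by omega)]
  have h4 := (Eqv.refl (upW (colW n e) k)).append
    (h3.append (Eqv.refl (upTailW (colW n e) (k + 1) (n - (k + 1)))))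
  simpa using h4

theorem readCol_eq {n k r : ℕ} {e : Filling} {i : ℤ} (p : Bool) {q : Bool} (hk : k < n)
    (hr : r + 1 < n) (hx : e r k = some ⟨i, q⟩) (hy : e (r + 1) k = some ⟨i + 1, false⟩)
    (hl : ∀ r' < r, ∀ x, e r' k = some x → x.ceil < i)
    (hu : ∀ r', r + 1 < r' → ∀ x, e r' k = some x → i + 1 < x.ceil) :
    Eqv (readCol n e k ⟨i, p⟩)
      (readCol n ((e.upd r k (some ⟨i, false⟩)).upd (r + 1) k (some ⟨i + 1, q⟩)) (k + 1)
        ⟨i + 1, p⟩) := by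
  have h1 : colW n e k = (tailW (r + 2) (n - r - 2) (fun i => e i k)).reverse ++
      ⟨i + 1, false⟩ :: ⟨i, q⟩ :: (seqW r fun i => e i k).reverse := by
    rw [colW, seqW_split₂ (f := fun i => e i k) hr hx hy]
    simp
  have h2 : colW n ((e.upd r k (some ⟨i, false⟩)).upd (r + 1) k (some ⟨i + 1, q⟩)) k =
      (tailW (r + 2) (n - r - 2) (fun i => e i k)).reverse ++
        ⟨i + 1, q⟩ :: ⟨i, false⟩ :: (seqW r fun i => e i k).reverse := by
    rw [colW, seqW_split₂ (f := fun j =>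
      (e.upd r k (some ⟨i, false⟩)).upd (r + 1) k (some ⟨i + 1, q⟩) j k)
      (x := ⟨i, false⟩) (y := ⟨i + 1, q⟩) hr
      (by rw [Filling.upd_of_ne _ _ (by omega), Filling.upd_self]) (Filling.upd_self _ _ _ _)]
    rw [seqW_congr (n := r) (g := fun i => e i k) (fun i hi => by
        rw [Filling.upd_of_ne _ _ (by omega), Filling.upd_of_ne _ _ (by omega)]),
      tailW_congr (g := fun i => e i k) (fun i hi => by
        rw [Filling.upd_of_ne _ _ (by omega), Filling.upd_of_ne _ _ (by omega)])]
    simp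
  have h3 := Eqv.col_eq (l := (seqW r fun i => e i k).reverse)
    (u := (tailW (r + 2) (n - r - 2) (fun i => e i k)).reverse) p q
    (fun x hx => by
      obtain ⟨j, hj, hx⟩ := mem_seqW.1 (List.mem_reverse.1 hx)
      exact hl j hj x hx) (fun x hx => by
      obtain ⟨j, hj, -, hx⟩ := mem_tailW (List.mem_reverse.1 hx)
      exact hu j hj x hx)
  rw [readCol, readCol, upTailW_split _ hk, h1, upW, h2,
    upTailW_congr (s := colW n
      ((e.upd r k (some ⟨i, false⟩)).upd (r + 1) k (some ⟨i + 1, q⟩))) (t := colW n e) (fun i hi => by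
      rw [colW_upd_of_ne n _ _ (by omega), colW_upd_of_ne n e _ (by omega)]),
    upW_congr (s := colW n
      ((e.upd r k (some ⟨i, false⟩)).upd (r + 1) k (some ⟨i + 1, q⟩))) (t := colW n e) (fun i hi => by
      rw [colW_upd_of_ne n _ _ (by omega), colW_upd_of_ne n e _ (by omega)])]
  have h4 := (Eqv.refl (upW (colW n e) k)).append
    (h3.append (Eqv.refl (upTailW (colW n e) (k + 1) (n - (k + 1)))))
  simpa using h4

/-- All boxes lie in the first `n` columns. -/
def Filling.Within (n : ℕ) (e : Filling) : Prop := ∀ r c x, e r c = some x → c < n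

/-- Moving two letters from the front of the row reading word into the column reading word, one
to the diagonal box `(k, k)` and the other one between columns `k` and `k + 1`. -/
theorem diag_transport {n k : ℕ} {e : Filling} {d u v : Letter} (he : Good e) (hn : e.Within n)
    (hd : e k k = some d) (huv : u.ceil < v.ceil)
    (hb : ∀ j x, k = j + 1 → e j k = some x → x.ceil < u.ceil) :
    Eqv (u :: v :: downW (rowW (n + 2) (e.upd k k none)) (n + 2))
      (readCol (n + 2) (e.upd k k (some u)) (k + 1) v) := by
  have hk : k < n := hn _ _ _ hd
  have hrow : ∀ r c x, e r c = some x → r < n := fun r c x hx =>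
    (he.le _ _ _ hx).trans_lt (hn _ _ _ hx)
  have hempty : ∀ r c, n ≤ r → e r c = none := fun r c hr => by
    by_contra h
    obtain ⟨x, hx⟩ := Option.ne_none_iff_exists'.1 h
    have := hrow r c x hx
    omega
  have hdiag : ∀ r c, c < r → e r c = none := fun r c hr => by
    by_contra h
    obtain ⟨x, hx⟩ := Option.ne_none_iff_exists'.1 h
    have := he.le r c x hx
    omega
  obtain ⟨g, hg⟩ : ∃ g : Filling, g = e.upd k k none := ⟨_, rfl⟩
  obtain ⟨f, hf⟩ : ∃ f : Filling, f = (g.upd (n + 1) k (some u)).upd n (k + 1) (some v) :=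
    ⟨_, rfl⟩
  have hfg : ∀ r c, r < n → f r c = g r c := fun r c hr => by
    rw [hf, Filling.upd_of_ne _ _ (by omega), Filling.upd_of_ne _ _ (by omega)]
  have hge : ∀ r c, r ≠ k ∨ c ≠ k → g r c = e r c := fun r c hr => by
    rw [hg, Filling.upd_of_ne _ _ hr]
  have hlow : ∀ r c a, e r c = some a → c ≤ k → r < k → a.ceil + 1 + (k - c) ≤ u.ceil := by
    intro r c a ha hc hr
    obtain ⟨j, rfl⟩ : ∃ j, k = j + 1 := ⟨k - 1, by omega⟩
    obtain ⟨x, hx, -⟩ := he.down j (j + 1) d hd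
    have h1 := he.dist (by omega) hc ha hx
    have h2 := hb j x rfl hx
    push_cast
    omega
  have hfar : ∀ r c r' c' a b, f r c = some a → f r' c' = some b → r < r' → c < c' → Far a b := by
    intro r c r' c' a b ha hb' hr hc
    simp only [hf, hg, Filling.upd] at ha hb'
    split_ifs at ha with h1 h2 h3
    · split_ifs at hb' with h4 h5
      · omega
      · omega
      · have := hrow _ _ _ hb'
        omega
    · split_ifs at hb' with h4 h5
      · omega
      · omega
      · have := hrow _ _ _ hb'
        omega
    · split_ifs at hb' with h4 h5
      · have h6 := he.le _ _ _ ha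
        have := hlow r c a ha (by omega) (by omega)
        cases hb'
        left
        omega
      · have h6 := he.le _ _ _ ha
        have := hlow r c a ha (by omega) (by omega)
        cases hb'
        left
        omega
      · exact he.far hr hc ha hb'
  have h1 := eqv_rows_cols (n := n + 2) hfar
  have r1 : rowW (n + 2) f (n + 1) = [u] := by
    rw [rowW, seqW_split (a := k) (x := u) (by omega)
      (by rw [hf, Filling.upd_of_ne _ _ (by omega), Filling.upd_self])]
    rw [seqW_eq_nil fun i hi => ?_, tailW_eq_nil fun i hi => ?_]
    · rfl
    · rw [hf, Filling.upd_of_ne _ _ (by omega), Filling.upd_of_ne _ _ (by omega),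
        hge _ _ (by omega), hempty _ _ (by omega)]
    · rw [hf, Filling.upd_of_ne _ _ (by omega), Filling.upd_of_ne _ _ (by omega),
        hge _ _ (by omega), hempty _ _ (by omega)]
  have r2 : rowW (n + 2) f n = [v] := by
    rw [rowW, seqW_split (a := k + 1) (x := v) (by omega)
      (by rw [hf, Filling.upd_self])]
    rw [seqW_eq_nil fun i hi => ?_, tailW_eq_nil fun i hi => ?_]
    · rfl
    · rw [hf, Filling.upd_of_ne _ _ (by omega), Filling.upd_of_ne _ _ (by omega),
        hge _ _ (by omega), hempty _ _ (by omega)]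
    · rw [hf, Filling.upd_of_ne _ _ (by omega), Filling.upd_of_ne _ _ (by omega),
        hge _ _ (by omega), hempty _ _ (by omega)]
  have r3 : ∀ i, n ≤ i → rowW (n + 2) g i = [] := fun i hi =>
    seqW_eq_nil fun j _ => by rw [hge _ _ (by omega), hempty _ _ hi]
  have c1 : colW (n + 2) f k = colW (n + 2) (e.upd k k (some u)) k := by
    rw [colW, colW, seqW_split (a := n + 1) (x := u) (f := fun r => f r k) (by omega)
        (by rw [hf, Filling.upd_of_ne _ _ (by omega), Filling.upd_self]),
      seqW_split (a := k) (x := u) (f := fun r => e.upd k k (some u) r k) (by omega)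
        (Filling.upd_self _ _ _ _),
      tailW_eq_nil fun i hi => ?_, tailW_eq_nil fun i hi => ?_]
    · rw [seqW_congr (n := n + 1) (g := fun r => g r k) fun i hi => ?_,
        seqW_split_none (a := k) (by omega) fun i hi => ?_,
        seqW_congr (f := fun r => g r k) (g := fun r => e.upd k k (some u) r k) fun i hi => ?_]
      · rw [hge _ _ (by omega), Filling.upd_of_ne _ _ (by omega)]
      · rcases hi.eq_or_lt with rfl | hi
        · rw [hg, Filling.upd_self]
        · rw [hge _ _ (by omega), hdiag _ _ hi]
      · rw [hf, Filling.upd_of_ne _ _ (by omega), Filling.upd_of_ne _ _ (by omega)]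
    · rw [Filling.upd_of_ne _ _ (by omega), hdiag _ _ (by omega)]
    · rw [hf, Filling.upd_of_ne _ _ (by omega), Filling.upd_of_ne _ _ (by omega),
        hge _ _ (by omega), hempty _ _ (by omega)]
  have c2 : colW (n + 2) f (k + 1) = v :: colW (n + 2) (e.upd k k (some u)) (k + 1) := by
    rw [colW_upd_of_ne _ _ _ (by omega), colW, colW,
      seqW_split (a := n) (x := v) (f := fun r => f r (k + 1)) (by omega)
        (by rw [hf, Filling.upd_self]), tailW_eq_nil fun i hi => ?_,
      seqW_split_none (a := n) (f := fun r => e r (k + 1)) (by omega)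
        fun i hi => hempty _ _ hi,
      seqW_congr (f := fun r => f r (k + 1)) (g := fun r => e r (k + 1)) fun i hi => ?_]
    · simp
    · rw [hfg _ _ hi, hge _ _ (by omega)]
    · rw [hf, Filling.upd_of_ne _ _ (by omega), Filling.upd_of_ne _ _ (by omega),
        hge _ _ (by omega), hempty _ _ (by omega)]
  have c3 : ∀ i, i ≠ k → i ≠ k + 1 →
      colW (n + 2) f i = colW (n + 2) (e.upd k k (some u)) i := fun i h1 h2 => by
    rw [hf, colW_upd_of_ne _ _ _ h2, colW_upd_of_ne _ _ _ h1, hg, colW_upd_of_ne _ _ _ h1,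
      colW_upd_of_ne _ _ _ h1]
  have e1 : downW (rowW (n + 2) f) (n + 2) = u :: v :: downW (rowW (n + 2) g) (n + 2) := by
    rw [downW, downW, r1, r2, downW, downW, r3 _ (by omega), r3 _ (by omega),
      downW_congr (s := rowW (n + 2) f) (t := rowW (n + 2) g) fun i hi =>
        seqW_congr fun j _ => hfg i j hi]
    rfl
  have e2 : upW (colW (n + 2) f) (n + 2) =
      readCol (n + 2) (e.upd k k (some u)) (k + 1) v := by
    have h2 := upW_add (colW (n + 2) f) (k + 1) (n + 2 - (k + 1))
    rw [show k + 1 + (n + 2 - (k + 1)) = n + 2 by omega] at h2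
    rw [h2, readCol, upTailW_split (colW (n + 2) f) (k := k + 1) (n := n + 2) (by omega),
      upTailW_split (colW (n + 2) (e.upd k k (some u))) (k := k + 1) (n := n + 2) (by omega), c2, upW, upW, c1,
      upW_congr fun i hi => c3 i (by omega) (by omega),
      upTailW_congr (s := colW (n + 2) f) (a := k + 1 + 1) fun i hi => c3 i (by omega) (by omega)]
    simp
  rw [e1, e2] at h1
  rwa [hg] at h1

theorem Eqv.move_list {a b : PWord} (h : ∀ x ∈ a, ∀ y ∈ b, Far x y) : Eqv (a ++ b) (b ++ a) := by
  induction a with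
  | nil => simpa using Eqv.refl b
  | cons x a ih =>
    have h1 := (ih fun u hu => h u (by simp [hu])).cons x
    have h2 := (Eqv.move x (h x (by simp))).append (Eqv.refl a)
    simpa using h1.trans (by simpa using h2)

theorem Good.upper {e : Filling} (h : Good e) {k n : ℕ} {d x : Letter} (hd : e k k = some d)
    (hx : x ∈ downTailW (rowW n e) (k + 1) (n - (k + 1))) : d.ceil + 2 ≤ x.ceil := by
  obtain ⟨r, hr, -, hx⟩ := mem_downTailW hx
  obtain ⟨c, -, hx⟩ := mem_seqW.1 hx
  have h1 := h.le _ _ _ hx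
  have := h.dist (by omega) (by omega) hd hx
  omega

theorem Good.right {e : Filling} (h : Good e) {k c a n : ℕ} {d x : Letter} (hd : e k c = some d)
    (hx : x ∈ tailW (c + a) n (e k)) : d.ceil + a ≤ x.ceil := by
  obtain ⟨i, hi, -, hx⟩ := mem_tailW hx
  have := h.dist le_rfl (by omega) hd hx
  omega

theorem rowW_diag {e : Filling} (h : Good e) {k n : ℕ} {d : Letter} (hk : k < n)
    (hd : e k k = some d) : rowW n e k = d :: tailW (k + 1) (n - k - 1) (e k) := by
  rw [rowW, seqW_split hk hd, seqW_eq_nil, List.nil_append]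
  intro i hi
  by_contra h'
  obtain ⟨x, hx⟩ := Option.ne_none_iff_exists'.1 h'
  have := h.le _ _ _ hx
  omega

theorem readRow_diag_split {e : Filling} (h : Good e) {k n : ℕ} {d : Letter} (hk : k < n)
    (hd : e k k = some d) (w : Letter) : readRow n e k w =
      downTailW (rowW n e) (k + 1) (n - (k + 1)) ++
        (d :: tailW (k + 1) (n - k - 1) (e k) ++ w :: downW (rowW n e) k) := by
  rw [readRow, downTailW_split _ hk, rowW_diag h hk hd]
  simp

theorem downW_remove_diag {e : Filling} (h : Good e) {k n : ℕ} (hk : k < n) :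
    downW (rowW n (e.upd k k none)) n =
      downTailW (rowW n e) (k + 1) (n - (k + 1)) ++
        (tailW (k + 1) (n - k - 1) (e k) ++ downW (rowW n e) k) := by
  have h1 := downW_add (rowW n (e.upd k k none)) (k + 1) (n - (k + 1))
  rw [show k + 1 + (n - (k + 1)) = n by omega] at h1
  have h2 : rowW n (e.upd k k none) k = tailW (k + 1) (n - k - 1) (e k) := by
    have h3 := seqW_eq_append k (n - k - 1 + 1) (e.upd k k none k)
    rw [show k + (n - k - 1 + 1) = n by omega] at h3
    rw [rowW, h3, tailW_cons_none (Filling.upd_self _ _ _ _), seqW_eq_nil, List.nil_append]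
    · exact tailW_congr fun i hi => Filling.upd_of_ne _ _ (by omega)
    · intro i hi
      rw [Filling.upd_of_ne _ _ (by omega)]
      by_contra h'
      obtain ⟨x, hx⟩ := Option.ne_none_iff_exists'.1 h'
      have := h.le _ _ _ hx
      omega
  rw [h1, downW, h2,
    downTailW_congr (t := rowW n e) fun i hi => rowW_upd_of_ne n e _ (by omega),
    downW_congr (t := rowW n e) fun i hi => rowW_upd_of_ne n e _ (by omega)]

/-- Bumping an entry on the main diagonal. -/
theorem readRow_diag {n k : ℕ} {e : Filling} {m w : Letter} (he : Good e) (hn : e.Within n)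
    (hm : e k k = some m) (hw : w.ceil < m.ceil)
    (hb : ∀ j x, k = j + 1 → e j k = some x → x.ceil < w.ceil) :
    EqvFront (readRow (n + 2) e k w)
      (readCol (n + 2) (e.upd k k (some w.unprime)) (k + 1) ⟨m.ceil, w.primed⟩) := by
  have hk : k < n + 2 := (hn _ _ _ hm).trans (by omega)
  have hmp := he.diag _ _ hm
  obtain ⟨i, q⟩ := m
  obtain ⟨j, p⟩ := w
  subst hmp
  have h1 := diag_transport (u := ⟨j, false⟩) (v := ⟨i, p⟩) he hn hm hw hb
  rw [downW_remove_diag he hk] at h1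
  have h2 := readRow_diag_split he hk hm ⟨j, p⟩
  set D := downTailW (rowW (n + 2) e) (k + 1) (n + 2 - (k + 1)) with hD
  set X := tailW (k + 1) (n + 2 - k - 1) (e k) with hX
  set L := downW (rowW (n + 2) e) k
  have h3 : Eqv (X ++ [⟨j, p⟩]) ([⟨j, p⟩] ++ X) := Eqv.move_list fun x hx y hy => by
    rw [List.mem_singleton] at hy
    subst hy
    have := he.right hm hx
    right
    dsimp only at this hw ⊢
    omega
  have h4 : Eqv (D ++ [⟨i, false⟩, ⟨j, p⟩]) ([⟨i, false⟩, ⟨j, p⟩] ++ D) :=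
    Eqv.move_list fun x hx y hy => by
      have := he.upper hm hx
      dsimp only at this hw
      simp only [List.mem_cons, List.not_mem_nil, or_false] at hy
      right
      rcases hy with rfl | rfl
      · exact this
      · dsimp only
        omega
  have h5 := (Eqv.refl (D ++ [⟨i, false⟩])).append (h3.append (Eqv.refl L))
  have h6 := h4.append (Eqv.refl (X ++ L))
  have h7 := (EqvFront.swap (i := i) (j := j) (by dsimp only at hw; omega) false p).append
    (Eqv.refl (D ++ (X ++ L)))
  rw [h2]
  simp only [List.append_assoc, List.cons_append, List.nil_append] at h5 h6 h7 ⊢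
  exact ((h5.trans h6).front.trans h7).trans h1.front

theorem EqvFront.eq_diag (i : ℤ) :
    EqvFront [⟨i + 2, false⟩, ⟨i, false⟩, ⟨i + 1, false⟩, ⟨i, false⟩]
      [⟨i, false⟩, ⟨i + 1, false⟩, ⟨i + 2, false⟩, ⟨i + 1, false⟩] := by
  have h1 : EqvFront ([⟨i + 2, false⟩] ++ [⟨i, false⟩, ⟨i + 1, false⟩, ⟨i, false⟩])
      ([⟨i + 2, false⟩] ++ [⟨i + 1, false⟩, ⟨i, false⟩, ⟨i + 1, false⟩]) :=
    ((Eqv.refl _).append (Eqv.braid i false false)).front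
  have h2 : EqvFront ([⟨i + 2, false⟩, ⟨i + 1, false⟩] ++ [⟨i, false⟩, ⟨i + 1, false⟩])
      ([⟨i + 1, false⟩, ⟨i + 2, false⟩] ++ [⟨i, false⟩, ⟨i + 1, false⟩]) :=
    (EqvFront.swap (by omega) false false).append (Eqv.refl _)
  have h3 : EqvFront ([⟨i + 1, false⟩] ++ ([⟨i + 2, false⟩, ⟨i, false⟩] ++ [⟨i + 1, false⟩]))
      ([⟨i + 1, false⟩] ++ ([⟨i, false⟩, ⟨i + 2, false⟩] ++ [⟨i + 1, false⟩])) :=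
    ((Eqv.refl _).append ((Eqv.swap (Or.inr le_rfl)).append (Eqv.refl _))).front
  have h4 : EqvFront ([⟨i + 1, false⟩, ⟨i, false⟩] ++ [⟨i + 2, false⟩, ⟨i + 1, false⟩])
      ([⟨i, false⟩, ⟨i + 1, false⟩] ++ [⟨i + 2, false⟩, ⟨i + 1, false⟩]) :=
    (EqvFront.swap (by omega) false false).append (Eqv.refl _)
  exact ((h1.trans h2).trans h3).trans h4

theorem readRow_readCol_eq_diag {n k : ℕ} {e : Filling} {i : ℤ} (he : Good e) (hn : e.Within n)
    (hx : e k k = some ⟨i, false⟩) (hy : e k (k + 1) = some ⟨i + 1, false⟩)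
    (ht : e (k + 1) (k + 1) = some ⟨i + 2, false⟩)
    (hb : ∀ j x, k = j + 1 → e j k = some x → x.ceil < i) :
    ∃ Z, ∀ p, Eqv (readRow (n + 2) e k ⟨i, p⟩)
        ([⟨i + 2, false⟩, ⟨i, false⟩, ⟨i + 1, false⟩, ⟨i, p⟩] ++ Z) ∧
      Eqv (readCol (n + 2) e (k + 1) ⟨i + 1, p⟩)
        ([⟨i, false⟩, ⟨i + 1, p⟩, ⟨i + 2, false⟩, ⟨i + 1, false⟩] ++ Z) := by
  have hk : k + 1 < n + 2 := (hn _ _ _ hy).trans (by omega)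
  have hD : downTailW (rowW (n + 2) e) (k + 1) (n + 2 - (k + 1)) =
      downTailW (rowW (n + 2) e) (k + 2) (n + 2 - (k + 2)) ++
        ⟨i + 2, false⟩ :: tailW (k + 2) (n + 2 - (k + 1) - 1) (e (k + 1)) := by
    rw [downTailW_split _ hk, rowW_diag he hk ht]
  have hX : tailW (k + 1) (n + 2 - k - 1) (e k) =
      ⟨i + 1, false⟩ :: tailW (k + 2) (n + 2 - k - 2) (e k) := by
    rw [show n + 2 - k - 1 = n + 2 - k - 2 + 1 by omega, tailW_cons hy]
  have hC : ∀ p, _ := fun p => diag_transport (u := ⟨i, false⟩) (v := ⟨i + 1, p⟩) he hn hx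
    (by dsimp only; omega) hb
  simp only [downW_remove_diag he (by omega : k < n + 2), e.upd_eq_self hx, hD, hX] at hC
  have hR : ∀ p, _ := fun p => readRow_diag_split he (by omega : k < n + 2) hx ⟨i, p⟩
  simp only [hD, hX] at hR
  set D₂ := downTailW (rowW (n + 2) e) (k + 2) (n + 2 - (k + 2)) with hD₂
  set D₁ := tailW (k + 2) (n + 2 - (k + 1) - 1) (e (k + 1)) with hD₁
  set X := tailW (k + 2) (n + 2 - k - 2) (e k) with hX
  set L := downW (rowW (n + 2) e) k
  have b₂ : ∀ x ∈ D₂, i + 4 ≤ x.ceil := fun x hx => by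
    have := he.upper ht hx
    dsimp only at this
    omega
  have b₁ : ∀ x ∈ D₁, i + 3 ≤ x.ceil := fun x hx => by
    have := he.right (c := k + 1) (a := 1) ht hx
    dsimp only at this
    omega
  have b₀ : ∀ x ∈ X, i + 2 ≤ x.ceil := fun x hx' => by
    have := he.right (c := k) (a := 2) hx hx'
    dsimp only at this
    omega
  refine ⟨D₂ ++ (D₁ ++ (X ++ L)), fun p => ⟨?_, ?_⟩⟩
  · rw [hR]
    have h1 : Eqv (X ++ [⟨i, p⟩]) ([⟨i, p⟩] ++ X) := Eqv.move_list fun x hx y hy => by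
      rw [List.mem_singleton] at hy
      subst hy
      exact Or.inr (b₀ x hx)
    have h2 : Eqv (D₁ ++ [⟨i, false⟩, ⟨i + 1, false⟩, ⟨i, p⟩])
        ([⟨i, false⟩, ⟨i + 1, false⟩, ⟨i, p⟩] ++ D₁) := Eqv.move_list fun x hx y hy => by
      have := b₁ x hx
      simp only [List.mem_cons, List.not_mem_nil, or_false] at hy
      right
      rcases hy with rfl | rfl | rfl <;> dsimp only <;> omega
    have h3 : Eqv (D₂ ++ [⟨i + 2, false⟩, ⟨i, false⟩, ⟨i + 1, false⟩, ⟨i, p⟩])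
        ([⟨i + 2, false⟩, ⟨i, false⟩, ⟨i + 1, false⟩, ⟨i, p⟩] ++ D₂) :=
      Eqv.move_list fun x hx y hy => by
        have := b₂ x hx
        simp only [List.mem_cons, List.not_mem_nil, or_false] at hy
        right
        rcases hy with rfl | rfl | rfl | rfl <;> dsimp only <;> omega
    have h4 := (Eqv.refl (D₂ ++ ⟨i + 2, false⟩ :: D₁ ++ [⟨i, false⟩, ⟨i + 1, false⟩])).append
      (h1.append (Eqv.refl L))
    have h5 := (Eqv.refl (D₂ ++ [⟨i + 2, false⟩])).append (h2.append (Eqv.refl (X ++ L)))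
    have h6 := h3.append (Eqv.refl (D₁ ++ (X ++ L)))
    simp only [List.append_assoc, List.cons_append, List.nil_append] at h4 h5 h6 ⊢
    exact (h4.trans h5).trans h6
  · refine (hC p).symm.trans ?_
    have h2 : Eqv (D₁ ++ [⟨i + 1, false⟩]) ([⟨i + 1, false⟩] ++ D₁) :=
      Eqv.move_list fun x hx y hy => by
        have := b₁ x hx
        rw [List.mem_singleton] at hy
        subst hy
        right
        dsimp only
        omega
    have h3 : Eqv (D₂ ++ [⟨i + 2, false⟩, ⟨i + 1, false⟩])
        ([⟨i + 2, false⟩, ⟨i + 1, false⟩] ++ D₂) :=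
      Eqv.move_list fun x hx y hy => by
        have := b₂ x hx
        simp only [List.mem_cons, List.not_mem_nil, or_false] at hy
        right
        rcases hy with rfl | rfl <;> dsimp only <;> omega
    have h5 := (Eqv.refl (⟨i, false⟩ :: ⟨i + 1, p⟩ :: (D₂ ++ [⟨i + 2, false⟩]))).append
      (h2.append (Eqv.refl (X ++ L)))
    have h6 := (Eqv.refl [⟨i, false⟩, ⟨i + 1, p⟩]).append (h3.append (Eqv.refl (D₁ ++ (X ++ L))))
    simp only [List.append_assoc, List.cons_append, List.nil_append] at h5 h6 ⊢
    exact h5.trans h6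

/-- Inserting into a row a letter whose ceiling is that of the entry on the main diagonal. -/
theorem readRow_eq_diag {n k : ℕ} {e : Filling} {i : ℤ} {p : Bool} {z : Equiv.Perm ℤ}
    (he : Good e) (hn : e.Within n) (hx : e k k = some ⟨i, false⟩)
    (hy : e k (k + 1) = some ⟨i + 1, false⟩)
    (hb : ∀ j x, k = j + 1 → e j k = some x → x.ceil < i)
    (hz : readRow (n + 2) e k ⟨i, p⟩ ∈ RinvPlus z) :
    p = false ∧ readCol (n + 2) e (k + 1) ⟨i + 1, false⟩ ∈ RinvPlus z := by
  have hk : k + 1 < n + 2 := (hn _ _ _ hy).trans (by omega)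
  by_cases ht : e (k + 1) (k + 1) = some ⟨i + 2, false⟩
  · obtain ⟨Z, hZ⟩ := readRow_readCol_eq_diag he hn hx hy ht hb
    have h1 := ((hZ p).1.front.mem_iff z).1 hz
    have h2 : Eqv ([⟨i + 2, false⟩, ⟨i, false⟩, ⟨i + 1, false⟩, ⟨i, p⟩] ++ Z)
        ([⟨i + 2, false⟩, ⟨i + 1, p⟩] ++ ([⟨i, false⟩, ⟨i + 1, false⟩] ++ Z)) :=
      ((Eqv.refl [⟨i + 2, false⟩]).append (Eqv.braid i p false)).append (Eqv.refl Z)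
    have hp : p = false := by
      by_contra hp
      refine not_mem_of_front ?_ z _ ((h2.front.mem_iff z).1 h1)
      have := run_one_adjacent (i := i + 2) (j := i + 1) (Or.inr (by omega)) false p
      rw [← Option.not_isSome_iff_eq_none, this]
      exact hp
    subst hp
    refine ⟨rfl, ((hZ false).2.front.mem_iff z).2 ?_⟩
    exact (((EqvFront.eq_diag i).append (Eqv.refl Z)).mem_iff z).1 h1
  · exfalso
    have hD : ∀ x ∈ downTailW (rowW (n + 2) e) (k + 1) (n + 2 - (k + 1)), i + 3 ≤ x.ceil := by
      intro x hx'
      obtain ⟨r, hr, -, hx'⟩ := mem_downTailW hx'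
      obtain ⟨c, -, hx'⟩ := mem_seqW.1 hx'
      have hrc := he.le _ _ _ hx'
      obtain ⟨⟨t, q⟩, ht'⟩ := he.box (r := k + 1) (c := k + 1) hr (by omega) le_rfl hx'
      have h1 := he.dist hr (by omega : k + 1 ≤ c) ht' hx'
      have h2 := he.dist (by omega) le_rfl hy ht'
      have h3 := he.diag _ _ ht'
      dsimp only at h1 h2 h3
      subst h3
      have h4 : t ≠ i + 2 := by
        rintro rfl
        exact ht ht'
      push_cast at h1 h2
      omega
    rw [readRow_diag_split he (by omega) hx, show n + 2 - k - 1 = n + 2 - k - 2 + 1 by omega,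
      tailW_cons hy] at hz
    set D := downTailW (rowW (n + 2) e) (k + 1) (n + 2 - (k + 1))
    set X := tailW (k + 1 + 1) (n + 2 - k - 2) (e k) with hX
    set L := downW (rowW (n + 2) e) k
    have h1 : Eqv (X ++ [⟨i, p⟩]) ([⟨i, p⟩] ++ X) := Eqv.move_list fun x hx' y hy => by
      rw [List.mem_singleton] at hy
      subst hy
      have := he.right (c := k) (a := 2) hx hx'
      exact Or.inr this
    have h2 : Eqv (D ++ [⟨i, false⟩, ⟨i + 1, false⟩, ⟨i, p⟩])
        ([⟨i, false⟩, ⟨i + 1, false⟩, ⟨i, p⟩] ++ D) := Eqv.move_list fun x hx y hy => by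
      have := hD x hx
      simp only [List.mem_cons, List.not_mem_nil, or_false] at hy
      right
      rcases hy with rfl | rfl | rfl <;> dsimp only <;> omega
    have h4 := (Eqv.refl (D ++ [⟨i, false⟩, ⟨i + 1, false⟩])).append (h1.append (Eqv.refl L))
    have h5 := h2.append (Eqv.refl (X ++ L))
    simp only [List.append_assoc, List.cons_append, List.nil_append] at h4 h5 hz
    refine not_mem_of_front (a := [⟨i, false⟩, ⟨i + 1, false⟩, ⟨i, p⟩]) ?_ z (D ++ (X ++ L))
      (((h4.trans h5).front.mem_iff z).1 hz)
    exact run_one_braid (Or.inl rfl) p false false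

/-- The inverse of `readRow_eq_diag`. -/
theorem readCol_eq_diag {n k : ℕ} {e : Filling} {i j : ℤ} {p : Bool} {z : Equiv.Perm ℤ}
    (he : Good e) (hn : e.Within n) (hx : e k k = some ⟨i, false⟩)
    (hy : e k (k + 1) = some ⟨j, false⟩)
    (hz : readCol (n + 2) e (k + 1) ⟨j, p⟩ ∈ RinvPlus z) :
    j = i + 1 ∧ p = false ∧ readRow (n + 2) e k ⟨i, false⟩ ∈ RinvPlus z := by
  have hk : k + 1 < n + 2 := (hn _ _ _ hy).trans (by omega)
  have hij : i < j := by
    have := he.dist le_rfl (by omega) hx hy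
    push_cast at this
    omega
  have hb : ∀ l x, k = l + 1 → e l k = some x → x.ceil < i := fun l x hl hx' => by
    subst hl
    have := he.dist (by omega) le_rfl hx' hx
    push_cast at this
    omega
  have hC := diag_transport (u := ⟨i, false⟩) (v := ⟨j, p⟩) he hn hx hij hb
  rw [downW_remove_diag he (by omega : k < n + 2), e.upd_eq_self hx,
    show n + 2 - k - 1 = n + 2 - k - 2 + 1 by omega, tailW_cons hy] at hC
  have hz' := (hC.front.mem_iff z).2 hz
  have hD : ∀ x r c, e r c = some x → k + 1 ≤ r → j + 1 + (r - (k + 1)) + (c - (k + 1)) ≤ x.ceil := by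
    intro x r c hx' hr
    have hrc := he.le _ _ _ hx'
    have := he.dist (by omega : k ≤ r) (by omega : k + 1 ≤ c) hy hx'
    push_cast at this ⊢
    omega
  by_cases ht : e (k + 1) (k + 1) = some ⟨j + 1, false⟩
  · have hji : j = i + 1 := by
      by_contra hji
      rw [downTailW_split _ hk, rowW_diag he hk ht] at hz'
      set D₂ := downTailW (rowW (n + 2) e) (k + 1 + 1) (n + 2 - (k + 1 + 1)) with hD₂
      set D₁ := tailW (k + 1 + 1) (n + 2 - (k + 1) - 1) (e (k + 1)) with hD₁
      set X := tailW (k + 1 + 1) (n + 2 - k - 2) (e k) with hX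
      set L := downW (rowW (n + 2) e) k
      have b₂ : ∀ x ∈ D₂, j + 3 ≤ x.ceil := fun x hx => by
        have := he.upper ht hx
        dsimp only at this
        omega
      have b₁ : ∀ x ∈ D₁, j + 2 ≤ x.ceil := fun x hx => by
        have := he.right (c := k + 1) (a := 1) ht hx
        dsimp only at this
        omega
      have h1 : Eqv (D₁ ++ [⟨j, false⟩]) ([⟨j, false⟩] ++ D₁) :=
        Eqv.move_list fun x hx y hy => by
          rw [List.mem_singleton] at hy
          subst hy
          exact Or.inr (b₁ x hx)
      have h2 : Eqv (D₂ ++ [⟨j + 1, false⟩, ⟨j, false⟩]) ([⟨j + 1, false⟩, ⟨j, false⟩] ++ D₂) :=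
        Eqv.move_list fun x hx y hy => by
          have := b₂ x hx
          simp only [List.mem_cons, List.not_mem_nil, or_false] at hy
          right
          rcases hy with rfl | rfl <;> dsimp only <;> omega
      have h3 : Eqv ([⟨i, false⟩] ++ [⟨j, p⟩, ⟨j + 1, false⟩, ⟨j, false⟩])
          ([⟨j, p⟩, ⟨j + 1, false⟩, ⟨j, false⟩] ++ [⟨i, false⟩]) :=
        Eqv.move_list fun x hx y hy => by
          rw [List.mem_singleton] at hx
          subst hx
          simp only [List.mem_cons, List.not_mem_nil, or_false] at hy
          left
          rcases hy with rfl | rfl | rfl <;> dsimp only <;> omega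
      have h4 := (Eqv.refl (⟨i, false⟩ :: ⟨j, p⟩ :: (D₂ ++ [⟨j + 1, false⟩]))).append
        (h1.append (Eqv.refl (X ++ L)))
      have h5 := (Eqv.refl [⟨i, false⟩, ⟨j, p⟩]).append (h2.append (Eqv.refl (D₁ ++ (X ++ L))))
      have h6 := h3.append (Eqv.refl (D₂ ++ (D₁ ++ (X ++ L))))
      simp only [List.append_assoc, List.cons_append, List.nil_append] at h4 h5 h6 hz'
      refine not_mem_of_front (a := [⟨j, p⟩, ⟨j + 1, false⟩, ⟨j, false⟩]) ?_ z
        (⟨i, false⟩ :: (D₂ ++ (D₁ ++ (X ++ L)))) ((((h4.trans h5).trans h6).front.mem_iff z).1 hz')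
      exact run_one_braid (Or.inl rfl) false false p
    subst hji
    rw [show i + 1 + 1 = i + 2 by ring] at ht
    obtain ⟨Z, hZ⟩ := readRow_readCol_eq_diag he hn hx hy ht hb
    have h1 := ((hZ p).2.front.mem_iff z).1 hz
    have hp : p = false := by
      by_contra hp
      refine not_mem_of_front (a := [⟨i, false⟩, ⟨i + 1, p⟩]) ?_ z
        ([⟨i + 2, false⟩, ⟨i + 1, false⟩] ++ Z) h1
      have := run_one_adjacent (i := i) (j := i + 1) (Or.inl (by omega)) false p
      rw [← Option.not_isSome_iff_eq_none, this]
      exact hp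
    subst hp
    refine ⟨rfl, rfl, ((hZ false).1.front.mem_iff z).2 ?_⟩
    exact (((EqvFront.eq_diag i).append (Eqv.refl Z)).mem_iff z).2 h1
  · exfalso
    have hD : ∀ x ∈ downTailW (rowW (n + 2) e) (k + 1) (n + 2 - (k + 1)), j + 2 ≤ x.ceil := by
      intro x hx'
      obtain ⟨r, hr, -, hx'⟩ := mem_downTailW hx'
      obtain ⟨c, -, hx'⟩ := mem_seqW.1 hx'
      have hrc := he.le _ _ _ hx'
      obtain ⟨⟨t, q⟩, ht'⟩ := he.box (r := k + 1) (c := k + 1) hr (by omega) le_rfl hx'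
      have h1 := he.dist hr (by omega : k + 1 ≤ c) ht' hx'
      have h2 := he.dist (by omega) le_rfl hy ht'
      have h3 := he.diag _ _ ht'
      dsimp only at h1 h2 h3
      subst h3
      have h4 : t ≠ j + 1 := by
        rintro rfl
        exact ht ht'
      push_cast at h1 h2
      omega
    set D := downTailW (rowW (n + 2) e) (k + 1) (n + 2 - (k + 1))
    set X := tailW (k + 1 + 1) (n + 2 - k - 2) (e k) with hX
    set L := downW (rowW (n + 2) e) k
    have h1 : Eqv (D ++ [⟨j, false⟩]) ([⟨j, false⟩] ++ D) := Eqv.move_list fun x hx' y hy => by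
      rw [List.mem_singleton] at hy
      subst hy
      exact Or.inr (hD x hx')
    have h4 := (Eqv.refl [⟨i, false⟩, ⟨j, p⟩]).append (h1.append (Eqv.refl (X ++ L)))
    simp only [List.append_assoc, List.cons_append, List.nil_append] at h4 hz'
    exact (dead_pair j p false).not_mem z [⟨i, false⟩] (D ++ (X ++ L))
      ((h4.front.mem_iff z).1 hz')

theorem not_mem_of_dead_pair {z : Equiv.Perm ℤ} {A r B : PWord} {a b : Letter}
    (hab : a.ceil = b.ceil) (hr : ∀ x ∈ r, Far a x) : A ++ (a :: (r ++ b :: B)) ∉ RinvPlus z := by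
  intro h
  have h1 := (Eqv.refl A).append ((Eqv.move a hr).append (Eqv.refl (b :: B)))
  simp only [List.append_assoc, List.cons_append, List.nil_append] at h1
  have h2 := (h1.front.mem_iff z).1 h
  obtain ⟨i, p⟩ := a
  obtain ⟨j, q⟩ := b
  dsimp only at hab
  subst hab
  exact (dead_pair i p q).not_mem z (A ++ r) B (by simpa using h2)

theorem not_mem_of_dead_braid_left {z : Equiv.Perm ℤ} {A r B : PWord} {a b y : Letter}
    (hab : a.ceil = b.ceil) (hy : y.ceil = a.ceil + 1 ∨ a.ceil = y.ceil + 1)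
    (hp : y.primed = true) (hr : ∀ x ∈ r, Far a x) :
    A ++ (a :: (r ++ y :: b :: B)) ∉ RinvPlus z := by
  intro h
  have h1 := (Eqv.refl A).append ((Eqv.move a hr).append (Eqv.refl (y :: b :: B)))
  simp only [List.append_assoc, List.cons_append, List.nil_append] at h1
  have h2 := (h1.front.mem_iff z).1 h
  obtain ⟨i, p⟩ := a
  obtain ⟨j, q⟩ := b
  obtain ⟨l, s⟩ := y
  dsimp only at hab hy hp
  subst hab hp
  exact (dead_braid_primed hy q p).not_mem z (A ++ r) B (by simpa using h2)

theorem not_mem_of_dead_braid_right {z : Equiv.Perm ℤ} {A r B : PWord} {a b y : Letter}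
    (hab : a.ceil = b.ceil) (hy : y.ceil = a.ceil + 1 ∨ a.ceil = y.ceil + 1)
    (hp : y.primed = true) (hr : ∀ x ∈ r, Far b x) :
    A ++ (a :: y :: (r ++ b :: B)) ∉ RinvPlus z := by
  intro h
  have h1 := (Eqv.refl (A ++ [a, y])).append ((Eqv.move b hr).symm.append (Eqv.refl B))
  simp only [List.append_assoc, List.cons_append, List.nil_append] at h1
  have h2 := (h1.front.mem_iff z).1 h
  obtain ⟨i, p⟩ := a
  obtain ⟨j, q⟩ := b
  obtain ⟨l, s⟩ := y
  dsimp only at hab hy hp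
  subst hab hp
  exact (dead_braid_primed hy q p).not_mem z A (r ++ B) (by simpa using h2)

/-- Entries increase by at least one from each position to the next. -/
def Steep (g : ℕ → Option Letter) : Prop :=
  ∀ i j x y, i ≤ j → g i = some x → g j = some y → x.ceil + (j - i : ℤ) ≤ y.ceil

theorem Good.steep_row {e : Filling} (h : Good e) (k : ℕ) : Steep (e k) :=
  fun i j x y hij hx hy => by simpa using h.dist le_rfl hij hx hy

theorem Good.steep_col {e : Filling} (h : Good e) (k : ℕ) : Steep fun r => e r k :=
  fun i j x y hij hx hy => by simpa using h.dist hij le_rfl hx hy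

theorem Steep.far_tail {g : ℕ → Option Letter} (hg : Steep g) {c n : ℕ} {m x : Letter}
    (hm : g c = some m) (h : ∀ y, g (c + 1) = some y → y.ceil ≠ m.ceil + 1)
    (hx : x ∈ tailW (c + 1) n g) : m.ceil + 2 ≤ x.ceil := by
  obtain ⟨j, hj, -, hx⟩ := mem_tailW hx
  have h1 := hg _ _ _ _ (by omega) hm hx
  rcases Nat.lt_or_ge (c + 1) j with h2 | h2
  · omega
  · obtain rfl : j = c + 1 := by omega
    have := h _ hx
    omega

theorem Steep.far_tail₂ {g : ℕ → Option Letter} (hg : Steep g) {c n : ℕ} {m x : Letter}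
    (hm : g c = some m) (hx : x ∈ tailW (c + 2) n g) : m.ceil + 2 ≤ x.ceil := by
  obtain ⟨j, hj, -, hx⟩ := mem_tailW hx
  have h1 := hg _ _ _ _ (by omega) hm hx
  omega

theorem Steep.seq_lt {g : ℕ → Option Letter} (hg : Steep g) {c : ℕ} {m x : Letter}
    (hm : g c = some m) (hx : x ∈ seqW c g) : x.ceil < m.ceil := by
  obtain ⟨j, hj, hx⟩ := mem_seqW.1 hx
  have h1 := hg _ _ _ _ (by omega) hx hm
  omega

theorem Letter.eq_mk {x : Letter} {i : ℤ} (h : x.ceil = i) (h' : x.primed ≠ true) :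
    x = ⟨i, false⟩ := by
  obtain ⟨j, p⟩ := x
  cases p <;> simp_all

theorem Steep.next_of_row {g : ℕ → Option Letter} (hg : Steep g) {c n : ℕ} {m w : Letter}
    {z : Equiv.Perm ℤ} {A B : PWord} (hm : g c = some m) (hw : m.ceil = w.ceil) (hc : c + 1 < n)
    (hz : A ++ (seqW n g ++ w :: B) ∈ RinvPlus z) : g (c + 1) = some ⟨w.ceil + 1, false⟩ := by
  by_cases h : ∃ y, g (c + 1) = some y ∧ y.ceil = m.ceil + 1
  · obtain ⟨y, hy, hy'⟩ := h
    rw [hy, Letter.eq_mk (hy'.trans (by rw [hw]))]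
    intro hp
    rw [seqW_split₂ hc hm hy] at hz
    refine not_mem_of_dead_braid_right (z := z) (A := A ++ seqW c g)
      (r := tailW (c + 2) (n - c - 2) g) (B := B) hw (Or.inl hy') hp ?_ (by simpa using hz)
    intro x hx
    have := hg.far_tail₂ hm hx
    exact Or.inl (by omega)
  · exfalso
    push Not at h
    rw [seqW_split (by omega) hm] at hz
    refine not_mem_of_dead_pair (z := z) (A := A ++ seqW c g) (r := tailW (c + 1) (n - c - 1) g)
      (B := B) hw ?_ (by simpa using hz)
    intro x hx
    have := hg.far_tail hm h hx
    exact Or.inl (by omega)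

theorem Steep.next_of_col {g : ℕ → Option Letter} (hg : Steep g) {c n : ℕ} {m w : Letter}
    {z : Equiv.Perm ℤ} {A B : PWord} (hm : g c = some m) (hw : m.ceil = w.ceil) (hc : c + 1 < n)
    (hz : A ++ (w :: ((seqW n g).reverse ++ B)) ∈ RinvPlus z) :
    g (c + 1) = some ⟨w.ceil + 1, false⟩ := by
  by_cases h : ∃ y, g (c + 1) = some y ∧ y.ceil = m.ceil + 1
  · obtain ⟨y, hy, hy'⟩ := h
    rw [hy, Letter.eq_mk (hy'.trans (by rw [hw]))]
    intro hp
    rw [seqW_split₂ hc hm hy] at hz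
    refine not_mem_of_dead_braid_left (z := z) (A := A) (B := (seqW c g).reverse ++ B)
      (r := (tailW (c + 2) (n - c - 2) g).reverse) hw.symm (Or.inl (hw ▸ hy')) hp ?_
      (by simpa using hz)
    intro x hx
    have := hg.far_tail₂ hm (List.mem_reverse.1 hx)
    exact Or.inl (by omega)
  · exfalso
    push Not at h
    rw [seqW_split (by omega) hm] at hz
    refine not_mem_of_dead_pair (z := z) (A := A) (B := (seqW c g).reverse ++ B)
      (r := (tailW (c + 1) (n - c - 1) g).reverse) hw.symm ?_ (by simpa using hz)
    intro x hx
    have := hg.far_tail hm h (List.mem_reverse.1 hx)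
    exact Or.inl (by omega)

theorem Steep.prev_of_row {g : ℕ → Option Letter} (hg : Steep g) {c n : ℕ} {x y w : Letter}
    {z : Equiv.Perm ℤ} {A B : PWord} (hx : g c = some x) (hy : g (c + 1) = some y)
    (hw : y.ceil = w.ceil) (hc : c + 1 < n)
    (hz : A ++ (w :: (seqW n g ++ B)) ∈ RinvPlus z) : x = ⟨w.ceil - 1, false⟩ := by
  have hxy := hg _ _ _ _ (by omega) hx hy
  push_cast at hxy
  rw [seqW_split₂ hc hx hy] at hz
  by_cases h : x.ceil = w.ceil - 1
  · refine Letter.eq_mk h fun hp => ?_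
    refine not_mem_of_dead_braid_left (z := z) (A := A) (B := tailW (c + 2) (n - c - 2) g ++ B)
      (r := seqW c g) hw.symm (Or.inr (by omega)) hp ?_ (by simpa using hz)
    intro u hu
    have := hg.seq_lt hx hu
    exact Or.inr (by omega)
  · exfalso
    refine not_mem_of_dead_pair (z := z) (A := A) (B := tailW (c + 2) (n - c - 2) g ++ B)
      (r := seqW c g ++ [x]) hw.symm ?_ (by simpa using hz)
    intro u hu
    rw [List.mem_append, List.mem_singleton] at hu
    rcases hu with hu | rfl
    · have := hg.seq_lt hx hu
      exact Or.inr (by omega)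
    · exact Or.inr (by omega)

theorem Steep.prev_of_col {g : ℕ → Option Letter} (hg : Steep g) {c n : ℕ} {x y w : Letter}
    {z : Equiv.Perm ℤ} {A B : PWord} (hx : g c = some x) (hy : g (c + 1) = some y)
    (hw : y.ceil = w.ceil) (hc : c + 1 < n)
    (hz : A ++ ((seqW n g).reverse ++ w :: B) ∈ RinvPlus z) : x = ⟨w.ceil - 1, false⟩ := by
  have hxy := hg _ _ _ _ (by omega) hx hy
  push_cast at hxy
  rw [seqW_split₂ hc hx hy] at hz
  by_cases h : x.ceil = w.ceil - 1
  · refine Letter.eq_mk h fun hp => ?_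
    refine not_mem_of_dead_braid_right (z := z) (B := B)
      (A := A ++ (tailW (c + 2) (n - c - 2) g).reverse)
      (r := (seqW c g).reverse) hw (Or.inr (by omega)) hp ?_ (by simpa using hz)
    intro u hu
    have := hg.seq_lt hx (List.mem_reverse.1 hu)
    exact Or.inr (by omega)
  · exfalso
    refine not_mem_of_dead_pair (z := z) (B := B)
      (A := A ++ (tailW (c + 2) (n - c - 2) g).reverse)
      (r := x :: (seqW c g).reverse) hw ?_ (by simpa using hz)
    intro u hu
    rw [List.mem_cons] at hu
    rcases hu with rfl | hu
    · exact Or.inr (by omega)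
    · have := hg.seq_lt hx (List.mem_reverse.1 hu)
      exact Or.inr (by omega)

theorem Good.readRow_next {e : Filling} (h : Good e) {k c n : ℕ} {m w : Letter}
    {z : Equiv.Perm ℤ} (hk : k < n) (hc : c + 1 < n) (hm : e k c = some m)
    (hw : m.ceil = w.ceil) (hz : readRow n e k w ∈ RinvPlus z) :
    e k (c + 1) = some ⟨w.ceil + 1, false⟩ := by
  rw [readRow, downTailW_split _ hk, List.append_assoc] at hz
  exact (h.steep_row k).next_of_row hm hw hc hz

theorem Good.readRow_prev {e : Filling} (h : Good e) {k c n : ℕ} {x y w : Letter}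
    {z : Equiv.Perm ℤ} (hc : c + 1 < n) (hx : e k c = some x) (hy : e k (c + 1) = some y)
    (hw : y.ceil = w.ceil) (hz : readRow n e (k + 1) w ∈ RinvPlus z) :
    x = ⟨w.ceil - 1, false⟩ :=
  (h.steep_row k).prev_of_row hx hy hw hc hz

theorem Good.readCol_next {e : Filling} (h : Good e) {k r n : ℕ} {m w : Letter}
    {z : Equiv.Perm ℤ} (hk : k < n) (hr : r + 1 < n) (hm : e r k = some m)
    (hw : m.ceil = w.ceil) (hz : readCol n e k w ∈ RinvPlus z) :
    e (r + 1) k = some ⟨w.ceil + 1, false⟩ := by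
  rw [readCol, upTailW_split _ hk] at hz
  exact (h.steep_col k).next_of_col hm hw hr hz

theorem Good.readCol_prev {e : Filling} (h : Good e) {k r n : ℕ} {x y w : Letter}
    {z : Equiv.Perm ℤ} (hr : r + 1 < n) (hx : e r k = some x) (hy : e (r + 1) k = some y)
    (hw : y.ceil = w.ceil) (hz : readCol n e (k + 1) w ∈ RinvPlus z) :
    x = ⟨w.ceil - 1, false⟩ := by
  rw [readCol, upW, List.append_assoc] at hz
  exact (h.steep_col k).prev_of_col hx hy hw hr hz

theorem Filling.Within.upd {n : ℕ} {e : Filling} (h : e.Within n) {r c : ℕ} {x : Option Letter}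
    (hc : c < n) : (e.upd r c x).Within n := by
  intro r' c' y hy
  by_cases hrc : r' = r ∧ c' = c
  · rw [hrc.2]
    exact hc
  · rw [e.upd_of_ne x (by tauto)] at hy
    exact h _ _ _ hy

theorem Good.swap_row {e : Filling} (h : Good e) {k c : ℕ} {i : ℤ} {p p' q q' : Bool}
    (hx : e k c = some ⟨i, p⟩) (hy : e k (c + 1) = some ⟨i + 1, p'⟩) (hc : k < c) :
    Good ((e.upd k c (some ⟨i, q⟩)).upd k (c + 1) (some ⟨i + 1, q'⟩)) := by
  refine h.of_ceil (fun r' c' => ?_) (fun r' x hx' => ?_)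
  · by_cases h1 : r' = k ∧ c' = c + 1
    · rw [h1.1, h1.2, Filling.upd_self, hy]
      rfl
    · rw [Filling.upd_of_ne _ _ (by omega)]
      by_cases h2 : r' = k ∧ c' = c
      · rw [h2.1, h2.2, Filling.upd_self, hx]
        rfl
      · rw [Filling.upd_of_ne _ _ (by omega)]
  · rw [Filling.upd_of_ne _ _ (by omega), Filling.upd_of_ne _ _ (by omega)] at hx'
    exact h.diag _ _ hx'

theorem Good.swap_col {e : Filling} (h : Good e) {r k : ℕ} {i : ℤ} {p p' q q' : Bool}
    (hx : e r k = some ⟨i, p⟩) (hy : e (r + 1) k = some ⟨i + 1, p'⟩)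
    (hq : r + 1 = k → q' = false) :
    Good ((e.upd r k (some ⟨i, q⟩)).upd (r + 1) k (some ⟨i + 1, q'⟩)) := by
  have hrk := h.le _ _ _ hy
  refine h.of_ceil (fun r' c' => ?_) (fun r' x hx' => ?_)
  · by_cases h1 : r' = r + 1 ∧ c' = k
    · rw [h1.1, h1.2, Filling.upd_self, hy]
      rfl
    · rw [Filling.upd_of_ne _ _ (by omega)]
      by_cases h2 : r' = r ∧ c' = k
      · rw [h2.1, h2.2, Filling.upd_self, hx]
        rfl
      · rw [Filling.upd_of_ne _ _ (by omega)]
  · by_cases h1 : r' = r + 1 ∧ r' = k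
    · rw [h1.2, ← h1.1, h1.2, Filling.upd_self] at hx'
      have := hq (by omega)
      simp only [Option.some.injEq] at hx'
      rw [← hx', this]
    · rw [Filling.upd_of_ne _ _ (by omega), Filling.upd_of_ne _ _ (by omega)] at hx'
      exact h.diag _ _ hx'

/-- One step of the insertion algorithm, inserting `w` into row or column `k` of `e`; columns
are marked by `true`. -/
inductive Step : Bool → ℕ → Filling → Letter → Bool → Filling → Letter → Prop
  | row_bump {k c : ℕ} {e : Filling} {w m : Letter} (hkc : k < c) (hm : e k c = some m)
      (hw : w.ceil < m.ceil) (hl : ∀ c' < c, ∀ x, e k c' = some x → x.ceil < w.ceil) :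
      Step false k e w false (e.upd k c (some w)) m
  | row_diag {k : ℕ} {e : Filling} {w m : Letter} (hm : e k k = some m) (hw : w.ceil < m.ceil) :
      Step false k e w true (e.upd k k (some w.unprime)) ⟨m.ceil, w.primed⟩
  | row_eq {k c : ℕ} {e : Filling} {i : ℤ} {p q : Bool} (hx : e k c = some ⟨i, q⟩)
      (hy : e k (c + 1) = some ⟨i + 1, false⟩)
      (hl : ∀ c' < c, ∀ x, e k c' = some x → x.ceil < i) :
      Step false k e ⟨i, p⟩ (decide (c = k))
        ((e.upd k c (some ⟨i, false⟩)).upd k (c + 1) (some ⟨i + 1, q⟩)) ⟨i + 1, p⟩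
  | col_bump {k r : ℕ} {e : Filling} {w m : Letter} (hrk : r < k) (hm : e r k = some m)
      (hw : w.ceil < m.ceil) (hl : ∀ r' < r, ∀ x, e r' k = some x → x.ceil < w.ceil) :
      Step true k e w true (e.upd r k (some w)) m
  | col_eq {k r : ℕ} {e : Filling} {i : ℤ} {p q : Bool} (hx : e r k = some ⟨i, q⟩)
      (hy : e (r + 1) k = some ⟨i + 1, false⟩)
      (hl : ∀ r' < r, ∀ x, e r' k = some x → x.ceil < i) :
      Step true k e ⟨i, p⟩ true
        ((e.upd r k (some ⟨i, false⟩)).upd (r + 1) k (some ⟨i + 1, q⟩)) ⟨i + 1, p⟩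

/-- The state of the algorithm before `w` is inserted into row `k`. -/
structure RowInv (n : ℕ) (z : Equiv.Perm ℤ) (k : ℕ) (e : Filling) (w : Letter) : Prop where
  good : Good e
  within : e.Within n
  mem : readRow (n + 2) e k w ∈ RinvPlus z
  wit : ∀ j, k = j + 1 → ∃ c x, k ≤ c ∧ e j c = some x ∧ x.ceil < w.ceil ∧
    ∀ y, e k c = some y → w.ceil ≤ y.ceil

/-- The state of the algorithm before `w` is inserted into column `k`. -/
structure ColInv (n : ℕ) (z : Equiv.Perm ℤ) (k : ℕ) (e : Filling) (w : Letter) : Prop where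
  good : Good e
  within : e.Within n
  mem : readCol (n + 2) e k w ∈ RinvPlus z
  wit : ∃ j r x, k = j + 1 ∧ r ≤ j ∧ e r j = some x ∧ x.ceil < w.ceil ∧
    ∀ y, e r k = some y → w.ceil ≤ y.ceil
  unprimed : ∀ j y, k = j + 1 → e j k = some y → y.ceil = w.ceil → y.primed = false

/-- The state of the algorithm before `w` is inserted into row or column `k`. -/
def SegInv (n : ℕ) (z : Equiv.Perm ℤ) : Bool → ℕ → Filling → Letter → Prop
  | false => RowInv n z
  | true => ColInv n z

section

variable {n : ℕ} {z : Equiv.Perm ℤ} {k : ℕ} {e : Filling} {w : Letter}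

theorem RowInv.below (h : RowInv n z k e w) {c : ℕ} (hkc : k ≤ c)
    (hne : ∀ c', k ≤ c' → c' < c → e k c' ≠ none)
    (hl : ∀ c' < c, ∀ x, e k c' = some x → x.ceil < w.ceil) :
    ∀ j, k = j + 1 → ∃ y, e j c = some y ∧ y.ceil < w.ceil := by
  intro j hj
  obtain ⟨c', x, hc', hx, hxw, hy⟩ := h.wit j hj
  have hcc : c ≤ c' := by
    by_contra hcc
    obtain ⟨y, hy'⟩ := Option.ne_none_iff_exists'.1 (hne c' hc' (by omega))
    have h1 := hy y hy'
    have h2 := hl c' (by omega) y hy'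
    omega
  obtain ⟨y, hy', hyx⟩ := h.good.row (by omega : j ≤ c) hcc hx
  exact ⟨y, hy', by omega⟩

theorem RowInv.lt (h : RowInv n z k e w) : k < n + 2 := by
  cases k with
  | zero => omega
  | succ j =>
    obtain ⟨c, x, hc, hx, -⟩ := h.wit j rfl
    have := h.within _ _ _ hx
    omega

theorem ColInv.lt (h : ColInv n z k e w) : k < n + 1 := by
  obtain ⟨j, r, x, rfl, hr, hx, -⟩ := h.wit
  have := h.within _ _ _ hx
  omega

theorem ColInv.left (h : ColInv n z k e w) {r : ℕ}
    (hne : ∀ r' < r, e r' k ≠ none)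
    (hl : ∀ r' < r, ∀ x, e r' k = some x → x.ceil < w.ceil) :
    ∃ j, k = j + 1 ∧ r ≤ j ∧ ∃ y, e r j = some y ∧ y.ceil < w.ceil := by
  obtain ⟨j, r', x, hj, hr', hx, hxw, hy⟩ := h.wit
  have hrr : r ≤ r' := by
    by_contra hrr
    obtain ⟨y, hy'⟩ := Option.ne_none_iff_exists'.1 (hne r' (by omega))
    have h1 := hy y hy'
    have h2 := hl r' (by omega) y hy'
    omega
  obtain ⟨y, hy', hyx⟩ := h.good.col hrr hx
  exact ⟨j, hj, by omega, y, hy', by omega⟩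

theorem Good.ne_none_row {e : Filling} (h : Good e) {k c : ℕ} {m : Letter} (hm : e k c = some m) :
    ∀ c', k ≤ c' → c' < c → e k c' ≠ none := fun c' h1 h2 => by
  obtain ⟨y, hy, -⟩ := h.row h1 h2.le hm
  simp [hy]

theorem Good.ne_none_col {e : Filling} (h : Good e) {k r : ℕ} {m : Letter} (hm : e r k = some m) :
    ∀ r' < r, e r' k ≠ none := fun c' h1 => by
  obtain ⟨y, hy, -⟩ := h.col h1.le hm
  simp [hy]

theorem RowInv.bump (h : RowInv n z k e w) {c : ℕ} {m : Letter} (hkc : k < c)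
    (hm : e k c = some m) (hw : w.ceil < m.ceil)
    (hl : ∀ c' < c, ∀ x, e k c' = some x → x.ceil < w.ceil) :
    RowInv n z (k + 1) (e.upd k c (some w)) m where
  good := by
    refine h.good.upd hkc.le ?_ (h.below hkc.le (h.good.ne_none_row hm) hl) ?_ ?_ (by omega)
    · rintro c' rfl hc'
      obtain ⟨y, hy, -⟩ := h.good.left _ _ _ hc' hm
      exact ⟨y, hy, hl _ (by omega) _ hy⟩
    · intro y hy
      have := h.good.dist le_rfl (Nat.le_succ c) hm hy
      push_cast at this
      omega
    · intro y hy
      have := h.good.dist (Nat.le_succ k) le_rfl hm hy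
      push_cast at this
      omega
  within := h.within.upd (h.within _ _ _ hm)
  mem := by
    refine ((readRow_bump h.lt ?_ hm hw hl ?_).front.mem_iff z).1 h.mem
    · have := h.within _ _ _ hm
      omega
    · intro c' hc' x hx
      have := h.good.dist le_rfl hc'.le hm hx
      omega
  wit := by
    rintro j hj
    obtain rfl : k = j := by omega
    refine ⟨c, w, hkc, Filling.upd_self _ _ _ _, hw, fun y hy => ?_⟩
    rw [Filling.upd_of_ne _ _ (by omega)] at hy
    have := h.good.dist (Nat.le_succ k) le_rfl hm hy
    push_cast at this
    omega

theorem RowInv.diag_below (h : RowInv n z k e w) :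
    ∀ j, k = j + 1 → ∃ y, e j k = some y ∧ y.ceil < w.ceil := by
  refine h.below le_rfl (fun c' h1 h2 => by omega) fun c' hc' x hx => ?_
  have := h.good.le _ _ _ hx
  omega

theorem RowInv.diag (h : RowInv n z k e w) {m : Letter} (hm : e k k = some m)
    (hw : w.ceil < m.ceil) :
    ColInv n z (k + 1) (e.upd k k (some w.unprime)) ⟨m.ceil, w.primed⟩ where
  good := by
    refine h.good.upd le_rfl (by omega) h.diag_below ?_ ?_ (fun _ => rfl)
    · intro y hy
      have := h.good.dist le_rfl (Nat.le_succ k) hm hy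
      push_cast at this
      exact hw.trans (by omega)
    · intro y hy
      have := h.good.le _ _ _ hy
      omega
  within := h.within.upd (h.within _ _ _ hm)
  mem := by
    refine ((readRow_diag h.good h.within hm hw fun j x hj hx => ?_).mem_iff z).1 h.mem
    obtain ⟨y, hy, hyw⟩ := h.diag_below j hj
    rw [hx, Option.some.injEq] at hy
    rw [hy]
    exact hyw
  wit := by
    refine ⟨k, k, w.unprime, rfl, le_rfl, Filling.upd_self _ _ _ _, hw, fun y hy => ?_⟩
    rw [Filling.upd_of_ne _ _ (by omega)] at hy
    have := h.good.dist le_rfl (Nat.le_succ k) hm hy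
    push_cast at this
    dsimp only
    omega
  unprimed := by
    intro j y hj hy hym
    obtain rfl : k = j := by omega
    rw [Filling.upd_of_ne _ _ (by omega)] at hy
    have := h.good.dist le_rfl (Nat.le_succ k) hm hy
    push_cast at this
    dsimp only at hym
    omega

theorem RowInv.eq {i : ℤ} {p q : Bool} (h : RowInv n z k e ⟨i, p⟩) {c : ℕ} (hkc : k < c)
    (hx : e k c = some ⟨i, q⟩) (hy : e k (c + 1) = some ⟨i + 1, false⟩)
    (hl : ∀ c' < c, ∀ x, e k c' = some x → x.ceil < i) :
    RowInv n z (k + 1) ((e.upd k c (some ⟨i, false⟩)).upd k (c + 1) (some ⟨i + 1, q⟩))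
      ⟨i + 1, p⟩ where
  good := h.good.swap_row hx hy hkc
  within := (h.within.upd (h.within _ _ _ hx)).upd (h.within _ _ _ hy)
  mem := by
    refine ((readRow_eq p h.lt ?_ hx hy hl ?_).front.mem_iff z).1 h.mem
    · have := h.within _ _ _ hy
      omega
    · intro c' hc' x hx
      have := h.good.dist le_rfl hc'.le hy hx
      push_cast at this
      omega
  wit := by
    rintro j hj
    obtain rfl : k = j := by omega
    refine ⟨c, ⟨i, false⟩, hkc, ?_, ?_, fun y hy => ?_⟩
    · rw [Filling.upd_of_ne _ _ (by omega), Filling.upd_self]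
    · dsimp only
      omega
    · rw [Filling.upd_of_ne _ _ (by omega), Filling.upd_of_ne _ _ (by omega)] at hy
      have := h.good.dist (Nat.le_succ k) le_rfl hx hy
      push_cast at this
      dsimp only at this ⊢
      omega

theorem RowInv.eq_diag {i : ℤ} {p q : Bool} (h : RowInv n z k e ⟨i, p⟩)
    (hx : e k k = some ⟨i, q⟩) (hy : e k (k + 1) = some ⟨i + 1, false⟩) :
    ColInv n z (k + 1) ((e.upd k k (some ⟨i, false⟩)).upd k (k + 1) (some ⟨i + 1, q⟩))
      ⟨i + 1, p⟩ := by
  obtain rfl : q = false := h.good.diag _ _ hx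
  rw [e.upd_eq_self hx, e.upd_eq_self hy]
  have h1 := readRow_eq_diag h.good h.within hx hy (fun j x hj hx => by
    obtain ⟨y, hy, hyw⟩ := h.diag_below j hj
    rw [hx, Option.some.injEq] at hy
    rw [hy]
    exact hyw) h.mem
  obtain rfl := h1.1
  refine ⟨h.good, h.within, h1.2, ⟨k, k, _, rfl, le_rfl, hx, ?_, fun y hy' => ?_⟩, ?_⟩
  · dsimp only
    omega
  · rw [hy, Option.some.injEq] at hy'
    rw [← hy']
  · intro j y hj hy' hy''
    obtain rfl : k = j := by omega
    rw [hy, Option.some.injEq] at hy'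
    rw [← hy']

theorem ColInv.bump (h : ColInv n z k e w) {r : ℕ} {m : Letter} (hrk : r < k)
    (hm : e r k = some m) (hw : w.ceil < m.ceil)
    (hl : ∀ r' < r, ∀ x, e r' k = some x → x.ceil < w.ceil) :
    ColInv n z (k + 1) (e.upd r k (some w)) m where
  good := by
    obtain ⟨j, hj, hrj, y, hy, hyw⟩ := h.left (h.good.ne_none_col hm) hl
    refine h.good.upd hrk.le ?_ ?_ ?_ ?_ (by omega)
    · intro c' hc' hr
      obtain rfl : c' = j := by omega
      exact ⟨y, hy, hyw⟩
    · rintro r' rfl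
      obtain ⟨y, hy, -⟩ := h.good.down _ _ _ hm
      exact ⟨y, hy, hl _ (by omega) _ hy⟩
    · intro y hy
      have := h.good.dist le_rfl (Nat.le_succ k) hm hy
      push_cast at this
      omega
    · intro y hy
      have := h.good.dist (Nat.le_succ r) le_rfl hm hy
      push_cast at this
      omega
  within := h.within.upd (h.within _ _ _ hm)
  mem := by
    have := h.lt
    refine ((readCol_bump (by omega) (by omega) hm hw hl ?_).front.mem_iff z).1 h.mem
    intro r' hr' x hx
    have := h.good.dist hr'.le le_rfl hm hx
    omega
  wit := by
    refine ⟨k, r, w, rfl, hrk.le, Filling.upd_self _ _ _ _, hw, fun y hy => ?_⟩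
    rw [Filling.upd_of_ne _ _ (by omega)] at hy
    have := h.good.dist le_rfl (Nat.le_succ k) hm hy
    push_cast at this
    omega
  unprimed := by
    intro j y hj hy hym
    obtain rfl : k = j := by omega
    rw [Filling.upd_of_ne _ _ (by omega)] at hy
    have := h.good.dist hrk.le (Nat.le_succ k) hm hy
    push_cast at this
    omega

theorem ColInv.eq {i : ℤ} {p q : Bool} (h : ColInv n z k e ⟨i, p⟩) {r : ℕ}
    (hx : e r k = some ⟨i, q⟩) (hy : e (r + 1) k = some ⟨i + 1, false⟩)
    (hl : ∀ r' < r, ∀ x, e r' k = some x → x.ceil < i) :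
    ColInv n z (k + 1) ((e.upd r k (some ⟨i, false⟩)).upd (r + 1) k (some ⟨i + 1, q⟩))
      ⟨i + 1, p⟩ := by
  have hrk := h.good.le _ _ _ hy
  refine ⟨h.good.swap_col hx hy fun hk => h.unprimed r _ hk.symm hx rfl,
    (h.within.upd (h.within _ _ _ hx)).upd (h.within _ _ _ hy), ?_,
    ⟨k, r, ⟨i, false⟩, rfl, by omega, ?_, ?_, fun y hy => ?_⟩, ?_⟩
  · have := h.lt
    refine ((readCol_eq p (by omega) (by omega) hx hy hl ?_).front.mem_iff z).1 h.mem
    intro r' hr' x hx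
    have := h.good.dist hr'.le le_rfl hy hx
    push_cast at this
    omega
  · rw [Filling.upd_of_ne _ _ (by omega), Filling.upd_self]
  · dsimp only
    omega
  · rw [Filling.upd_of_ne _ _ (by omega), Filling.upd_of_ne _ _ (by omega)] at hy
    have := h.good.dist le_rfl (Nat.le_succ k) hx hy
    push_cast at this
    dsimp only at this ⊢
    omega
  · intro j y hj hy' hym
    obtain rfl : k = j := by omega
    rw [Filling.upd_of_ne _ _ (by omega), Filling.upd_of_ne _ _ (by omega)] at hy'
    have := h.good.dist hrk (Nat.le_succ k) hy hy'
    push_cast at this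
    dsimp only at this hym
    omega

end

theorem exists_first_ge (g : ℕ → Option Letter) (w : Letter) :
    (∀ i x, g i = some x → x.ceil < w.ceil) ∨
      ∃ c m, g c = some m ∧ w.ceil ≤ m.ceil ∧ ∀ c' < c, ∀ x, g c' = some x → x.ceil < w.ceil := by
  classical
  by_cases h : ∃ c m, g c = some m ∧ w.ceil ≤ m.ceil
  · right
    obtain ⟨m, hm⟩ := Nat.find_spec h
    refine ⟨_, m, hm.1, hm.2, fun c' hc' x hx => ?_⟩
    by_contra hlt
    exact Nat.find_min h hc' ⟨x, hx, by omega⟩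
  · left
    push Not at h
    exact h

/-- Either all entries of the current segment are smaller than the inserted letter, or the
algorithm continues with the next segment. -/
theorem SegInv.step {n : ℕ} {z : Equiv.Perm ℤ} {b : Bool} {k : ℕ} {e : Filling} {w : Letter}
    (h : SegInv n z b k e w) :
    (∀ i x, (bif b then e i k else e k i) = some x → x.ceil < w.ceil) ∨
      ∃ b' e' w', Step b k e w b' e' w' ∧ SegInv n z b' (k + 1) e' w' := by
  obtain _ | _ := b
  · have h : RowInv n z k e w := h
    refine (exists_first_ge (e k) w).imp id ?_
    rintro ⟨c, m, hm, hwm, hl⟩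
    have hkc := h.good.le _ _ _ hm
    rcases hwm.lt_or_eq with hlt | heq
    · rcases hkc.lt_or_eq with hkc | rfl
      · exact ⟨false, _, _, Step.row_bump hkc hm hlt hl, h.bump hkc hm hlt hl⟩
      · exact ⟨true, _, _, Step.row_diag hm hlt, h.diag hm hlt⟩
    · have hc := h.within _ _ _ hm
      have hy := h.good.readRow_next h.lt (by omega) hm heq.symm h.mem
      obtain ⟨i, p⟩ := w
      obtain ⟨i', q⟩ := m
      dsimp only at heq hy
      subst heq
      refine ⟨_, _, _, Step.row_eq hm hy hl, ?_⟩
      rcases hkc.lt_or_eq with hkc | rfl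
      · rw [decide_eq_false hkc.ne']
        exact h.eq hkc hm hy hl
      · rw [decide_eq_true rfl]
        exact h.eq_diag hm hy
  · have h : ColInv n z k e w := h
    refine (exists_first_ge (fun r => e r k) w).imp id ?_
    rintro ⟨r, m, hm, hwm, hl⟩
    rcases hwm.lt_or_eq with hlt | heq
    · obtain ⟨j, hj, hrj, -⟩ := h.left (h.good.ne_none_col hm) hl
      exact ⟨true, _, _, Step.col_bump (by omega) hm hlt hl, h.bump (by omega) hm hlt hl⟩
    · have hrk := h.good.le _ _ _ hm
      have hkn := h.lt
      have hy := h.good.readCol_next (by omega : k < n + 2) (by omega) hm heq.symm h.mem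
      obtain ⟨i, p⟩ := w
      obtain ⟨i', q⟩ := m
      dsimp only at heq hy
      subst heq
      exact ⟨true, _, _, Step.col_eq hm hy hl, h.eq hm hy hl⟩

theorem Filling.upd_upd_upd_upd (e : Filling) {r c r' c' : ℕ} {x y x' y' : Option Letter}
    (hne : r' ≠ r ∨ c' ≠ c) (hx : e r c = x) (hy : e r' c' = y) :
    (((e.upd r c x').upd r' c' y').upd r c x).upd r' c' y = e := by
  funext s t
  by_cases h1 : s = r' ∧ t = c'
  · rw [h1.1, h1.2, Filling.upd_self, hy]
  · rw [Filling.upd_of_ne _ _ (by tauto)]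
    by_cases h2 : s = r ∧ t = c
    · rw [h2.1, h2.2, Filling.upd_self, hx]
    · rw [Filling.upd_of_ne _ _ (by tauto), Filling.upd_of_ne _ _ (by tauto),
        Filling.upd_of_ne _ _ (by tauto)]

theorem exists_last_lt {g : ℕ → Option Letter} {n : ℕ} (hn : ∀ i x, g i = some x → i < n)
    {w x₀ : Letter} {c₀ : ℕ} (h₀ : g c₀ = some x₀) (h₁ : x₀.ceil < w.ceil) :
    ∃ c x, c₀ ≤ c ∧ g c = some x ∧ x.ceil < w.ceil ∧
      ∀ c', c < c' → ∀ y, g c' = some y → w.ceil ≤ y.ceil := by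
  classical
  obtain ⟨c, hc⟩ : ∃ c, c = Nat.findGreatest (fun c => ∃ x, g c = some x ∧ x.ceil < w.ceil) n :=
    ⟨_, rfl⟩
  have h := Nat.findGreatest_spec (P := fun c => ∃ x, g c = some x ∧ x.ceil < w.ceil)
    (hn _ _ h₀).le ⟨x₀, h₀, h₁⟩
  rw [← hc] at h
  obtain ⟨x, hx, hxw⟩ := h
  refine ⟨c, x, ?_, hx, hxw, fun c' hc' y hy => ?_⟩
  · rw [hc]
    exact Nat.le_findGreatest (hn _ _ h₀).le ⟨x₀, h₀, h₁⟩
  · by_contra hyw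
    have := Nat.le_findGreatest (P := fun c => ∃ x, g c = some x ∧ x.ceil < w.ceil)
      (hn _ _ hy).le ⟨y, hy, by omega⟩
    omega

section

variable {n : ℕ} {z : Equiv.Perm ℤ} {k : ℕ} {e : Filling} {w : Letter}

theorem RowInv.exists_prev (h : RowInv n z (k + 1) e w) :
    ∃ e₀ w₀, Step false k e₀ w₀ false e w ∧ RowInv n z k e₀ w₀ := by
  obtain ⟨c₀, x₀, hc₀, hx₀, hxw₀, hy₀⟩ := h.wit k rfl
  obtain ⟨c, x, hcc, hx, hxw, hr⟩ := exists_last_lt (fun i x hx => h.within k i x hx) hx₀ hxw₀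
  have hkn := h.lt
  have hcn := h.within _ _ _ hx
  by_cases hy : ∃ y, e k (c + 1) = some y ∧ y.ceil = w.ceil
  · obtain ⟨y, hy, hyw⟩ := hy
    have hxi := h.good.readRow_prev (by omega) hx hy hyw h.mem
    obtain ⟨i, p, rfl⟩ : ∃ i p, w = ⟨i + 1, p⟩ := ⟨w.ceil - 1, w.primed, by simp⟩
    obtain ⟨j, q⟩ := y
    dsimp only at hyw hxi
    subst hyw hxi
    rw [add_sub_cancel_right] at hx hxw
    obtain ⟨e₀, he₀⟩ : ∃ e₀, e₀ = (e.upd k c (some ⟨i, q⟩)).upd k (c + 1)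
      (some ⟨i + 1, false⟩) := ⟨_, rfl⟩
    have hg : Good e₀ := he₀ ▸ h.good.swap_row hx hy (by omega)
    have hx' : e₀ k c = some ⟨i, q⟩ := by
      rw [he₀, Filling.upd_of_ne _ _ (by omega), Filling.upd_self]
    have hy' : e₀ k (c + 1) = some ⟨i + 1, false⟩ := by
      rw [he₀, Filling.upd_self]
    have he : (e₀.upd k c (some ⟨i, false⟩)).upd k (c + 1) (some ⟨i + 1, q⟩) = e := by
      rw [he₀]
      exact Filling.upd_upd_upd_upd e (by omega) hx hy
    have hl : ∀ c' < c, ∀ x, e₀ k c' = some x → x.ceil < i := fun c' hc' x hx => by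
      have := hg.dist le_rfl hc'.le hx hx'
      dsimp only at this
      omega
    refine ⟨e₀, ⟨i, p⟩, ?_, hg, ?_, ?_, fun j hj => ?_⟩
    · have := Step.row_eq (p := p) hx' hy' hl
      rwa [he, decide_eq_false (by omega : ¬ c = k)] at this
    · rw [he₀]
      exact (h.within.upd (by omega)).upd (h.within _ _ _ hy)
    · have := readRow_eq (n := n + 2) p (by omega) (by omega) hx' hy' hl fun c' hc' x hx => by
        have := hg.dist le_rfl hc'.le hy' hx
        push_cast at this
        omega
      rw [he] at this
      exact (this.front.mem_iff z).2 h.mem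
    · subst hj
      obtain ⟨y, hy, hyi⟩ := hg.down _ _ _ hx'
      refine ⟨c, y, by omega, hy, hyi, fun u hu => ?_⟩
      rw [hx', Option.some.injEq] at hu
      rw [← hu]
  · push Not at hy
    have hr' : ∀ y, e k (c + 1) = some y → w.ceil < y.ceil := fun y hy' =>
      lt_of_le_of_ne (hr _ (Nat.lt_succ_self c) y hy') (hy y hy').symm
    have hu : ∀ y, e (k + 1) c = some y → w.ceil < y.ceil := by
      intro y hy'
      obtain ⟨u, hu, huy⟩ := h.good.row hc₀ hcc hy'
      have h1 := hy₀ u hu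
      rcases hcc.lt_or_eq with hlt | rfl
      · omega
      · refine lt_of_le_of_ne (hy₀ y hy') fun heq => ?_
        have h2 := h.good.readRow_next hkn (by omega) hy' heq.symm h.mem
        obtain ⟨v, hv, hvw⟩ := h.good.down _ _ _ h2
        have := hr' v hv
        dsimp only at hvw
        omega
    obtain ⟨e₀, he₀⟩ : ∃ e₀, e₀ = e.upd k c (some w) := ⟨_, rfl⟩
    have hg : Good e₀ := by
      rw [he₀]
      refine h.good.upd (by omega) ?_ ?_ hr' hu (by omega)
      · rintro c' rfl hc'
        obtain ⟨y, hy, hyx⟩ := h.good.left _ _ _ hc' hx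
        exact ⟨y, hy, by omega⟩
      · rintro r' rfl
        obtain ⟨y, hy, hyx⟩ := h.good.down _ _ _ hx
        exact ⟨y, hy, by omega⟩
    have hx' : e₀ k c = some w := by rw [he₀, Filling.upd_self]
    have he : e₀.upd k c (some x) = e := by
      rw [he₀, Filling.upd_upd, e.upd_eq_self hx]
    have hl : ∀ c' < c, ∀ y, e₀ k c' = some y → y.ceil < x.ceil := fun c' hc' y hy => by
      rw [he₀, Filling.upd_of_ne _ _ (by omega)] at hy
      have := h.good.dist le_rfl hc'.le hy hx
      omega
    refine ⟨e₀, x, ?_, hg, he₀ ▸ h.within.upd hcn, ?_, fun j hj => ?_⟩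
    · have := Step.row_bump (by omega) hx' hxw hl
      rwa [he] at this
    · have := readRow_bump (n := n + 2) (by omega) (by omega) hx' hxw hl fun c' hc' y hy => by
        have := hg.dist le_rfl hc'.le hx' hy
        omega
      rw [he] at this
      exact (this.front.mem_iff z).2 h.mem
    · subst hj
      obtain ⟨y, hy, hyx⟩ := h.good.down _ _ _ hx
      refine ⟨c, y, by omega, ?_, hyx, fun u hu => ?_⟩
      · rw [he₀, Filling.upd_of_ne _ _ (by omega), hy]
      · rw [hx', Option.some.injEq] at hu
        rw [← hu]
        exact hxw.le

theorem ColInv.exists_prev_eq (h : ColInv n z (k + 1) e w) {r : ℕ} {x y : Letter} (hrk : r < k)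
    (hx : e r k = some x) (hy : e (r + 1) k = some y) (hyw : y.ceil = w.ceil) :
    ∃ e₀ w₀, Step true k e₀ w₀ true e w ∧ ColInv n z k e₀ w₀ := by
  have hkn := h.lt
  have hxi := h.good.readCol_prev (by omega) hx hy hyw h.mem
  obtain ⟨i, p, rfl⟩ : ∃ i p, w = ⟨i + 1, p⟩ := ⟨w.ceil - 1, w.primed, by simp⟩
  obtain ⟨j, q⟩ := y
  dsimp only at hyw hxi
  subst hyw hxi
  rw [add_sub_cancel_right] at hx
  obtain ⟨e₀, he₀⟩ : ∃ e₀, e₀ = (e.upd r k (some ⟨i, q⟩)).upd (r + 1) k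
    (some ⟨i + 1, false⟩) := ⟨_, rfl⟩
  have hg : Good e₀ := he₀ ▸ h.good.swap_col hx hy fun _ => rfl
  have hx' : e₀ r k = some ⟨i, q⟩ := by
    rw [he₀, Filling.upd_of_ne _ _ (by omega), Filling.upd_self]
  have hy' : e₀ (r + 1) k = some ⟨i + 1, false⟩ := by
    rw [he₀, Filling.upd_self]
  have he : (e₀.upd r k (some ⟨i, false⟩)).upd (r + 1) k (some ⟨i + 1, q⟩) = e := by
    rw [he₀]
    exact Filling.upd_upd_upd_upd e (by omega) hx hy
  have hl : ∀ r' < r, ∀ x, e₀ r' k = some x → x.ceil < i := fun r' hr' x hx => by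
    have := hg.dist hr'.le le_rfl hx hx'
    dsimp only at this
    omega
  refine ⟨e₀, ⟨i, p⟩, ?_, hg, ?_, ?_, ?_, ?_⟩
  · have := Step.col_eq (p := p) hx' hy' hl
    rwa [he] at this
  · rw [he₀]
    exact (h.within.upd (by omega)).upd (h.within _ _ _ hy)
  · have := readCol_eq (n := n + 2) p (by omega) (by omega) hx' hy' hl fun c' hc' x hx => by
      have := hg.dist hc'.le le_rfl hy' hx
      push_cast at this
      omega
    rw [he] at this
    exact (this.front.mem_iff z).2 h.mem
  · obtain ⟨j, rfl⟩ := Nat.exists_eq_succ_of_ne_zero (by omega : k ≠ 0)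
    obtain ⟨y, hy, hyi⟩ := hg.left _ _ _ (by omega) hx'
    refine ⟨j, r, y, rfl, by omega, hy, hyi, fun u hu => ?_⟩
    rw [hx', Option.some.injEq] at hu
    rw [← hu]
  · intro j u hj hu hui
    have h1 := hg.dist (by omega : r ≤ j) le_rfl hx' hu
    dsimp only at h1 hui
    obtain rfl : j = r := by omega
    rw [hx', Option.some.injEq] at hu
    subst hu hj
    exact h.good.diag _ ⟨i + 1, q⟩ hy

theorem ColInv.exists_prev_bump (h : ColInv n z (k + 1) e w) {r : ℕ} {x : Letter} (hrk : r < k)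
    (hx : e r k = some x) (hxw : x.ceil < w.ceil)
    (hr : ∀ y, e r (k + 1) = some y → w.ceil < y.ceil)
    (hu : ∀ y, e (r + 1) k = some y → w.ceil < y.ceil) :
    ∃ e₀ w₀, Step true k e₀ w₀ true e w ∧ ColInv n z k e₀ w₀ := by
  have hkn := h.lt
  obtain ⟨e₀, he₀⟩ : ∃ e₀, e₀ = e.upd r k (some w) := ⟨_, rfl⟩
  have hg : Good e₀ := by
    rw [he₀]
    refine h.good.upd (by omega) ?_ ?_ hr hu (by omega)
    · rintro c' rfl hc'
      obtain ⟨y, hy, hyx⟩ := h.good.left _ _ _ hc' hx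
      exact ⟨y, hy, by omega⟩
    · rintro r' rfl
      obtain ⟨y, hy, hyx⟩ := h.good.down _ _ _ hx
      exact ⟨y, hy, by omega⟩
  have hx' : e₀ r k = some w := by rw [he₀, Filling.upd_self]
  have he : e₀.upd r k (some x) = e := by
    rw [he₀, Filling.upd_upd, e.upd_eq_self hx]
  have hl : ∀ r' < r, ∀ y, e₀ r' k = some y → y.ceil < x.ceil := fun r' hr' y hy => by
    rw [he₀, Filling.upd_of_ne _ _ (by omega)] at hy
    have := h.good.dist hr'.le le_rfl hy hx
    omega
  refine ⟨e₀, x, ?_, hg, he₀ ▸ h.within.upd (h.within _ _ _ hx), ?_, ?_, ?_⟩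
  · have := Step.col_bump (by omega) hx' hxw hl
    rwa [he] at this
  · have := readCol_bump (n := n + 2) (by omega) (by omega) hx' hxw hl fun c' hc' y hy => by
      have := hg.dist hc'.le le_rfl hx' hy
      omega
    rw [he] at this
    exact (this.front.mem_iff z).2 h.mem
  · obtain ⟨j, rfl⟩ := Nat.exists_eq_succ_of_ne_zero (by omega : k ≠ 0)
    obtain ⟨y, hy, hyx⟩ := h.good.left _ _ _ (by omega) hx
    refine ⟨j, r, y, rfl, by omega, ?_, hyx, fun u hu => ?_⟩
    · rw [he₀, Filling.upd_of_ne _ _ (by omega), hy]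
    · rw [hx', Option.some.injEq] at hu
      rw [← hu]
      exact hxw.le
  · intro j u hj hu hui
    have h1 := hg.dist (by omega : r ≤ j) le_rfl hx' hu
    omega

theorem ColInv.exists_prev_diag (h : ColInv n z (k + 1) e w) {x : Letter}
    (hx : e k k = some x) (hxw : x.ceil < w.ceil)
    (hr : ∀ y, e k (k + 1) = some y → w.ceil ≤ y.ceil) :
    ∃ e₀ w₀, Step false k e₀ w₀ true e w ∧ RowInv n z k e₀ w₀ := by
  have hkn := h.lt
  have hxp := h.good.diag _ _ hx
  obtain ⟨i, p⟩ := x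
  dsimp only at hxp hxw
  subst hxp
  have hd : ∀ e₀ : Filling, (∀ r, r ≠ k → e₀ r k = e r k) → (∀ y, e₀ k k = some y → i ≤ y.ceil) →
      ∀ j, k = j + 1 → ∃ c x, k ≤ c ∧ e₀ j c = some x ∧ x.ceil < i ∧
        ∀ y, e₀ k c = some y → i ≤ y.ceil := by
    rintro e₀ h1 h2 j rfl
    obtain ⟨y, hy, hyi⟩ := h.good.down _ _ _ hx
    exact ⟨j + 1, y, le_rfl, (h1 j (by omega)).trans hy, hyi, h2⟩
  by_cases hy : ∃ y, e k (k + 1) = some y ∧ y.ceil = w.ceil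
  · obtain ⟨y, hy, hyw⟩ := hy
    have hyp := h.unprimed k y rfl hy hyw
    obtain ⟨j, p⟩ := w
    obtain ⟨j', q⟩ := y
    dsimp only at hyw hyp
    subst hyw hyp
    obtain ⟨hj, rfl, hm⟩ := readCol_eq_diag h.good h.within hx hy h.mem
    subst hj
    refine ⟨e, ⟨i, false⟩, ?_, h.good, h.within, hm, hd e (fun _ _ => rfl) fun u hu => ?_⟩
    · have := Step.row_eq (p := false) hx hy fun c' hc' x hx => by
        have := h.good.le _ _ _ hx
        omega
      rwa [e.upd_eq_self hx, e.upd_eq_self hy, decide_eq_true rfl] at this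
    · rw [hx, Option.some.injEq] at hu
      rw [← hu]
  · push Not at hy
    have hg : Good (e.upd k k (some ⟨w.ceil, false⟩)) := by
      refine h.good.upd le_rfl (by omega) ?_ ?_ ?_ (fun _ => rfl)
      · rintro r' rfl
        obtain ⟨y, hy, hyx⟩ := h.good.down _ _ _ hx
        exact ⟨y, hy, hyx.trans hxw⟩
      · exact fun y hy' => lt_of_le_of_ne (hr y hy') (hy y hy').symm
      · intro y hy
        have := h.good.le _ _ _ hy
        omega
    obtain ⟨e₀, he₀⟩ : ∃ e₀, e₀ = e.upd k k (some ⟨w.ceil, false⟩) := ⟨_, rfl⟩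
    rw [← he₀] at hg
    have hx' : e₀ k k = some ⟨w.ceil, false⟩ := by rw [he₀, Filling.upd_self]
    have he : e₀.upd k k (some (Letter.unprime ⟨i, w.primed⟩)) = e := by
      rw [he₀, Filling.upd_upd]
      exact e.upd_eq_self hx
    have hw : e₀.Within n := he₀ ▸ h.within.upd (h.within _ _ _ hx)
    have hd' := hd e₀ (fun r hr => by rw [he₀, Filling.upd_of_ne _ _ (by omega)])
      (fun y hy => by
        rw [hx', Option.some.injEq] at hy
        rw [← hy]
        exact hxw.le)
    refine ⟨e₀, ⟨i, w.primed⟩, ?_, hg, hw, ?_, hd'⟩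
    · have := Step.row_diag (w := ⟨i, w.primed⟩) hx' hxw
      rwa [he] at this
    · have := readRow_diag (w := ⟨i, w.primed⟩) hg hw hx' hxw fun j x hj hxj => by
        subst hj
        rw [he₀, Filling.upd_of_ne _ _ (by omega)] at hxj
        have := h.good.dist (Nat.le_succ j) le_rfl hxj hx
        push_cast at this
        dsimp only at this ⊢
        omega
      rw [he] at this
      exact (this.mem_iff z).2 h.mem

end

/-- Every state of the algorithm after the first segment arises from a previous state. -/
theorem SegInv.exists_prev {n : ℕ} {z : Equiv.Perm ℤ} {b : Bool} {k : ℕ} {e : Filling}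
    {w : Letter} (h : SegInv n z b (k + 1) e w) :
    ∃ b₀ e₀ w₀, Step b₀ k e₀ w₀ b e w ∧ SegInv n z b₀ k e₀ w₀ := by
  obtain _ | _ := b
  · exact ⟨false, RowInv.exists_prev h⟩
  have h : ColInv n z (k + 1) e w := h
  obtain ⟨j, r₀, x₀, hj, hr₀, hx₀, hxw₀, hy₀⟩ := h.wit
  obtain rfl : k = j := by omega
  have hkn := h.lt
  obtain ⟨r, x, hrr, hx, hxw, hr⟩ := exists_last_lt (g := fun r => e r k) (n := k + 1)
    (fun i x hx => Nat.lt_succ_of_le (h.good.le i k x hx)) hx₀ hxw₀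
  have hy : ∀ y, e r (k + 1) = some y → w.ceil + (r - r₀ : ℤ) ≤ y.ceil := fun y hy => by
    obtain ⟨u, hu, huy⟩ := h.good.col hrr hy
    have := hy₀ u hu
    omega
  rcases (h.good.le _ _ _ hx).lt_or_eq with hrk | rfl
  · refine ⟨true, ?_⟩
    by_cases hu : ∃ y, e (r + 1) k = some y ∧ y.ceil = w.ceil
    · obtain ⟨y, hy, hyw⟩ := hu
      exact h.exists_prev_eq hrk hx hy hyw
    · push Not at hu
      have hu' : ∀ y, e (r + 1) k = some y → w.ceil < y.ceil := fun y hy =>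
        lt_of_le_of_ne (hr _ (Nat.lt_succ_self r) y hy) (hu y hy).symm
      refine h.exists_prev_bump hrk hx hxw (fun y hy' => ?_) hu'
      refine lt_of_le_of_ne (by have := hy y hy'; omega) fun heq => ?_
      have h1 := h.good.readCol_next (by omega) (by omega) hy' heq.symm h.mem
      obtain ⟨v, hv, hvw⟩ := h.good.left _ _ _ (by omega) h1
      have := hu' v hv
      dsimp only at hvw
      omega
  · refine ⟨false, h.exists_prev_diag hx hxw fun y hy' => ?_⟩
    have := hy y hy'
    omega

/-- The end of the insertion algorithm: the letter `w` is placed in the empty box `(r, c)` of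
row or column `k`. -/
inductive Term : Bool → ℕ → Filling → Letter → ℕ → ℕ → Filling → Bool → Prop
  | row {k c : ℕ} {e : Filling} {w : Letter} (hkc : k ≤ c) (hn : e k c = none)
      (hne : ∀ c', k ≤ c' → c' < c → e k c' ≠ none)
      (hl : ∀ c' x, e k c' = some x → x.ceil < w.ceil) :
      Term false k e w k c (e.upd k c (some (if k = c then w.unprime else w)))
        (decide (k = c) && w.primed)
  | col {k r : ℕ} {e : Filling} {w : Letter} (hrk : r < k) (hn : e r k = none)
      (hne : ∀ r' < r, e r' k ≠ none) (hl : ∀ r' x, e r' k = some x → x.ceil < w.ceil) :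
      Term true k e w r k (e.upd r k (some w)) true

/-- The states reached when inserting `w₀` into `e₀`. -/
inductive InsPath (e₀ : Filling) (w₀ : Letter) : Bool → ℕ → Filling → Letter → Prop
  | start (h : Good e₀) : InsPath e₀ w₀ false 0 e₀ w₀
  | step {b b' : Bool} {k : ℕ} {e e' : Filling} {w w' : Letter} (h : InsPath e₀ w₀ b k e w)
      (hs : Step b k e w b' e' w') (hg : Good e') : InsPath e₀ w₀ b' (k + 1) e' w'

theorem InsPath.good {e₀ e : Filling} {w₀ w : Letter} {b : Bool} {k : ℕ}
    (h : InsPath e₀ w₀ b k e w) : Good e := by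
  cases h <;> assumption

theorem SegInv.good {n : ℕ} {z : Equiv.Perm ℤ} {b : Bool} {k : ℕ} {e : Filling} {w : Letter}
    (h : SegInv n z b k e w) : Good e := by
  cases b
  · exact RowInv.good h
  · exact ColInv.good h

theorem SegInv.lt {n : ℕ} {z : Equiv.Perm ℤ} {b : Bool} {k : ℕ} {e : Filling} {w : Letter}
    (h : SegInv n z b k e w) : k < n + 2 := by
  cases b
  · exact RowInv.lt h
  · exact (ColInv.lt h).trans (Nat.lt_succ_self _)

/-- The insertion of `w₀` into `e₀` gives `e'` with the new box `(r, c)`, and `f` records whether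
it ends in column insertion. -/
def Inserts (e₀ : Filling) (w₀ : Letter) (r c : ℕ) (e' : Filling) (f : Bool) : Prop :=
  ∃ b k e w, InsPath e₀ w₀ b k e w ∧ Term b k e w r c e' f

theorem SegInv.exists_path_aux {n : ℕ} {z : Equiv.Perm ℤ} {e₀ : Filling} {w₀ : Letter} (d : ℕ) :
    ∀ {b : Bool} {k : ℕ} {e : Filling} {w : Letter}, n + 2 ≤ k + d → SegInv n z b k e w →
      InsPath e₀ w₀ b k e w → ∃ b' k' e' w', InsPath e₀ w₀ b' k' e' w' ∧ SegInv n z b' k' e' w' ∧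
        ∀ i x, (bif b' then e' i k' else e' k' i) = some x → x.ceil < w'.ceil := by
  induction d with
  | zero =>
    intro b k e w hd h hp
    have := h.lt
    omega
  | succ d ih =>
    intro b k e w hd h hp
    rcases h.step with h1 | ⟨b', e', w', hs, h'⟩
    · exact ⟨b, k, e, w, hp, h, h1⟩
    · exact ih (by omega) h' (hp.step hs h'.good)

theorem SegInv.exists_path_to {n : ℕ} {z : Equiv.Perm ℤ} {k : ℕ} :
    ∀ {b : Bool} {e : Filling} {w : Letter}, SegInv n z b k e w →
      ∃ e₀ w₀, InsPath e₀ w₀ b k e w ∧ RowInv n z 0 e₀ w₀ := by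
  induction k with
  | zero =>
    intro b e w h
    obtain _ | _ := b
    · exact ⟨e, w, InsPath.start h.good, h⟩
    · obtain ⟨j, _, _, hj, -⟩ := ColInv.wit h
      omega
  | succ k ih =>
    intro b e w h
    obtain ⟨b', e', w', hs, h'⟩ := h.exists_prev
    obtain ⟨e₀, w₀, hp, h₀⟩ := ih h'
    exact ⟨e₀, w₀, hp.step hs h.good, h₀⟩

theorem Good.readRow_eq_of_none {e : Filling} (h : Good e) {n k c : ℕ} (hkc : k ≤ c) (hcn : c < n)
    (hn : e k c = none) (x : Letter) :
    downW (rowW n (e.upd k c (some x))) n = readRow n e k x := by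
  have h1 := downW_add (rowW n (e.upd k c (some x))) k (n - k)
  rw [show k + (n - k) = n by omega] at h1
  have h3 : ∀ i, c ≤ i → e k i = none := fun i hi => by
    by_contra hne
    obtain ⟨y, hy⟩ := Option.ne_none_iff_exists'.1 hne
    obtain ⟨u, hu, -⟩ := h.row hkc hi hy
    simp [hu] at hn
  have h2 : rowW n (e.upd k c (some x)) k = rowW n e k ++ [x] := by
    rw [rowW, seqW_split hcn (Filling.upd_self _ _ _ _), rowW, seqW_split_none hcn.le h3,
      tailW_eq_nil fun i hi => by rw [Filling.upd_of_ne _ _ (by omega), h3 i (by omega)],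
      seqW_congr (g := e k) fun i hi => Filling.upd_of_ne _ _ (by omega)]
  rw [h1, downTailW_split _ (by omega), h2, readRow, downTailW_split _ (by omega : k < n),
    downTailW_congr (t := rowW n e) fun i hi => rowW_upd_of_ne n e _ (by omega),
    downW_congr (t := rowW n e) fun i hi => rowW_upd_of_ne n e _ (by omega)]
  simp

theorem Good.readCol_eq_of_none {e : Filling} (h : Good e) {n k r : ℕ} (hkn : k < n) (hrk : r ≤ k)
    (hn : e r k = none) (x : Letter) :
    upW (colW n (e.upd r k (some x))) n = readCol n e k x := by
  have h1 := upW_add (colW n (e.upd r k (some x))) k (n - k)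
  rw [show k + (n - k) = n by omega] at h1
  have h3 : ∀ i, r ≤ i → e i k = none := fun i hi => by
    by_contra hne
    obtain ⟨y, hy⟩ := Option.ne_none_iff_exists'.1 hne
    obtain ⟨u, hu, -⟩ := h.col hi hy
    simp [hu] at hn
  have h2 : colW n (e.upd r k (some x)) k = x :: colW n e k := by
    rw [colW, seqW_split (f := fun i => e.upd r k (some x) i k) (by omega)
      (Filling.upd_self _ _ _ _), colW, seqW_split_none (by omega : r ≤ n) h3,
      tailW_eq_nil fun i hi => by rw [Filling.upd_of_ne _ _ (by omega), h3 i (by omega)],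
      seqW_congr (g := fun i => e i k) fun i hi => Filling.upd_of_ne _ _ (by omega)]
    simp
  rw [h1, upTailW_split _ (by omega), h2, readCol, upTailW_split _ (by omega : k < n),
    upTailW_congr (t := colW n e) fun i hi => colW_upd_of_ne n e _ (by omega),
    upW_congr (t := colW n e) fun i hi => colW_upd_of_ne n e _ (by omega)]
  simp

theorem Good.eqv_rows_cols {e : Filling} (h : Good e) (n : ℕ) :
    Eqv (downW (rowW n e) n) (upW (colW n e) n) :=
  _root_.eqv_rows_cols fun _ _ _ _ _ _ hx hy hr hc => h.far hr hc hx hy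

theorem Good.readRow_eq_cons {e : Filling} (h : Good e) {n k : ℕ} (hn : e k k = none)
    (x : Letter) : readRow n e k x = x :: downW (rowW n e) k := by
  rw [readRow, downTailW_eq_nil, List.nil_append]
  intro i hi
  refine seqW_eq_nil fun c _ => ?_
  by_contra hne
  obtain ⟨y, hy⟩ := Option.ne_none_iff_exists'.1 hne
  obtain ⟨u, hu⟩ := h.box hi (hi.trans (h.le _ _ _ hy)) le_rfl hy
  simp [hu] at hn

theorem Good.readRow_mem_iff {e : Filling} (h : Good e) {n k c : ℕ} {z : Equiv.Perm ℤ} {w : Letter}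
    (hkc : k ≤ c) (hcn : c < n) (hn : e k c = none) :
    downW (rowW n (e.upd k c (some (if k = c then w.unprime else w)))) n ∈ RinvPlus z ↔
      readRow n e k w ∈ RinvPlus z := by
  rw [h.readRow_eq_of_none hkc hcn hn]
  split_ifs with hc
  · subst hc
    rw [h.readRow_eq_cons hn, h.readRow_eq_cons hn]
    exact ((EqvFront.toggle w.ceil false w.primed).append (Eqv.refl _)).mem_iff z
  · rfl

theorem Good.readCol_mem_iff {e : Filling} (h : Good e) {n k r : ℕ} {z : Equiv.Perm ℤ} {w : Letter}
    (hg : Good (e.upd r k (some w))) (hkn : k < n) (hrk : r ≤ k) (hn : e r k = none) :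
    downW (rowW n (e.upd r k (some w))) n ∈ RinvPlus z ↔ readCol n e k w ∈ RinvPlus z := by
  rw [← h.readCol_eq_of_none hkn hrk hn]
  exact (hg.eqv_rows_cols n).front.mem_iff z

theorem exists_first_none {g : ℕ → Option Letter} {k n : ℕ} (h : k ≤ n) (hn : g n = none) :
    ∃ c, k ≤ c ∧ c ≤ n ∧ g c = none ∧ ∀ c', k ≤ c' → c' < c → g c' ≠ none := by
  classical
  have h1 : ∃ c, k ≤ c ∧ g c = none := ⟨n, h, hn⟩
  obtain ⟨h2, h3⟩ := Nat.find_spec h1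
  exact ⟨_, h2, Nat.find_min' h1 ⟨h, hn⟩, h3, fun c' hc hc' h' => Nat.find_min h1 hc' ⟨hc, h'⟩⟩

theorem Good.none_right {e : Filling} (h : Good e) {r c c' : ℕ} (hrc : r ≤ c) (hc : c ≤ c')
    (hn : e r c = none) : e r c' = none := by
  by_contra hne
  obtain ⟨y, hy⟩ := Option.ne_none_iff_exists'.1 hne
  obtain ⟨u, hu⟩ := h.box le_rfl hc hrc hy
  simp [hu] at hn

theorem Good.none_up {e : Filling} (h : Good e) {r r' c : ℕ} (hr : r ≤ r')
    (hn : e r c = none) : e r' c = none := by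
  by_contra hne
  obtain ⟨y, hy⟩ := Option.ne_none_iff_exists'.1 hne
  obtain ⟨u, hu, -⟩ := h.col hr hy
  simp [hu] at hn

/-- If all entries of the current segment are smaller than the inserted letter, then the
insertion ends by adding a box to the segment. -/
theorem SegInv.exists_term {n : ℕ} {z : Equiv.Perm ℤ} {b : Bool} {k : ℕ} {e : Filling}
    {w : Letter} (h : SegInv n z b k e w)
    (hl : ∀ i x, (bif b then e i k else e k i) = some x → x.ceil < w.ceil) :
    ∃ r c e' f, Term b k e w r c e' f ∧ Good e' ∧ e'.Within (n + 1) ∧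
      downW (rowW (n + 2) e') (n + 2) ∈ RinvPlus z := by
  obtain _ | _ := b
  · have h : RowInv n z k e w := h
    have hl : ∀ i x, e k i = some x → x.ceil < w.ceil := hl
    have hmax : ∃ c, k ≤ c ∧ e k c = none ∧ c < n + 1 := by
      cases k with
      | zero =>
        refine ⟨n, Nat.zero_le _, ?_, by omega⟩
        by_contra hne
        obtain ⟨y, hy⟩ := Option.ne_none_iff_exists'.1 hne
        exact (h.within _ _ _ hy).false
      | succ j =>
        obtain ⟨c, x, hc, hx, -, hy⟩ := h.wit j rfl
        refine ⟨c, hc, ?_, (h.within _ _ _ hx).trans (Nat.lt_succ_self n)⟩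
        by_contra hne
        obtain ⟨y, hy'⟩ := Option.ne_none_iff_exists'.1 hne
        exact absurd (hl _ _ hy') (not_lt.2 (hy _ hy'))
    obtain ⟨c₀, hc₀, hn₀, hcn₀⟩ := hmax
    obtain ⟨c, hkc, hcc, hn, hne⟩ := exists_first_none hc₀ hn₀
    have hce : (if k = c then w.unprime else w).ceil = w.ceil := by split_ifs <;> rfl
    refine ⟨k, c, _, _, Term.row hkc hn hne hl, ?_, ?_,
      (h.good.readRow_mem_iff hkc (by omega) hn).2 h.mem⟩
    · refine h.good.upd hkc ?_ ?_ ?_ ?_ ?_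
      · rintro c' rfl hc'
        obtain ⟨y, hy⟩ := Option.ne_none_iff_exists'.1 (hne c' hc' (Nat.lt_succ_self _))
        exact ⟨y, hy, hce ▸ hl _ _ hy⟩
      · rw [hce]
        exact h.below hkc hne fun c' _ => hl c'
      · intro y hy
        rw [h.good.none_right hkc (Nat.le_succ c) hn] at hy
        simp at hy
      · intro y hy
        rw [h.good.none_up (Nat.le_succ k) hn] at hy
        simp at hy
      · rintro rfl
        simp [Letter.unprime]
    · refine Filling.Within.upd (fun r c x hx => (h.within r c x hx).trans (Nat.lt_succ_self n)) ?_
      omega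
  · have h : ColInv n z k e w := h
    have hl : ∀ i x, e i k = some x → x.ceil < w.ceil := hl
    have hkn := h.lt
    obtain ⟨j, r₀, x, hj, hr₀, hx, hxw, hy⟩ := h.wit
    have hn₀ : e r₀ k = none := by
      by_contra hne
      obtain ⟨y, hy'⟩ := Option.ne_none_iff_exists'.1 hne
      exact absurd (hl _ _ hy') (not_lt.2 (hy _ hy'))
    obtain ⟨r, -, hrr, hn, hne⟩ := exists_first_none (g := fun r => e r k) (Nat.zero_le r₀) hn₀
    replace hne : ∀ r' < r, e r' k ≠ none := fun r' => hne r' (Nat.zero_le r')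
    obtain ⟨j', hj', hrj', y, hy', hyw⟩ := h.left hne fun r' _ => hl r'
    have hg : Good (e.upd r k (some w)) := by
      refine h.good.upd (by omega) ?_ ?_ ?_ ?_ (by omega)
      · intro c' hc' _
        obtain rfl : c' = j' := by omega
        exact ⟨y, hy', hyw⟩
      · rintro r' rfl
        obtain ⟨y, hy⟩ := Option.ne_none_iff_exists'.1 (hne r' (Nat.lt_succ_self _))
        exact ⟨y, hy, hl _ _ hy⟩
      · intro y hy
        rw [h.good.none_right (by omega) (Nat.le_succ k) hn] at hy
        simp at hy
      · intro y hy
        rw [h.good.none_up (Nat.le_succ r) hn] at hy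
        simp at hy
    exact ⟨r, k, _, _, Term.col (by omega) hn hne hl, hg,
      Filling.Within.upd (fun r c x hx => (h.within r c x hx).trans (Nat.lt_succ_self n)) hkn,
      (h.good.readCol_mem_iff hg (by omega) (by omega) hn).2 h.mem⟩

/-- Every filling with a corner box arises as the end of an insertion. -/
theorem Good.exists_term {n : ℕ} {z : Equiv.Perm ℤ} {e : Filling} (h : Good e) (hw : e.Within n)
    (hz : downW (rowW (n + 2) e) (n + 2) ∈ RinvPlus z) {r c : ℕ} {x : Letter}
    (hx : e r c = some x) (hr : e r (c + 1) = none) (hu : e (r + 1) c = none) (f : Bool) :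
    ∃ b k e₀ w₀, Term b k e₀ w₀ r c e f ∧ SegInv n z b k e₀ w₀ := by
  have hrc := h.le _ _ _ hx
  have hcn := hw _ _ _ hx
  have hg := h.remove hr hu
  have hw' : (e.upd r c none).Within n := hw.upd hcn
  have hn : e.upd r c none r c = none := Filling.upd_self _ _ _ _
  have hne : ∀ c', r ≤ c' → c' < c → e.upd r c none r c' ≠ none := fun c' h1 h2 => by
    rw [Filling.upd_of_ne _ _ (by omega)]
    exact h.ne_none_row hx c' h1 h2
  have hl : ∀ w : Letter, w.ceil = x.ceil → ∀ c' y, e.upd r c none r c' = some y →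
      y.ceil < w.ceil := fun w hwx c' y hy => by
    have hc : c' < c := by
      by_contra hc
      rw [hg.none_right hrc (by omega) hn] at hy
      simp at hy
    rw [Filling.upd_of_ne _ _ (by omega)] at hy
    have := h.dist le_rfl hc.le hy hx
    omega
  by_cases hrow : r = c ∨ f = false
  · obtain ⟨w, hwdef⟩ : ∃ w : Letter, w = if r = c then ⟨x.ceil, f⟩ else x := ⟨_, rfl⟩
    have hwx : w.ceil = x.ceil := by
      rw [hwdef]
      split_ifs <;> rfl
    have hwx' : (if r = c then w.unprime else w) = x := by
      rw [hwdef]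
      split_ifs with hrc
      · subst hrc
        have := h.diag _ _ hx
        obtain ⟨i, p⟩ := x
        dsimp only at this
        rw [this]
        rfl
      · rfl
    have hf : (decide (r = c) && w.primed) = f := by
      rw [hwdef]
      by_cases hrc : r = c
      · simp [hrc]
      · simp [hrow.resolve_left hrc, hrc]
    have he : (e.upd r c none).upd r c (some (if r = c then w.unprime else w)) = e := by
      rw [Filling.upd_upd, hwx', e.upd_eq_self hx]
    refine ⟨false, r, e.upd r c none, w, ?_, hg, hw', ?_, ?_⟩
    · have := Term.row hrc hn hne (hl w hwx)
      rwa [he, hf] at this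
    · rw [← hg.readRow_mem_iff hrc (by omega) hn, he]
      exact hz
    · rintro j rfl
      obtain ⟨y, hy, hyx⟩ := h.down _ _ _ hx
      refine ⟨c, y, hrc, ?_, hwx ▸ hyx, fun u hu => ?_⟩
      · rw [Filling.upd_of_ne _ _ (by omega), hy]
      · rw [hn] at hu
        simp at hu
  · push Not at hrow
    obtain ⟨hne', hf⟩ := hrow
    replace hf : f = true := by simpa using hf
    subst hf
    have he : (e.upd r c none).upd r c (some x) = e := by
      rw [Filling.upd_upd, e.upd_eq_self hx]
    refine ⟨true, c, e.upd r c none, x, ?_, hg, hw', ?_, ?_, ?_⟩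
    · have := Term.col (w := x) (lt_of_le_of_ne hrc hne') hn (fun r' hr' => ?_) (fun r' y hy => ?_)
      · rwa [he] at this
      · rw [Filling.upd_of_ne _ _ (by omega)]
        exact h.ne_none_col hx r' hr'
      · have hr : r' < r := by
          by_contra hr
          rw [hg.none_up (by omega) hn] at hy
          simp at hy
        rw [Filling.upd_of_ne _ _ (by omega)] at hy
        have := h.dist hr.le le_rfl hy hx
        omega
    · rw [← hg.readCol_mem_iff (he.symm ▸ h) (by omega) hrc hn, he]
      exact hz
    · obtain ⟨j, rfl⟩ := Nat.exists_eq_succ_of_ne_zero (by omega : c ≠ 0)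
      obtain ⟨y, hy, hyx⟩ := h.left _ _ _ (by omega) hx
      refine ⟨j, r, y, rfl, by omega, ?_, hyx, fun u hu => ?_⟩
      · rw [Filling.upd_of_ne _ _ (by omega), hy]
      · rw [hn] at hu
        simp at hu
    · intro j y hj hy
      rw [hg.none_up (by omega) hn] at hy
      simp at hy

theorem RowInv.inserts {n : ℕ} {z : Equiv.Perm ℤ} {e : Filling} {w : Letter}
    (h : RowInv n z 0 e w) : ∃ r c e' f, Inserts e w r c e' f ∧ Good e' ∧ e'.Within (n + 1) ∧
      downW (rowW (n + 2) e') (n + 2) ∈ RinvPlus z := by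
  obtain ⟨b, k, e', w', hp, hi, hl⟩ := SegInv.exists_path_aux (b := false) (n + 2)
    (by omega) h (InsPath.start h.good)
  obtain ⟨r, c, e'', f, ht, h'⟩ := hi.exists_term hl
  exact ⟨r, c, e'', f, ⟨b, k, e', w', hp, ht⟩, h'⟩

theorem Good.exists_inserts {n : ℕ} {z : Equiv.Perm ℤ} {e : Filling} (h : Good e)
    (hw : e.Within n) (hz : downW (rowW (n + 2) e) (n + 2) ∈ RinvPlus z) {r c : ℕ} {x : Letter}
    (hx : e r c = some x) (hr : e r (c + 1) = none) (hu : e (r + 1) c = none) (f : Bool) :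
    ∃ e₀ w₀, Inserts e₀ w₀ r c e f ∧ RowInv n z 0 e₀ w₀ := by
  obtain ⟨b, k, e', w', ht, hi⟩ := h.exists_term hw hz hx hr hu f
  obtain ⟨e₀, w₀, hp, h₀⟩ := hi.exists_path_to
  exact ⟨e₀, w₀, ⟨b, k, e', w', hp, ht⟩, h₀⟩

/-- The entry `x` in position `c` is the last one which is smaller than `w`. -/
def IsLast (g : ℕ → Option Letter) (w : Letter) (c : ℕ) (x : Letter) : Prop :=
  g c = some x ∧ x.ceil < w.ceil ∧ ∀ c' > c, ∀ y, g c' = some y → w.ceil ≤ y.ceil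

theorem IsLast.unique {g : ℕ → Option Letter} {w x x' : Letter} {c c' : ℕ} (h : IsLast g w c x)
    (h' : IsLast g w c' x') : c = c' ∧ x = x' := by
  obtain rfl : c = c' := by
    rcases lt_trichotomy c c' with hc | hc | hc
    · exact absurd h'.2.1 (not_lt.2 (h.2.2 _ hc _ h'.1))
    · exact hc
    · exact absurd h.2.1 (not_lt.2 (h'.2.2 _ hc _ h.1))
  exact ⟨rfl, by simpa using h.1.symm.trans h'.1⟩

theorem Step.prev_row {b₀ : Bool} {k : ℕ} {e₀ e : Filling} {w₀ w : Letter}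
    (h : Step b₀ k e₀ w₀ false e w) (hg : Good e₀) :
    b₀ = false ∧ ∃ c x, IsLast (e k) w c x ∧
      (∀ y, e k (c + 1) = some y → y.ceil = w.ceil →
        e₀ = (e.upd k c (some ⟨x.ceil, y.primed⟩)).upd k (c + 1) (some ⟨w.ceil, false⟩) ∧
        w₀ = ⟨x.ceil, w.primed⟩) ∧
      ((∀ y, e k (c + 1) = some y → y.ceil ≠ w.ceil) → e₀ = e.upd k c (some w) ∧ w₀ = x) := by
  generalize hb : false = b at h
  cases h with
  | @row_bump _ c _ _ m hkc hm hw hl =>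
    have hgt : ∀ c' > c, ∀ y, e₀ k c' = some y → w.ceil < y.ceil := fun c' hc' y hy => by
      have := hg.dist le_rfl hc'.le hm hy
      omega
    refine ⟨rfl, c, w₀, ⟨Filling.upd_self _ _ _ _, hw, fun c' hc' y hy => ?_⟩,
      fun y hy hyw => ?_, fun _ => ⟨?_, rfl⟩⟩
    · rw [Filling.upd_of_ne _ _ (by omega)] at hy
      exact (hgt c' hc' y hy).le
    · rw [Filling.upd_of_ne _ _ (by omega)] at hy
      exact absurd hyw (hgt _ (Nat.lt_succ_self c) y hy).ne'
    · rw [Filling.upd_upd, Filling.upd_eq_self _ hm]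
  | row_diag => simp at hb
  | @row_eq _ c _ i p q hx hy hl =>
    refine ⟨hb, c, ⟨i, false⟩, ⟨?_, by simp, fun c' hc' u hu => ?_⟩, fun u hu hui => ?_,
      fun h => ?_⟩
    · rw [Filling.upd_of_ne _ _ (by omega), Filling.upd_self]
    · by_cases hcc : c' = c + 1
      · subst hcc
        rw [Filling.upd_self] at hu
        cases hu
        simp
      · rw [Filling.upd_of_ne _ _ (by omega), Filling.upd_of_ne _ _ (by omega)] at hu
        have := hg.dist le_rfl (by omega : c + 1 ≤ c') hy hu
        dsimp only at this ⊢
        omega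
    · rw [Filling.upd_self] at hu
      cases hu
      refine ⟨?_, rfl⟩
      funext r' c'
      by_cases h1 : r' = k ∧ c' = c + 1
      · rw [h1.1, h1.2, Filling.upd_self, hy, ← hb]
      · rw [Filling.upd_of_ne _ _ (by omega)]
        by_cases h2 : r' = k ∧ c' = c
        · rw [h2.1, h2.2, Filling.upd_self, hx]
        · rw [Filling.upd_of_ne _ _ (by omega), Filling.upd_of_ne _ _ (by omega),
            Filling.upd_of_ne _ _ (by omega)]
    · exact absurd rfl (h ⟨i + 1, q⟩ (Filling.upd_self _ _ _ _))
  | col_bump => simp at hb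
  | col_eq => simp at hb

theorem Step.prev_col {b₀ : Bool} {k : ℕ} {e₀ e : Filling} {w₀ w : Letter}
    (h : Step b₀ k e₀ w₀ true e w) (hg : Good e₀) :
    ∃ r x, IsLast (fun r => e r k) w r x ∧ b₀ = decide (r ≠ k) ∧
      (r = k → (∀ y, e k (k + 1) = some y → y.ceil = w.ceil →
        e₀ = (e.upd k k (some ⟨x.ceil, y.primed⟩)).upd k (k + 1) (some ⟨w.ceil, false⟩) ∧
        w₀ = ⟨x.ceil, w.primed⟩) ∧
      ((∀ y, e k (k + 1) = some y → y.ceil ≠ w.ceil) →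
        e₀ = e.upd k k (some ⟨w.ceil, false⟩) ∧ w₀ = ⟨x.ceil, w.primed⟩)) ∧
      (r ≠ k → (∀ y, e (r + 1) k = some y → y.ceil = w.ceil →
        e₀ = (e.upd r k (some ⟨x.ceil, y.primed⟩)).upd (r + 1) k (some ⟨w.ceil, false⟩) ∧
        w₀ = ⟨x.ceil, w.primed⟩) ∧
      ((∀ y, e (r + 1) k = some y → y.ceil ≠ w.ceil) → e₀ = e.upd r k (some w) ∧ w₀ = x)) := by
  generalize hb : true = b at h
  have htop : ∀ r > k, e₀ r k = none := fun r hr => by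
    by_contra hne
    obtain ⟨y, hy⟩ := Option.ne_none_iff_exists'.1 hne
    have := hg.le _ _ _ hy
    omega
  cases h with
  | row_bump => simp at hb
  | @row_diag _ _ _ m hm hw =>
    refine ⟨k, w₀.unprime, ⟨Filling.upd_self _ _ _ _, hw, fun r' hr' y hy => ?_⟩, by simp,
      fun _ => ⟨fun y hy hyw => ?_, fun _ => ⟨?_, rfl⟩⟩, fun h => absurd rfl h⟩
    · dsimp only at hy
      rw [Filling.upd_of_ne _ _ (by omega), htop _ hr'] at hy
      cases hy
    · rw [Filling.upd_of_ne _ _ (by omega)] at hy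
      have := hg.dist le_rfl (Nat.le_succ k) hm hy
      push_cast at this
      dsimp only at hyw
      omega
    · rw [Filling.upd_upd, Filling.upd_eq_self]
      have := hg.diag _ _ hm
      rw [hm, ← this]
  | @row_eq _ c _ i p q hx hy hl =>
    obtain rfl : c = k := by simpa using hb
    refine ⟨c, ⟨i, false⟩, ⟨?_, by simp, fun r' hr' u hu => ?_⟩, by simp,
      fun _ => ⟨fun u hu hui => ?_, fun h => ?_⟩, fun h => absurd rfl h⟩
    · dsimp only
      rw [Filling.upd_of_ne _ _ (by omega), Filling.upd_self]
    · dsimp only at hu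
      rw [Filling.upd_of_ne _ _ (by omega), Filling.upd_of_ne _ _ (by omega), htop _ hr'] at hu
      cases hu
    · rw [Filling.upd_self] at hu
      cases hu
      refine ⟨?_, rfl⟩
      funext r' c'
      by_cases h1 : r' = c ∧ c' = c + 1
      · rw [h1.1, h1.2, Filling.upd_self, hy]
      · rw [Filling.upd_of_ne _ _ (by omega)]
        by_cases h2 : r' = c ∧ c' = c
        · rw [h2.1, h2.2, Filling.upd_self, hx]
        · rw [Filling.upd_of_ne _ _ (by omega), Filling.upd_of_ne _ _ (by omega),
            Filling.upd_of_ne _ _ (by omega)]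
    · exact absurd rfl (h ⟨i + 1, q⟩ (Filling.upd_self _ _ _ _))
  | @col_bump _ r _ _ m hrk hm hw hl =>
    have hgt : ∀ r' > r, ∀ y, e₀ r' k = some y → w.ceil < y.ceil := fun c' hc' y hy => by
      have := hg.dist hc'.le le_rfl hm hy
      omega
    refine ⟨r, w₀, ⟨Filling.upd_self _ _ _ _, hw, fun c' hc' y hy => ?_⟩, by simp; omega,
      fun h => by omega, fun _ => ⟨fun y hy hyw => ?_, fun _ => ⟨?_, rfl⟩⟩⟩
    · dsimp only at hy
      rw [Filling.upd_of_ne _ _ (by omega)] at hy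
      exact (hgt c' hc' y hy).le
    · rw [Filling.upd_of_ne _ _ (by omega)] at hy
      exact absurd hyw (hgt _ (Nat.lt_succ_self r) y hy).ne'
    · rw [Filling.upd_upd, Filling.upd_eq_self _ hm]
  | @col_eq _ r _ i p q hx hy hl =>
    have hrk := hg.le _ _ _ hy
    refine ⟨r, ⟨i, false⟩, ⟨?_, by simp, fun c' hc' u hu => ?_⟩, by simp; omega,
      fun h => by omega, fun _ => ⟨fun u hu hui => ?_, fun h => ?_⟩⟩
    · dsimp only
      rw [Filling.upd_of_ne _ _ (by omega), Filling.upd_self]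
    · dsimp only at hu
      by_cases hcc : c' = r + 1
      · subst hcc
        rw [Filling.upd_self] at hu
        cases hu
        simp
      · rw [Filling.upd_of_ne _ _ (by omega), Filling.upd_of_ne _ _ (by omega)] at hu
        have := hg.dist (by omega : r + 1 ≤ c') le_rfl hy hu
        dsimp only at this ⊢
        omega
    · rw [Filling.upd_self] at hu
      cases hu
      refine ⟨?_, rfl⟩
      funext r' c'
      by_cases h1 : r' = r + 1 ∧ c' = k
      · rw [h1.1, h1.2, Filling.upd_self, hy]
      · rw [Filling.upd_of_ne _ _ (by omega)]
        by_cases h2 : r' = r ∧ c' = k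
        · rw [h2.1, h2.2, Filling.upd_self, hx]
        · rw [Filling.upd_of_ne _ _ (by omega), Filling.upd_of_ne _ _ (by omega),
            Filling.upd_of_ne _ _ (by omega)]
    · exact absurd rfl (h ⟨i + 1, q⟩ (Filling.upd_self _ _ _ _))

theorem Step.injective {b₁ b₂ b : Bool} {k : ℕ} {e₁ e₂ e : Filling} {w₁ w₂ w : Letter}
    (h₁ : Step b₁ k e₁ w₁ b e w) (h₂ : Step b₂ k e₂ w₂ b e w) (hg₁ : Good e₁) (hg₂ : Good e₂) :
    b₁ = b₂ ∧ e₁ = e₂ ∧ w₁ = w₂ := by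
  have key : ∀ {g : Option Letter} {A A' : Letter → Prop} {B B' : Prop},
      (∀ y, g = some y → y.ceil = w.ceil → A y) → ((∀ y, g = some y → y.ceil ≠ w.ceil) → B) →
      (∀ y, g = some y → y.ceil = w.ceil → A' y) → ((∀ y, g = some y → y.ceil ≠ w.ceil) → B') →
      (∃ y, A y ∧ A' y) ∨ B ∧ B' := by
    intro g A A' B B' h1 h2 h3 h4
    by_cases h : ∃ y, g = some y ∧ y.ceil = w.ceil
    · obtain ⟨y, hy, hyw⟩ := h
      exact Or.inl ⟨y, h1 y hy hyw, h3 y hy hyw⟩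
    · push Not at h
      exact Or.inr ⟨h2 h, h4 h⟩
  cases b
  · obtain ⟨rfl, c, x, hl, h3, h4⟩ := h₁.prev_row hg₁
    obtain ⟨rfl, c', x', hl', h3', h4'⟩ := h₂.prev_row hg₂
    obtain ⟨rfl, rfl⟩ := hl.unique hl'
    rcases key h3 h4 h3' h4' with ⟨y, h, h'⟩ | ⟨h, h'⟩
    · exact ⟨rfl, h.1.trans h'.1.symm, h.2.trans h'.2.symm⟩
    · exact ⟨rfl, h.1.trans h'.1.symm, h.2.trans h'.2.symm⟩
  · obtain ⟨c, x, hl, hb, h3, h4⟩ := h₁.prev_col hg₁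
    obtain ⟨c', x', hl', hb', h3', h4'⟩ := h₂.prev_col hg₂
    obtain ⟨rfl, rfl⟩ := hl.unique hl'
    refine ⟨hb.trans hb'.symm, ?_⟩
    by_cases hc : c = k
    · rcases key (h3 hc).1 (h3 hc).2 (h3' hc).1 (h3' hc).2 with ⟨y, h, h'⟩ | ⟨h, h'⟩
      · exact ⟨h.1.trans h'.1.symm, h.2.trans h'.2.symm⟩
      · exact ⟨h.1.trans h'.1.symm, h.2.trans h'.2.symm⟩
    · rcases key (h4 hc).1 (h4 hc).2 (h4' hc).1 (h4' hc).2 with ⟨y, h, h'⟩ | ⟨h, h'⟩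
      · exact ⟨h.1.trans h'.1.symm, h.2.trans h'.2.symm⟩
      · exact ⟨h.1.trans h'.1.symm, h.2.trans h'.2.symm⟩

theorem InsPath.injective {k : ℕ} : ∀ {e₁ e₂ e : Filling} {w₁ w₂ w : Letter} {b : Bool},
    InsPath e₁ w₁ b k e w → InsPath e₂ w₂ b k e w → e₁ = e₂ ∧ w₁ = w₂ := by
  induction k with
  | zero =>
    intro e₁ e₂ e w₁ w₂ w b h₁ h₂
    cases h₁
    cases h₂
    exact ⟨rfl, rfl⟩
  | succ k ih =>
    intro e₁ e₂ e w₁ w₂ w b h₁ h₂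
    cases h₁ with
    | step h₁ hs₁ _ =>
      cases h₂ with
      | step h₂ hs₂ _ =>
        obtain ⟨rfl, rfl, rfl⟩ := hs₁.injective hs₂ h₁.good h₂.good
        exact ih h₁ h₂

theorem Filling.upd_injective {e₁ e₂ : Filling} {r c : ℕ} {x₁ x₂ : Option Letter}
    (h₁ : e₁ r c = none) (h₂ : e₂ r c = none) (h : e₁.upd r c x₁ = e₂.upd r c x₂) :
    e₁ = e₂ ∧ x₁ = x₂ := by
  constructor
  · have := congrArg (fun e => Filling.upd e r c none) h
    simpa only [Filling.upd_upd, Filling.upd_eq_self _ h₁, Filling.upd_eq_self _ h₂] using this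
  · have := congrFun (congrFun h r) c
    rwa [Filling.upd_self, Filling.upd_self] at this

theorem Term.unique {b₁ b₂ : Bool} {k₁ k₂ r c : ℕ} {e₁ e₂ e : Filling} {w₁ w₂ : Letter} {f : Bool}
    (h₁ : Term b₁ k₁ e₁ w₁ r c e f) (h₂ : Term b₂ k₂ e₂ w₂ r c e f) :
    b₁ = b₂ ∧ k₁ = k₂ ∧ e₁ = e₂ ∧ w₁ = w₂ := by
  generalize he : e = e' at h₁
  generalize hf : f = f' at h₁
  cases h₁ with
  | row hkc hn hne hl =>
    cases h₂ with
    | row hkc' hn' hne' hl' =>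
      obtain ⟨rfl, hw⟩ := Filling.upd_injective hn' hn he
      refine ⟨rfl, rfl, rfl, ?_⟩
      by_cases hc : k₁ = c
      · rw [if_pos hc, if_pos hc, Option.some.injEq] at hw
        simp only [hc, decide_true, Bool.true_and] at hf
        obtain ⟨i, p⟩ := w₁
        obtain ⟨i', p'⟩ := w₂
        simp only [Letter.unprime, Letter.mk.injEq] at hw
        dsimp only at hf
        rw [hf, hw.1]
      · rw [if_neg hc, if_neg hc] at hw
        simpa using hw.symm
    | col hrk hn' hne' hl' =>
      simp [hrk.ne] at hf
  | col hrk hn hne hl =>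
    cases h₂ with
    | row hkc' hn' hne' hl' =>
      simp [hrk.ne] at hf
    | col hrk hn' hne' hl' =>
      obtain ⟨rfl, hw⟩ := Filling.upd_injective hn' hn he
      exact ⟨rfl, rfl, rfl, by simpa using hw.symm⟩

theorem Inserts.injective {e₁ e₂ e : Filling} {w₁ w₂ : Letter} {r c : ℕ} {f : Bool}
    (h₁ : Inserts e₁ w₁ r c e f) (h₂ : Inserts e₂ w₂ r c e f) : e₁ = e₂ ∧ w₁ = w₂ := by
  obtain ⟨b, k, e', w, hp, ht⟩ := h₁
  obtain ⟨b', k', e'', w', hp', ht'⟩ := h₂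
  obtain ⟨rfl, rfl, rfl, rfl⟩ := ht.unique ht'
  exact hp.injective hp'

theorem List.findIdx?_eq_some_of_getElem? {α : Type*} {l : List α} {p : α → Bool} {i : ℕ} {x : α}
    (hx : l[i]? = some x) (hp : p x = true)
    (hl : ∀ j < i, ∀ y, l[j]? = some y → p y = false) : l.findIdx? p = some i := by
  obtain ⟨hi, rfl⟩ := List.getElem?_eq_some_iff.1 hx
  rw [List.findIdx?_eq_some_iff_getElem]
  exact ⟨hi, hp, fun j hj => by simp [hl j hj _ (List.getElem?_eq_getElem (hj.trans hi))]⟩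

theorem List.findIdx?_eq_none_of_getElem? {α : Type*} {l : List α} {p : α → Bool}
    (hl : ∀ (j : ℕ) y, l[j]? = some y → p y = false) : l.findIdx? p = none := by
  rw [List.findIdx?_eq_none_iff]
  intro x hx
  obtain ⟨j, hj⟩ := List.mem_iff_getElem?.1 hx
  exact hl j x hj

theorem getElem?_filterMap_range {β : Type*} {n : ℕ} {g : ℕ → Option β}
    (hn : ∀ i, n ≤ i → g i = none) (hg : ∀ i j, i ≤ j → g i = none → g j = none) (i : ℕ) :
    ((List.range n).filterMap g)[i]? = g i := by
  induction n generalizing g i with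
  | zero => simp [hn i (Nat.zero_le _)]
  | succ n ih =>
    rw [List.range_succ_eq_map, List.filterMap_cons]
    have h1 := ih (g := fun i => g (i + 1)) (fun i hi => hn _ (by omega))
      (fun i j hij => hg _ _ (by omega))
    cases h0 : g 0 with
    | none =>
      rw [hg 0 i (Nat.zero_le _) h0, List.filterMap_map]
      simp only
      rw [show (List.filterMap (g ∘ Nat.succ) (List.range n)) =
        (List.range n).filterMap fun i => g (i + 1) from rfl, h1, hg 0 _ (Nat.zero_le _) h0]
    | some x =>
      rw [List.filterMap_map]
      cases i with
      | zero => simp [h0]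
      | succ i =>
        simp only [List.getElem?_cons_succ]
        exact h1 i

section

variable {α : Type*}

theorem entryG?_of_le (T : List (List α)) {r c : ℕ} (h : r ≤ c) :
    entryG? T r c = (T.getD r [])[c - r]? := by
  rw [entryG?, if_pos h, List.getD_eq_getElem?_getD]
  cases T[r]? <;> simp

theorem entryG?_add (T : List (List α)) (r i : ℕ) : entryG? T r (r + i) = (T.getD r [])[i]? := by
  rw [entryG?_of_le _ (Nat.le_add_right r i), Nat.add_sub_cancel_left]

theorem le_of_entryG? {T : List (List α)} {r c : ℕ} {x : α} (h : entryG? T r c = some x) :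
    r ≤ c := by
  by_contra hrc
  simp [entryG?, hrc] at h

theorem isShifted_iff {T : List (List α)} : IsShifted T ↔
    ∀ r < T.length, 0 < (T.getD r []).length ∧
      (r + 1 < T.length → (T.getD (r + 1) []).length < (T.getD r []).length) := by
  rw [IsShifted, IsStrictPartition, shapeOf, List.Chain', List.isChain_iff_getElem]
  constructor
  · rintro ⟨h1, h2⟩ r hr
    refine ⟨h2 _ (List.mem_map_of_mem ?_), fun hr' => ?_⟩
    · rw [List.getD_eq_getElem _ _ hr]
      exact List.getElem_mem hr
    · rw [List.getD_eq_getElem _ _ hr, List.getD_eq_getElem _ _ hr']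
      have := h1 r ((List.length_map List.length (as := T)).symm ▸ hr')
      rwa [List.getElem_map, List.getElem_map] at this
  · intro h
    constructor
    · intro i hi
      have hi' : i + 1 < T.length := by simpa using hi
      have := (h i (by omega)).2 hi'
      rw [List.getD_eq_getElem _ _ hi', List.getD_eq_getElem _ _ (by omega)] at this
      simpa using this
    · intro m hm
      obtain ⟨row, hrow, rfl⟩ := List.mem_map.1 hm
      obtain ⟨r, hr, rfl⟩ := List.mem_iff_getElem.1 hrow
      have := (h r hr).1
      rwa [List.getD_eq_getElem _ _ hr] at this

theorem IsShifted.length_pos {T : List (List α)} (h : IsShifted T) {r : ℕ} :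
    0 < (T.getD r []).length ↔ r < T.length := by
  constructor
  · intro hr
    by_contra hr'
    rw [List.getD_eq_default _ _ (by omega)] at hr
    simp at hr
  · exact fun hr => (isShifted_iff.1 h r hr).1

theorem IsShifted.length_lt {T : List (List α)} (h : IsShifted T) {r : ℕ}
    (hr : 0 < (T.getD r []).length) : (T.getD (r + 1) []).length < (T.getD r []).length := by
  by_cases hr' : r + 1 < T.length
  · exact (isShifted_iff.1 h r (by omega)).2 hr'
  · rwa [List.getD_eq_default _ _ (by omega)]

theorem IsShifted.ext {T T' : List (List α)} (h : IsShifted T) (h' : IsShifted T')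
    (he : ∀ r c, entryG? T r c = entryG? T' r c) : T = T' := by
  have h1 : ∀ r, T.getD r [] = T'.getD r [] := fun r => by
    refine List.ext_getElem? fun i => ?_
    rw [← entryG?_add, ← entryG?_add, he]
  have h2 : T.length = T'.length := by
    have h3 : ∀ r, r < T.length ↔ r < T'.length := fun r => by
      rw [← h.length_pos, ← h'.length_pos, h1]
    have := h3 T.length
    have := h3 T'.length
    omega
  refine List.ext_getElem h2 fun r hr hr' => ?_
  rw [← List.getD_eq_getElem _ [] hr, ← List.getD_eq_getElem _ [] hr', h1]

theorem getD_setRowG {T : List (List α)} {r : ℕ} (hr : r ≤ T.length) (row : List α) (r' : ℕ) :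
    (setRowG T r row).getD r' [] = if r' = r then row else T.getD r' [] := by
  rw [setRowG]
  split_ifs with h1 h2 h2
  · subst h2
    rw [List.getD_eq_getElem?_getD, List.getElem?_set_self h1]
    rfl
  · rw [List.getD_eq_getElem?_getD, List.getElem?_set_ne (Ne.symm h2),
      List.getD_eq_getElem?_getD]
  · obtain rfl : r' = T.length := by omega
    simp
  · rw [List.getD_eq_getElem?_getD, List.getD_eq_getElem?_getD]
    rcases lt_or_ge r' T.length with h3 | h3
    · rw [List.getElem?_append_left h3]
    · rw [List.getElem?_eq_none (by simp; omega), List.getElem?_eq_none h3]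

theorem length_setRowG {T : List (List α)} {r : ℕ} (hr : r ≤ T.length) (row : List α) :
    (setRowG T r row).length = max T.length (r + 1) := by
  rw [setRowG]
  split_ifs with h1
  · rw [List.length_set]
    omega
  · rw [List.length_append, List.length_singleton]
    omega

theorem setEntryG_eq {T : List (List α)} {r : ℕ} (hr : r < T.length) (c : ℕ) (x : α) :
    setEntryG T r c x = setRowG T r ((T.getD r []).set (c - r) x) := by
  rw [setEntryG, setRowG, if_pos hr]

end

/-- The tableau `T` has the entries of the filling `e`. -/
structure Represents (T : STab) (e : Filling) : Prop where
  shifted : IsShifted T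
  entry : ∀ r c, entryG? T r c = e r c

namespace Represents

variable {T : STab} {e : Filling}

theorem getElem? (h : Represents T e) (r i : ℕ) : (T.getD r [])[i]? = e r (r + i) := by
  rw [← h.entry, entryG?_add]

theorem lt_length_iff (h : Represents T e) (r i : ℕ) :
    i < (T.getD r []).length ↔ e r (r + i) ≠ none := by
  rw [← h.getElem?, ne_eq, List.getElem?_eq_none_iff, not_le]

theorem row_lt (h : Represents T e) {r c : ℕ} {m : Letter} (hm : e r c = some m) :
    r ≤ c ∧ c - r < (T.getD r []).length ∧ r < T.length := by
  have hrc := le_of_entryG? ((h.entry r c).trans hm)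
  have h1 : c - r < (T.getD r []).length := by
    rw [h.lt_length_iff, show r + (c - r) = c by omega, hm]
    simp
  exact ⟨hrc, h1, h.shifted.length_pos.1 (by omega)⟩

theorem entry_setRowG {r : ℕ} (hr : r ≤ T.length) (row : List Letter) (r' c' : ℕ) :
    entryG? (setRowG T r row) r' c' =
      if r' = r ∧ r ≤ c' then row[c' - r]? else if r' = r then none else entryG? T r' c' := by
  by_cases hrc : r' ≤ c'
  · rw [entryG?_of_le _ hrc, getD_setRowG hr]
    by_cases h : r' = r
    · subst h
      simp [hrc]
    · simp [h, entryG?_of_le _ hrc]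
  · rw [entryG?, if_neg hrc, entryG?, if_neg hrc, if_neg (by omega)]
    simp

theorem set (h : Represents T e) {r c : ℕ} {m : Letter} (hm : e r c = some m) (x : Letter) :
    Represents (setEntryG T r c x) (e.upd r c (some x)) := by
  obtain ⟨hrc, hlen, hr⟩ := h.row_lt hm
  have hL : ∀ r', ((setEntryG T r c x).getD r' []).length = (T.getD r' []).length := fun r' => by
    rw [setEntryG_eq hr, getD_setRowG hr.le]
    split_ifs with h'
    · rw [List.length_set, h']
    · rfl
  refine ⟨isShifted_iff.2 fun r' hr' => ?_, fun r' c' => ?_⟩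
  · rw [hL, hL]
    rw [setEntryG_eq hr, length_setRowG hr.le] at hr' ⊢
    have h1 := isShifted_iff.1 h.shifted r' (by omega)
    exact ⟨h1.1, fun h2 => h1.2 (by omega)⟩
  · rw [setEntryG_eq hr, entry_setRowG hr.le]
    by_cases h1 : r' = r
    · subst h1
      by_cases h2 : r' ≤ c'
      · rw [if_pos ⟨rfl, h2⟩]
        by_cases h3 : c' = c
        · subst h3
          rw [Filling.upd_self, List.getElem?_set_self hlen]
        · rw [Filling.upd_of_ne _ _ (by omega), List.getElem?_set_ne (by omega), h.getElem?,
            show r' + (c' - r') = c' by omega]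
      · rw [if_neg (by omega), if_pos rfl, Filling.upd_of_ne _ _ (by omega), ← h.entry, entryG?,
          if_neg h2]
    · rw [if_neg (by omega), if_neg h1, Filling.upd_of_ne _ _ (by omega), h.entry]

theorem length_eq (h : Represents T e) {r c : ℕ} (hrc : r ≤ c) (hn : e r c = none)
    (hne : ∀ c', r ≤ c' → c' < c → e r c' ≠ none) : (T.getD r []).length = c - r := by
  have h1 := (h.lt_length_iff r (c - r)).not
  rw [show r + (c - r) = c by omega, hn] at h1
  simp only [ne_eq, not_true_eq_false, not_false_eq_true, iff_true, not_lt] at h1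
  rcases h1.lt_or_eq with h2 | h2
  · have h3 := (h.lt_length_iff r (T.getD r []).length).not
    exact absurd (h3.1 (lt_irrefl _)) (not_not.2 (hne _ (by omega) (by omega)))
  · exact h2

theorem add (h : Represents T e) {r c : ℕ} (hrc : r ≤ c) (hn : e r c = none)
    (hne : ∀ c', r ≤ c' → c' < c → e r c' ≠ none) (hd : ∀ r', r = r' + 1 → e r' c ≠ none)
    (x : Letter) : Represents (setRowG T r (T.getD r [] ++ [x])) (e.upd r c (some x)) := by
  have hlen := h.length_eq hrc hn hne
  have hbelow : ∀ r', r = r' + 1 → c - r' < (T.getD r' []).length := fun r' hr' => by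
    rw [h.lt_length_iff, show r' + (c - r') = c by omega]
    exact hd r' hr'
  have hr : r ≤ T.length := by
    cases r with
    | zero => omega
    | succ r' =>
      have := hbelow r' rfl
      exact h.shifted.length_pos.1 (by omega)
  refine ⟨isShifted_iff.2 fun r' hr' => ?_, fun r' c' => ?_⟩
  · rw [getD_setRowG hr, getD_setRowG hr]
    rw [length_setRowG hr] at hr' ⊢
    have h1 := isShifted_iff.1 h.shifted r'
    split_ifs with h2 h3 h3
    · omega
    · subst h2
      rw [List.length_append, List.length_singleton]
      refine ⟨by omega, fun h4 => ?_⟩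
      have := (isShifted_iff.1 h.shifted r' (by omega)).2 (by omega)
      omega
    · rw [List.length_append, List.length_singleton]
      have := hbelow r' h3.symm
      omega
    · have h4 := h1 (by omega)
      exact ⟨h4.1, fun h5 => h4.2 (by omega)⟩
  · rw [entry_setRowG hr]
    by_cases h1 : r' = r
    · subst h1
      by_cases h2 : r' ≤ c'
      · rw [if_pos ⟨rfl, h2⟩]
        by_cases h3 : c' = c
        · subst h3
          rw [Filling.upd_self, ← hlen, List.getElem?_concat_length]
        · rw [Filling.upd_of_ne _ _ (by omega)]
          rcases lt_or_ge (c' - r') (T.getD r' []).length with h4 | h4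
          · rw [List.getElem?_append_left h4, h.getElem?, show r' + (c' - r') = c' by omega]
          · rw [List.getElem?_eq_none (by rw [List.length_append, List.length_singleton]; omega),
              ← h.entry, entryG?_of_le _ h2, List.getElem?_eq_none h4]
      · rw [if_neg (by omega), if_pos rfl, Filling.upd_of_ne _ _ (by omega), ← h.entry, entryG?,
          if_neg h2]
    · rw [if_neg (by omega), if_neg h1, Filling.upd_of_ne _ _ (by omega), h.entry]

end Represents

/-- Insertion into row (`false`) or column (`true`) number `k`. -/
def egSeg : Bool → ℕ → STab → ℕ → Letter → STab × Bool
  | false => egRow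
  | true => egCol

theorem switchPrimes_eq (i j : ℤ) (q : Bool) :
    switchPrimes ⟨i, q⟩ ⟨j, false⟩ = (⟨i, false⟩, ⟨j, q⟩) := by
  cases q <;> rfl

theorem Good.getElem?_col {e : Filling} (hg : Good e) {T : STab} (h : Represents T e) (c i : ℕ) :
    ((List.range (c + 1)).filterMap fun r => (entry? T r c).map fun x => (r, x))[i]? =
      (e i c).map fun x => (i, x) := by
  simp only [entry?, h.entry]
  refine getElem?_filterMap_range (g := fun r => (e r c).map fun x => (r, x)) (fun j hj => ?_)
    (fun j j' hj hn => ?_) i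
  · rw [Option.map_eq_none_iff]
    by_contra hne
    obtain ⟨y, hy⟩ := Option.ne_none_iff_exists'.1 hne
    have := hg.le _ _ _ hy
    omega
  · rw [Option.map_eq_none_iff] at hn ⊢
    exact hg.none_up hj hn

section

variable {T : STab} {e : Filling} {k : ℕ} {w : Letter}

theorem Represents.findIdx_row (h : Represents T e) (hg : Good e) {p : Letter → Bool} {c : ℕ} {m : Letter}
    (hm : e k c = some m) (hp : p m = true) (hl : ∀ c' < c, ∀ x, e k c' = some x → p x = false) :
    (T.getD k []).findIdx? p = some (c - k) := by
  have hkc := hg.le _ _ _ hm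
  refine List.findIdx?_eq_some_of_getElem? (x := m) ?_ hp fun j hj y hy => ?_
  · rw [h.getElem?, show k + (c - k) = c by omega, hm]
  · rw [h.getElem?] at hy
    exact hl _ (by omega) _ hy

theorem Represents.findIdx_col (h : Represents T e) (hg : Good e) {p : ℕ × Letter → Bool} {r : ℕ} {m : Letter}
    (hm : e r k = some m) (hp : p (r, m) = true)
    (hl : ∀ r' < r, ∀ x, e r' k = some x → p (r', x) = false) :
    (((List.range (k + 1)).filterMap fun r => (entry? T r k).map fun x => (r, x)).findIdx? p) =
      some r := by
  refine List.findIdx?_eq_some_of_getElem? (x := (r, m)) ?_ hp fun j hj y hy => ?_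
  · rw [hg.getElem?_col h, hm]
    rfl
  · rw [hg.getElem?_col h] at hy
    obtain ⟨x, hx, rfl⟩ := Option.map_eq_some_iff.1 hy
    exact hl _ hj _ hx

theorem Step.simulate (hg : Good e) (h : Represents T e) {b b' : Bool} {e' : Filling} {w' : Letter}
    (hs : Step b k e w b' e' w') :
    ∃ T', Represents T' e' ∧ ∀ F, egSeg b (F + 1) T k w = egSeg b' F T' (k + 1) w' := by
  cases hs with
  | @row_bump _ c _ _ _ hkc hm hw hl =>
    refine ⟨_, h.set hm w, fun F => ?_⟩
    obtain ⟨-, -, hk⟩ := h.row_lt hm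
    have h1 := h.findIdx_row hg (p := fun x => decide (w.ceil < x.ceil)) hm (by simpa using hw)
      fun c' hc' x hx => by simpa using (hl c' hc' x hx).le
    have h2 := h.findIdx_row hg (p := fun x => decide (w.ceil ≤ x.ceil)) hm (by simpa using hw.le)
      fun c' hc' x hx => by simpa using hl c' hc' x hx
    have h3 := h.getElem? k (c - k)
    rw [show k + (c - k) = c by omega, hm] at h3
    simp only [egSeg]
    rw [egRow]
    simp only [h1, h2, Option.getD_some, if_true, if_neg (by omega : ¬ c - k = 0),
      List.getD_eq_getElem?_getD (l := T.getD k []), h3, setEntryG_eq hk]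
  | @row_diag _ _ _ m hm hw =>
    refine ⟨_, h.set hm w.unprime, fun F => ?_⟩
    obtain ⟨-, -, hk⟩ := h.row_lt hm
    have hl : ∀ c' < k, ∀ x, e k c' = some x → False := fun c' hc' x hx => by
      have := hg.le _ _ _ hx
      omega
    have h1 := h.findIdx_row hg (p := fun x => decide (w.ceil < x.ceil)) hm (by simpa using hw)
      fun c' hc' x hx => (hl c' hc' x hx).elim
    have h2 := h.findIdx_row hg (p := fun x => decide (w.ceil ≤ x.ceil)) hm (by simpa using hw.le)
      fun c' hc' x hx => (hl c' hc' x hx).elim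
    have h3 := h.getElem? k 0
    rw [Nat.add_zero, hm] at h3
    rw [Nat.sub_self] at h1 h2
    simp only [egSeg]
    rw [egRow]
    simp only [h1, h2, Option.getD_some, if_true,
      List.getD_eq_getElem?_getD (l := T.getD k []), h3, setEntryG_eq hk, Nat.sub_self]
  | @row_eq _ c _ i p q hx hy hl =>
    have hkc := hg.le _ _ _ hx
    refine ⟨_, (h.set hx ⟨i, false⟩).set (c := c + 1)
      ((Filling.upd_of_ne _ _ (by omega)).trans hy) ⟨i + 1, q⟩, fun F => ?_⟩
    obtain ⟨-, hlen, hk⟩ := h.row_lt hx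
    have h1 := h.findIdx_row hg (p := fun x => decide (i < x.ceil)) hy (by simp)
      fun c' hc' x hx' => by
        have := hg.dist le_rfl (by omega : c' ≤ c) hx' hx
        dsimp only at this
        simp only [decide_eq_false_iff_not]
        omega
    have h2 := h.findIdx_row hg (p := fun x => decide (i ≤ x.ceil)) hx (by simp)
      fun c' hc' x hx => by simpa using hl c' hc' x hx
    have h3 := h.getElem? k (c - k)
    rw [show k + (c - k) = c by omega, hx] at h3
    have h4 := h.getElem? k (c + 1 - k)
    rw [show k + (c + 1 - k) = c + 1 by omega, hy] at h4
    have h5 : setEntryG (setEntryG T k c ⟨i, false⟩) k (c + 1) ⟨i + 1, q⟩ =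
        setRowG T k (((T.getD k []).set (c - k) ⟨i, false⟩).set (c + 1 - k) ⟨i + 1, q⟩) := by
      have hk' : k < (setEntryG T k c ⟨i, false⟩).length := by
        rw [setEntryG, List.length_set]
        exact hk
      rw [setEntryG_eq hk', setEntryG_eq hk, getD_setRowG hk.le, if_pos rfl, setRowG, setRowG,
        setRowG, if_pos hk, if_pos hk, if_pos (by rwa [List.length_set]), List.set_set]
    simp only [egSeg]
    rw [egRow]
    simp only [h1, h2, Option.getD_some, if_neg (by omega : ¬ c - k = c + 1 - k),
      List.getD_eq_getElem?_getD (l := T.getD k []), h3, h4, switchPrimes_eq, h5]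
    by_cases hc : c = k
    · subst hc
      simp [Letter.succL]
    · rw [if_neg (by omega), decide_eq_false hc]
      rfl
  | @col_bump _ r _ _ _ hrk hm hw hl =>
    refine ⟨_, h.set hm w, fun F => ?_⟩
    have h1 := h.findIdx_col hg (p := fun x => decide (w.ceil < x.2.ceil)) hm (by simpa using hw)
      fun c' hc' x hx => by simpa using (hl c' hc' x hx).le
    have h2 := h.findIdx_col hg (p := fun x => decide (w.ceil ≤ x.2.ceil)) hm
      (by simpa using hw.le) fun c' hc' x hx => by simpa using hl c' hc' x hx
    have h3 := hg.getElem?_col h k r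
    rw [hm] at h3
    simp only [egSeg]
    rw [egCol]
    simp only [h1, h2, Option.getD_some, if_true, List.getD_eq_getElem?_getD (α := ℕ × Letter), h3,
      Option.map_some, if_neg hrk.ne]
  | @col_eq _ r _ i p q hx hy hl =>
    refine ⟨_, (h.set hx ⟨i, false⟩).set (r := r + 1)
      ((Filling.upd_of_ne _ _ (by omega)).trans hy) ⟨i + 1, q⟩, fun F => ?_⟩
    have h1 := h.findIdx_col hg (p := fun x => decide (i < x.2.ceil)) hy (by simp)
      fun c' hc' x hx' => by
        have := hg.dist (by omega : c' ≤ r) le_rfl hx' hx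
        dsimp only at this
        simp only [decide_eq_false_iff_not]
        omega
    have h2 := h.findIdx_col hg (p := fun x => decide (i ≤ x.2.ceil)) hx (by simp)
      fun c' hc' x hx => by simpa using hl c' hc' x hx
    have h3 := hg.getElem?_col h k r
    rw [hx] at h3
    have h4 := hg.getElem?_col h k (r + 1)
    rw [hy] at h4
    simp only [egSeg]
    rw [egCol]
    simp only [h1, h2, Option.getD_some, if_neg (by omega : ¬ r = r + 1),
      List.getD_eq_getElem?_getD (α := ℕ × Letter), h3, h4, switchPrimes_eq, Option.map_some]
    rfl

theorem Term.simulate (hg : Good e) (h : Represents T e) {b : Bool} {r c : ℕ} {e' : Filling} {f : Bool}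
    (ht : Term b k e w r c e' f) (hg' : Good e') :
    ∃ T', Represents T' e' ∧ ∀ F, egSeg b (F + 1) T k w = (T', f) := by
  cases ht with
  | row hkc hn hne hl =>
    have hd : ∀ r', k = r' + 1 → e r' c ≠ none := by
      rintro r' rfl
      obtain ⟨y, hy, -⟩ := hg'.down r' c _ (Filling.upd_self _ _ _ _)
      rw [Filling.upd_of_ne _ _ (by omega)] at hy
      simp [hy]
    refine ⟨_, h.add hkc hn hne hd _, fun F => ?_⟩
    have h1 : (T.getD k []).findIdx? (fun x => decide (w.ceil < x.ceil)) = none := by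
      refine List.findIdx?_eq_none_of_getElem? fun j y hy => ?_
      rw [h.getElem?] at hy
      simpa using (hl _ _ hy).le
    have hlen := h.length_eq hkc hn hne
    simp only [egSeg]
    rw [egRow]
    simp only [h1]
    by_cases hc : k = c
    · subst hc
      have hnil : T.getD k [] = [] := List.length_eq_zero_iff.1 (by omega)
      simp only [hnil, List.isEmpty_nil, true_and, if_true, decide_true, Bool.true_and]
      cases hw : w.primed
      · obtain ⟨i, p⟩ := w
        dsimp only at hw
        subst hw
        rfl
      · rfl
    · have hne : (T.getD k []).isEmpty = false := by
        rw [List.isEmpty_eq_false_iff, ← List.length_pos_iff]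
        omega
      simp only [hne, hc, Bool.false_eq_true, false_and, if_false, decide_false, Bool.false_and]
  | @col _ r _ _ hrk hn hne hl =>
    have hne' : ∀ c', r ≤ c' → c' < k → e r c' ≠ none := by
      intro c' h1 h2
      have := hg'.ne_none_row (Filling.upd_self e r k (some w)) c' h1 h2
      rwa [Filling.upd_of_ne _ _ (by omega)] at this
    have hd : ∀ r', r = r' + 1 → e r' k ≠ none := by
      rintro r' rfl
      exact hne r' (Nat.lt_succ_self r')
    refine ⟨_, h.add hrk.le hn hne' hd _, fun F => ?_⟩
    have h1 : ((List.range (k + 1)).filterMap fun r =>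
        (entry? T r k).map fun x => (r, x)).findIdx? (fun x => decide (w.ceil < x.2.ceil)) =
        none := by
      refine List.findIdx?_eq_none_of_getElem? fun j y hy => ?_
      rw [hg.getElem?_col h] at hy
      obtain ⟨x, hx, rfl⟩ := Option.map_eq_some_iff.1 hy
      simpa using (hl _ _ hx).le
    have h2 : ((List.range (k + 1)).filterMap fun r =>
        (entry? T r k).map fun x => (r, x)).length = r := by
      have h3 : ∀ i, i < ((List.range (k + 1)).filterMap fun r =>
          (entry? T r k).map fun x => (r, x)).length ↔ e i k ≠ none := fun i => by
        rw [← not_le, ← List.getElem?_eq_none_iff, hg.getElem?_col h, Option.map_eq_none_iff]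
      refine le_antisymm (not_lt.1 fun h4 => (h3 r).1 h4 hn) (not_lt.1 fun h4 => ?_)
      exact lt_irrefl _ ((h3 _).2 (hne _ h4))
    simp only [egSeg]
    rw [egCol]
    simp only [h1, h2, hrk.ne, false_and, if_false]

end

/-- The boxes of the filling form a shifted diagram. -/
structure ShapeClosed (e : Filling) : Prop where
  le : ∀ r c, e r c ≠ none → r ≤ c
  left : ∀ r c, r ≤ c → e r (c + 1) ≠ none → e r c ≠ none
  down : ∀ r c, e (r + 1) c ≠ none → e r c ≠ none

theorem Good.shapeClosed {e : Filling} (h : Good e) : ShapeClosed e where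
  le r c hx := by
    obtain ⟨x, hx⟩ := Option.ne_none_iff_exists'.1 hx
    exact h.le r c x hx
  left r c hrc hx := by
    obtain ⟨x, hx⟩ := Option.ne_none_iff_exists'.1 hx
    obtain ⟨y, hy, -⟩ := h.left r c x hrc hx
    simp [hy]
  down r c hx := by
    obtain ⟨x, hx⟩ := Option.ne_none_iff_exists'.1 hx
    obtain ⟨y, hy, -⟩ := h.down r c x hx
    simp [hy]

theorem ShapeClosed.remove {e : Filling} (h : ShapeClosed e) {r c : ℕ} (hr : e r (c + 1) = none)
    (hu : e (r + 1) c = none) : ShapeClosed (e.upd r c none) where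
  le r' c' hx := by
    simp only [Filling.upd] at hx
    split_ifs at hx with h1
    · simp at hx
    · exact h.le _ _ hx
  left r' c' hrc hx := by
    simp only [Filling.upd] at hx ⊢
    split_ifs at hx with h1
    · simp at hx
    · rw [if_neg]
      · exact h.left _ _ hrc hx
      · rintro ⟨rfl, rfl⟩
        exact hx hr
  down r' c' hx := by
    simp only [Filling.upd] at hx ⊢
    split_ifs at hx with h1
    · simp at hx
    · rw [if_neg]
      · exact h.down _ _ hx
      · rintro ⟨rfl, rfl⟩
        exact hx hu

namespace Represents

variable {T T' : STab} {e : Filling}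

theorem unique (h : Represents T e) (h' : Represents T' e) : T = T' :=
  h.shifted.ext h'.shifted fun r c => by rw [h.entry, h'.entry]

theorem shapeClosed (h : Represents T e) : ShapeClosed e where
  le r c hx := by
    obtain ⟨x, hx⟩ := Option.ne_none_iff_exists'.1 hx
    exact (h.row_lt hx).1
  left r c hrc hx := by
    obtain ⟨i, rfl⟩ := Nat.exists_eq_add_of_le hrc
    rw [add_assoc, ← h.lt_length_iff] at hx
    rw [← h.lt_length_iff]
    omega
  down r c hx := by
    obtain ⟨x, hx'⟩ := Option.ne_none_iff_exists'.1 hx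
    obtain ⟨i, rfl⟩ := Nat.exists_eq_add_of_le (h.row_lt hx').1
    rw [← h.lt_length_iff] at hx
    rw [add_assoc, ← h.lt_length_iff]
    have hr := (h.row_lt hx').2.2
    have := (isShifted_iff.1 h.shifted r (by omega)).2 hr
    omega

theorem within (h : Represents T e) : e.Within T.flatten.length := by
  have h1 : ∀ r, r < T.length → (T.getD r []).length + r ≤ (T.getD 0 []).length := by
    intro r
    induction r with
    | zero => simp
    | succ r ih =>
      intro hr
      have h2 := (isShifted_iff.1 h.shifted r (by omega)).2 hr
      have := ih (by omega)
      omega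
  have h2 : (T.getD 0 []).length ≤ T.flatten.length := by
    cases T <;> simp
  intro r c x hx
  obtain ⟨h3, h4, h5⟩ := h.row_lt hx
  have := h1 r h5
  omega

theorem rowW_eq (h : Represents T e) {n : ℕ} (hw : e.Within n) (r : ℕ) :
    rowW n e r = T.getD r [] := by
  have hnone : ∀ c, c < r → e r c = none := fun c hc => by
    by_contra hne
    have := h.shapeClosed.le _ _ hne
    omega
  have h1 : seqW (n + r) (e r) = rowW n e r := by
    refine seqW_split_none (Nat.le_add_right n r) fun i hi => ?_
    by_contra hne
    obtain ⟨x, hx⟩ := Option.ne_none_iff_exists'.1 hne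
    exact absurd (hw _ _ _ hx) (not_lt.2 hi)
  rw [← h1, add_comm, seqW_eq_append, seqW_eq_nil fun i hi => hnone i hi, List.nil_append]
  refine List.ext_getElem? fun i => ?_
  rw [tailW, List.range'_eq_map_range, List.filterMap_map, h.getElem?]
  refine getElem?_filterMap_range (g := fun i => e r (r + i)) (fun i hi => ?_)
    (fun i j hij hn => ?_) i
  · by_contra hne
    obtain ⟨x, hx⟩ := Option.ne_none_iff_exists'.1 hne
    have := hw _ _ _ hx
    omega
  · rw [← h.getElem?, List.getElem?_eq_none_iff] at hn ⊢
    omega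

end Represents

theorem ShapeClosed.exists_represents {e : Filling} (h : ShapeClosed e) {n : ℕ}
    (hw : e.Within n) : ∃ T, Represents T e := by
  have hnone : ∀ r c, n ≤ c → e r c = none := fun r c hc => by
    by_contra hne
    obtain ⟨x, hx⟩ := Option.ne_none_iff_exists'.1 hne
    exact absurd (hw _ _ _ hx) (not_lt.2 hc)
  have hright : ∀ r c c', r ≤ c → c ≤ c' → e r c = none → e r c' = none := by
    intro r c c' hrc hc hn
    induction c', hc using Nat.le_induction with
    | base => exact hn
    | succ m hm ih =>
      by_contra hne
      exact h.left r m (by omega) hne ih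
  have hup : ∀ r r' c, r ≤ r' → e r c = none → e r' c = none := by
    intro r r' c hr hn
    induction r', hr using Nat.le_induction with
    | base => exact hn
    | succ m hm ih =>
      by_contra hne
      exact h.down m c hne ih
  let R : ℕ → List Letter := fun r => (List.range n).filterMap fun i => e r (r + i)
  have hR : ∀ r i, (R r)[i]? = e r (r + i) := fun r i =>
    getElem?_filterMap_range (g := fun i => e r (r + i)) (fun i hi => hnone _ _ (by omega))
      (fun i j hij => hright _ _ _ (by omega) (by omega)) i
  have hR' : ∀ r i, i < (R r).length ↔ e r (r + i) ≠ none := fun r i => by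
    rw [← hR, ne_eq, List.getElem?_eq_none_iff, not_le]
  have hR0 : ∀ r, R r = [] ↔ e r r = none := fun r => by
    have := hR' r 0
    rw [List.length_pos_iff, not_iff_not] at this
    exact this
  let T : STab := (List.range n).filterMap fun r => if R r = [] then none else some (R r)
  have hT : ∀ r, T[r]? = if R r = [] then none else some (R r) := by
    refine getElem?_filterMap_range (g := fun r => if R r = [] then none else some (R r))
      (fun i hi => ?_) (fun i j hij hn => ?_)
    · rw [if_pos ((hR0 i).2 (hnone _ _ hi))]
    · have h1 : R i = [] := by
        by_contra h2
        rw [if_neg h2] at hn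
        simp at hn
      rw [if_pos]
      rw [hR0] at h1 ⊢
      exact hup i j j hij (hright i i j le_rfl hij h1)
  have hD : ∀ r, T.getD r [] = R r := fun r => by
    rw [List.getD_eq_getElem?_getD, hT]
    split_ifs with h1
    · exact h1.symm
    · rfl
  refine ⟨T, isShifted_iff.2 fun r hr => ?_, fun r c => ?_⟩
  · rw [hD, hD]
    have h1 : ∀ r < T.length, R r ≠ [] := fun r hr h1 => by
      have := hT r
      rw [if_pos h1, List.getElem?_eq_none_iff] at this
      omega
    refine ⟨List.length_pos_iff.2 (h1 r hr), fun hr' => ?_⟩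
    have h2 := List.length_pos_iff.2 (h1 _ hr')
    have h3 := (hR' (r + 1) ((R (r + 1)).length - 1)).1 (by omega)
    have h4 := h.down _ _ h3
    rw [show r + 1 + ((R (r + 1)).length - 1) = r + (R (r + 1)).length by omega, ← hR'] at h4
    exact h4
  · by_cases hrc : r ≤ c
    · rw [entryG?_of_le _ hrc, hD, hR, show r + (c - r) = c by omega]
    · rw [entryG?, if_neg hrc]
      by_contra hne
      exact hrc (h.le r c (Ne.symm hne))

/-- The filling given by the entries of a tableau. -/
def entries (T : STab) : Filling := fun r c => entryG? T r c

theorem IsShifted.represents {T : STab} (h : IsShifted T) : Represents T (entries T) :=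
  ⟨h, fun _ _ => rfl⟩

namespace Represents

variable {T : STab} {e : Filling}

theorem eq_entries (h : Represents T e) : e = entries T := by
  funext r c
  exact (h.entry r c).symm

theorem rowWord_eq (h : Represents T e) {n : ℕ} (hw : e.Within n) :
    rowWord T = downW (rowW n e) n := by
  have h1 : ∀ T : STab, T.reverse.flatten = downW (fun r => T.getD r []) T.length := by
    intro T
    induction T using List.reverseRecOn with
    | nil => rfl
    | append_singleton T row ih =>
      rw [List.reverse_append, List.reverse_singleton, List.flatten_append, ih,
        List.length_append, List.length_singleton, downW]
      congr 1
      · simp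
      · refine downW_congr fun i hi => ?_
        rw [List.getD_eq_getElem?_getD, List.getD_eq_getElem?_getD, List.getElem?_append_left hi]
  have h2 : T.length ≤ n := by
    by_contra h2
    have h3 := h.shifted.length_pos.2 (by omega : n < T.length)
    rw [h.lt_length_iff, Nat.add_zero] at h3
    obtain ⟨x, hx⟩ := Option.ne_none_iff_exists'.1 h3
    exact lt_irrefl n (hw _ _ _ hx)
  rw [downW_congr (s := rowW n e) (t := fun r => T.getD r []) fun i _ => h.rowW_eq hw i]
  obtain ⟨m, rfl⟩ := Nat.exists_eq_add_of_le h2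
  rw [downW_add, downTailW_eq_nil, rowWord, h1, List.nil_append]
  intro i hi
  exact List.getD_eq_default _ _ hi

end Represents

theorem Filling.upd_eq_none_iff {e : Filling} {r c : ℕ} {m x : Letter} (h : e r c = some m)
    (r' c' : ℕ) : e.upd r c (some x) r' c' = none ↔ e r' c' = none := by
  simp only [Filling.upd]
  split_ifs with h'
  · rw [h'.1, h'.2, h]
    simp
  · rfl

theorem Step.eq_none_iff {b b' : Bool} {k : ℕ} {e e' : Filling} {w w' : Letter}
    (h : Step b k e w b' e' w') (r c : ℕ) : e' r c = none ↔ e r c = none := by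
  cases h with
  | row_bump hkc hm hw hl => exact Filling.upd_eq_none_iff hm r c
  | row_diag hm hw => exact Filling.upd_eq_none_iff hm r c
  | row_eq hx hy hl =>
    rw [Filling.upd_eq_none_iff ((Filling.upd_of_ne _ _ (by omega)).trans hy),
      Filling.upd_eq_none_iff hx]
  | col_bump hrk hm hw hl => exact Filling.upd_eq_none_iff hm r c
  | col_eq hx hy hl =>
    rw [Filling.upd_eq_none_iff ((Filling.upd_of_ne _ _ (by omega)).trans hy),
      Filling.upd_eq_none_iff hx]

theorem InsPath.eq_none_iff {e₀ e : Filling} {w₀ w : Letter} {b : Bool} {k : ℕ}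
    (h : InsPath e₀ w₀ b k e w) (r c : ℕ) : e r c = none ↔ e₀ r c = none := by
  induction h with
  | start h => rfl
  | step h hs hg ih => rw [hs.eq_none_iff, ih]

theorem Term.eq_upd {b : Bool} {k : ℕ} {e e' : Filling} {w : Letter} {r c : ℕ} {f : Bool}
    (h : Term b k e w r c e' f) :
    k ≤ c ∧ r ≤ c ∧ e r c = none ∧ ∃ x, e' = e.upd r c (some x) := by
  cases h with
  | row hkc hn hne hl => exact ⟨hkc, hkc, hn, _, rfl⟩
  | col hrk hn hne hl => exact ⟨le_rfl, hrk.le, hn, _, rfl⟩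

theorem InsPath.simulate {e₀ e : Filling} {w₀ w : Letter} {b : Bool} {k : ℕ}
    (h : InsPath e₀ w₀ b k e w) {T₀ : STab} (hT : Represents T₀ e₀) :
    ∃ T, Represents T e ∧ ∀ F, egRow (F + k) T₀ 0 w₀ = egSeg b F T k w := by
  induction h with
  | start h => exact ⟨T₀, hT, fun F => rfl⟩
  | step h hs hg ih =>
    obtain ⟨T, hT, hF⟩ := ih
    obtain ⟨T', hT', hF'⟩ := hs.simulate h.good hT
    refine ⟨T', hT', fun F => ?_⟩
    rw [← hF', ← hF]
    congr 1
    omega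

theorem Inserts.eq_none_iff {e e' : Filling} {w : Letter} {r c : ℕ} {f : Bool}
    (h : Inserts e w r c e' f) : r ≤ c ∧ e r c = none ∧ e' r c ≠ none ∧
      ∀ r' c', (r' ≠ r ∨ c' ≠ c) → (e' r' c' = none ↔ e r' c' = none) := by
  obtain ⟨b, k, e₁, w₁, hp, ht⟩ := h
  obtain ⟨hkc, hrc, hn, x, rfl⟩ := ht.eq_upd
  refine ⟨hrc, (hp.eq_none_iff r c).1 hn, ?_, fun r' c' h' => ?_⟩
  · rw [Filling.upd_self]
    simp
  · rw [Filling.upd_of_ne _ _ h', hp.eq_none_iff]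

theorem Inserts.simulate {e e' : Filling} {w : Letter} {r c : ℕ} {f : Bool}
    (h : Inserts e w r c e' f) (hg : Good e') {T : STab} (hT : Represents T e)
    (hc : c ≤ T.flatten.length) : ∃ T', Represents T' e' ∧ egInsert T w = (T', f) := by
  obtain ⟨b, k, e₁, w₁, hp, ht⟩ := h
  obtain ⟨T₁, hT₁, hF⟩ := hp.simulate hT
  obtain ⟨T', hT', hF'⟩ := ht.simulate hp.good hT₁ hg
  refine ⟨T', hT', ?_⟩
  obtain ⟨hkc, -⟩ := ht.eq_upd
  obtain ⟨F, hF₁⟩ := Nat.exists_eq_add_of_le (by omega : k + 1 ≤ T.flatten.length + T.length + 2)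
  rw [egInsert, hF₁, ← hF' F, ← hF]
  congr 1
  omega

/-- The tableau `T'` has one box more than `T`, in row `r`. -/
def AddsBox (T T' : STab) (r : ℕ) : Prop :=
  ∀ r', (T'.getD r' []).length = (T.getD r' []).length + if r' = r then 1 else 0

theorem Inserts.addsBox {e e' : Filling} {w : Letter} {r c : ℕ} {f : Bool}
    (h : Inserts e w r c e' f) {T T' : STab} (hT : Represents T e) (hT' : Represents T' e') :
    AddsBox T T' r ∧ c = r + (T.getD r []).length := by
  obtain ⟨hrc, hn, hn', hne⟩ := h.eq_none_iff
  have key : ∀ r' i, (r' ≠ r ∨ i + r ≠ c) →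
      (i < (T'.getD r' []).length ↔ i < (T.getD r' []).length) := fun r' i h' => by
    rw [hT.lt_length_iff, hT'.lt_length_iff, not_iff_not]
    exact hne _ _ (by omega)
  have h1 := (hT'.lt_length_iff r (c - r)).2 (by rwa [show r + (c - r) = c by omega])
  have h2 := (hT.lt_length_iff r (c - r)).not.2 (by rw [show r + (c - r) = c by omega, hn]; simp)
  have h3 : (T.getD r []).length = c - r := by
    by_contra h3
    have h4 := (key r (T.getD r []).length (by omega)).1 (by omega)
    omega
  have h4 : (T'.getD r []).length = c - r + 1 := by
    by_contra h4
    have h5 := (key r (c - r + 1) (by omega)).1 (by omega)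
    omega
  refine ⟨fun r' => ?_, by omega⟩
  split_ifs with h5
  · rw [h5]
    omega
  · have h6 := key r' (T.getD r' []).length (by omega)
    have h7 := key r' (T'.getD r' []).length (by omega)
    omega

theorem readRow_zero (n : ℕ) (e : Filling) (w : Letter) :
    readRow n e 0 w = downW (rowW n e) n ++ [w] := by
  have h := downW_add (rowW n e) 0 n
  rw [zero_add] at h
  rw [readRow, h]
  simp [downW]

theorem Filling.Within.mono {e : Filling} {m n : ℕ} (h : e.Within m) (hmn : m ≤ n) :
    e.Within n := fun r c x hx => (h r c x hx).trans_le hmn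

theorem Good.rowInv_zero_iff {e : Filling} (h : Good e) {n : ℕ} (hw : e.Within n)
    {T : STab} (hT : Represents T e) {z : Equiv.Perm ℤ} {w : Letter} :
    RowInv n z 0 e w ↔ rowWord T ++ [w] ∈ RinvPlus z := by
  rw [hT.rowWord_eq (hw.mono (Nat.le_add_right n 2)), ← readRow_zero]
  exact ⟨RowInv.mem, fun hm => ⟨h, hw, hm, fun j hj => by omega⟩⟩

/-- A tableau whose filling is good and whose reading word is a primed involution word. -/
structure Valid (T : STab) (z : Equiv.Perm ℤ) : Prop where
  shifted : IsShifted T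
  good : Good (entries T)
  mem : rowWord T ∈ RinvPlus z

theorem Valid.insert {T : STab} {z z' : Equiv.Perm ℤ} (h : Valid T z) {w : Letter}
    (hw : rowWord T ++ [w] ∈ RinvPlus z') :
    Valid (egInsert T w).1 z' ∧ ∃ r, AddsBox T (egInsert T w).1 r ∧
      Inserts (entries T) w r (r + (T.getD r []).length) (entries (egInsert T w).1)
        (egInsert T w).2 := by
  have hT := h.shifted.represents
  have hi := (h.good.rowInv_zero_iff hT.within hT).2 hw
  obtain ⟨r, c, e', f, hins, hg, hwi, hmem⟩ := hi.inserts
  have hc : c ≤ T.flatten.length := by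
    obtain ⟨x, hx⟩ := Option.ne_none_iff_exists'.1 hins.eq_none_iff.2.2.1
    exact Nat.le_of_lt_succ (hwi _ _ _ hx)
  obtain ⟨T', hT', heq⟩ := hins.simulate hg hT hc
  obtain ⟨h1, rfl⟩ := hins.addsBox hT hT'
  rw [heq]
  obtain rfl := hT'.eq_entries
  refine ⟨⟨hT'.shifted, hg, ?_⟩, r, h1, hins⟩
  rwa [hT'.rowWord_eq (hwi.mono (Nat.le_succ _))]

theorem Valid.insert_injective {T₁ T₂ : STab} {z₁ z₂ z : Equiv.Perm ℤ} (h₁ : Valid T₁ z₁)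
    (h₂ : Valid T₂ z₂) {w₁ w₂ : Letter} (hw₁ : rowWord T₁ ++ [w₁] ∈ RinvPlus z)
    (hw₂ : rowWord T₂ ++ [w₂] ∈ RinvPlus z) (he : egInsert T₁ w₁ = egInsert T₂ w₂)
    (hl : shapeOf T₁ = shapeOf T₂) : T₁ = T₂ ∧ w₁ = w₂ := by
  obtain ⟨-, r₁, ha₁, hi₁⟩ := h₁.insert hw₁
  obtain ⟨-, r₂, ha₂, hi₂⟩ := h₂.insert hw₂
  have hlen : ∀ r, (T₁.getD r []).length = (T₂.getD r []).length := fun r => by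
    have := congrArg (fun l : List ℕ => l[r]?.getD 0) hl
    simp only [shapeOf, List.getElem?_map] at this
    rw [List.getD_eq_getElem?_getD, List.getD_eq_getElem?_getD]
    revert this
    cases T₁[r]? <;> cases T₂[r]? <;> simp
  have hr : r₁ = r₂ := by
    have h3 := ha₁ r₁
    have h4 := ha₂ r₁
    rw [he, hlen, h4, if_pos rfl] at h3
    by_contra hne
    rw [if_neg hne] at h3
    omega
  subst hr
  rw [he, hlen] at hi₁
  obtain ⟨h3, h4⟩ := hi₁.injective hi₂
  exact ⟨h₁.shifted.represents.unique (h3 ▸ h₂.shifted.represents), h4⟩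

theorem Valid.exists_insert {T' : STab} {z : Equiv.Perm ℤ} (h : Valid T' z) {r c : ℕ}
    (hx : entries T' r c ≠ none) (hr : entries T' r (c + 1) = none)
    (hu : entries T' (r + 1) c = none) (f : Bool) :
    ∃ T z₀ w, Valid T z₀ ∧ rowWord T ++ [w] ∈ RinvPlus z ∧ egInsert T w = (T', f) ∧
      AddsBox T T' r := by
  have hT' := h.shifted.represents
  obtain ⟨x, hx⟩ := Option.ne_none_iff_exists'.1 hx
  have hmem := h.mem
  rw [hT'.rowWord_eq (hT'.within.mono (Nat.le_add_right _ 2))] at hmem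
  obtain ⟨e₀, w₀, hins, hi⟩ := h.good.exists_inserts hT'.within hmem hx hr hu f
  obtain ⟨T, hT⟩ := hi.good.shapeClosed.exists_represents hi.within
  obtain rfl := hT.eq_entries
  have hw := (hi.good.rowInv_zero_iff hi.within hT).1 hi
  obtain ⟨h1, h2⟩ := hins.addsBox hT hT'
  have hc : c ≤ T.flatten.length := by
    have h3 : (T.getD r []).length + r ≤ T.flatten.length := by
      cases hl : (T.getD r []).length with
      | zero =>
        cases r with
        | zero => omega
        | succ r =>
          obtain ⟨y, hy, -⟩ := h.good.down _ _ _ hx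
          have h4 : entries T r c ≠ none := by
            rw [ne_eq, ← hins.eq_none_iff.2.2.2 r c (by omega), hy]
            simp
          obtain ⟨y, hy⟩ := Option.ne_none_iff_exists'.1 h4
          have := hT.within _ _ _ hy
          omega
      | succ i =>
        have h4 := (hT.lt_length_iff r i).1 (by omega)
        obtain ⟨y, hy⟩ := Option.ne_none_iff_exists'.1 h4
        have := hT.within _ _ _ hy
        omega
    omega
  obtain ⟨T'', hT'', heq⟩ := hins.simulate h.good hT hc
  obtain rfl := hT''.unique hT'
  exact ⟨T, _, w₀, ⟨hT.shifted, hi.good, mem_RinvPlus_prefix hw⟩, hw, heq, h1⟩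

theorem Letter.lt_iff {x y : Letter} :
    x < y ↔ x.ceil < y.ceil ∨ x.ceil = y.ceil ∧ x.primed = true ∧ y.primed = false := by
  have h : x < y ↔ toLex (x.ceil, !x.primed) < toLex (y.ceil, !y.primed) := Iff.rfl
  rw [h, Prod.Lex.toLex_lt_toLex]
  obtain ⟨i, p⟩ := x
  obtain ⟨j, q⟩ := y
  cases p <;> cases q <;> simp

theorem Letter.ceil_le {x y : Letter} (h : x < y) : x.ceil ≤ y.ceil := by
  rcases Letter.lt_iff.1 h with h | h
  · exact h.le
  · exact h.1.le

theorem dead_primed_succ (i : ℤ) : Dead [⟨i, true⟩, ⟨i + 1, true⟩] := by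
  intro y hy
  simp only [run]
  split_ifs with h1 h2
  · exfalso
    have k1 := h1.2 rfl
    have k2 := (h2.2 rfl).1
    dsimp only at k1 k2
    rw [invStep_apply hy h1.1, if_pos k1] at k2
    have h3 : sPerm i (i + 1) = i := by rw [sPerm_apply]; simp
    rw [h3, k1.1] at k2
    omega
  · rfl
  · rfl

/-- A filling with strictly increasing rows and columns and unprimed main diagonal. -/
structure Increasing (e : Filling) : Prop where
  shape : ShapeClosed e
  row : ∀ r c x y, e r c = some x → e r (c + 1) = some y → x < y
  col : ∀ r c x y, e r c = some x → e (r + 1) c = some y → x < y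
  diag : ∀ r x, e r r = some x → x.primed = false

namespace Increasing

variable {e : Filling} {n : ℕ} {z : Equiv.Perm ℤ}

theorem exists_left (h : Increasing e) {r c : ℕ} {x : Letter} (hrc : r ≤ c)
    (hx : e r (c + 1) = some x) : ∃ y, e r c = some y := by
  have h1 := h.shape.left r c hrc (by rw [hx]; simp)
  exact Option.ne_none_iff_exists'.1 h1

theorem exists_down (h : Increasing e) {r c : ℕ} {x : Letter}
    (hx : e (r + 1) c = some x) : ∃ y, e r c = some y := by
  have h1 := h.shape.down r c (by rw [hx]; simp)
  exact Option.ne_none_iff_exists'.1 h1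

theorem le (h : Increasing e) {r c : ℕ} {x : Letter} (hx : e r c = some x) : r ≤ c :=
  h.shape.le r c (by rw [hx]; simp)

theorem diag_le (h : Increasing e) {r c : ℕ} {x : Letter} (hx : e r c = some x) {k : ℕ}
    (hk : k ≤ r) : ∃ y, e k k = some y ∧ y.ceil ≤ x.ceil := by
  have h1 : ∀ c, r ≤ c → ∀ x, e r c = some x → ∃ y, e r r = some y ∧ y.ceil ≤ x.ceil := by
    intro c hc
    induction c, hc using Nat.le_induction with
    | base => exact fun x hx => ⟨x, hx, le_rfl⟩
    | succ c hc ih =>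
      intro x hx
      obtain ⟨y, hy⟩ := h.exists_left hc hx
      obtain ⟨y', hy', hle⟩ := ih y hy
      exact ⟨y', hy', hle.trans (Letter.ceil_le (h.row _ _ _ _ hy hx))⟩
  obtain ⟨y, hy, hyx⟩ := h1 c (h.le hx) x hx
  clear h1 hx
  induction r, hk using Nat.le_induction generalizing y with
  | base => exact ⟨y, hy, hyx⟩
  | succ r hr ih =>
    obtain ⟨u, hu⟩ := h.exists_down hy
    obtain ⟨v, hv⟩ := h.exists_left le_rfl hu
    exact ih v hv ((Letter.ceil_le (h.row _ _ _ _ hv hu)).trans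
      ((Letter.ceil_le (h.col _ _ _ _ hu hy)).trans hyx))

end Increasing

theorem downW_split (s : ℕ → PWord) {k n : ℕ} (h : k < n) :
    downW s n = downTailW s (k + 1) (n - (k + 1)) ++ (s k ++ downW s k) := by
  obtain ⟨m, rfl⟩ : ∃ m, n = k + 1 + m := ⟨n - k - 1, by omega⟩
  rw [downW_add, Nat.add_sub_cancel_left, downW]

theorem Filling.exists_split {e : Filling} {n r c : ℕ} {x y : Letter} (hw : e.Within n)
    (hr : r < n) (hx : e r c = some x) (hy : e r (c + 1) = some y) :
    ∃ A B, downW (rowW n e) n = A ++ x :: y :: B := by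
  refine ⟨downTailW (rowW n e) (r + 1) (n - (r + 1)) ++ seqW c (e r),
    tailW (c + 2) (n - c - 2) (e r) ++ downW (rowW n e) r, ?_⟩
  have hrow : rowW n e r = _ := seqW_split₂ (hw _ _ _ hy) hx hy
  rw [downW_split _ hr, hrow]
  simp only [List.append_assoc, List.cons_append]

namespace Increasing

variable {e : Filling} {n : ℕ} {z : Equiv.Perm ℤ}

theorem row_ceil_lt (h : Increasing e) (hw : e.Within n)
    (hz : downW (rowW n e) n ∈ RinvPlus z) {r c : ℕ} {x y : Letter}
    (hx : e r c = some x) (hy : e r (c + 1) = some y) : x.ceil < y.ceil := by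
  rcases Letter.lt_iff.1 (h.row _ _ _ _ hx hy) with h1 | h1
  · exact h1
  · exfalso
    have := h.le hx
    obtain ⟨A, B, hAB⟩ := Filling.exists_split hw (lt_of_le_of_lt this (hw _ _ _ hx)) hx hy
    rw [hAB] at hz
    exact not_mem_of_dead_pair (r := []) h1.1 (by simp) hz

theorem row_not_primed (h : Increasing e) (hw : e.Within n)
    (hz : downW (rowW n e) n ∈ RinvPlus z) {r c : ℕ} {x y : Letter}
    (hx : e r c = some x) (hy : e r (c + 1) = some y) (hxp : x.primed = true)
    (hyp : y.primed = true) : y.ceil ≠ x.ceil + 1 := by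
  intro hxy
  have := h.le hx
  obtain ⟨A, B, hAB⟩ := Filling.exists_split hw (lt_of_le_of_lt this (hw _ _ _ hx)) hx hy
  rw [hAB] at hz
  obtain ⟨i, p⟩ := x
  obtain ⟨j, q⟩ := y
  dsimp only at hxp hyp hxy
  subst hxp hyp hxy
  exact (dead_primed_succ i).not_mem z A B (by simpa using hz)

end Increasing

theorem not_mem_of_fixed_braid {z : Equiv.Perm ℤ} {A r B : PWord} {v : ℤ}
    (hA : ∀ u ∈ A, v + 2 ≤ u.ceil) (hr : ∀ u ∈ r, v + 2 ≤ u.ceil) :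
    A ++ ⟨v, false⟩ :: (r ++ ⟨v - 1, false⟩ :: ⟨v, true⟩ :: B) ∉ RinvPlus z := by
  intro h
  have h1 := (Eqv.refl A).append ((Eqv.move ⟨v, false⟩ (l := r) fun u hu => Or.inl (hr u hu)).append
    (Eqv.refl (⟨v - 1, false⟩ :: ⟨v, true⟩ :: B)))
  simp only [List.append_assoc, List.cons_append, List.nil_append] at h1
  have h2 := (h1.front.mem_iff z).1 h
  rw [← List.append_assoc, mem_RinvPlus_iff, run_append] at h2
  obtain ⟨h2, -⟩ := h2
  cases hrun : run 1 (A ++ r) with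
  | none => rw [hrun] at h2; simp at h2
  | some y =>
    rw [hrun, Option.bind_some] at h2
    have hfix : ∀ x, x ≤ v + 1 → y x = x := fun x hx =>
      run_fixed inv_one hrun rfl fun u hu => by
        have : v + 2 ≤ u.ceil := by
          rcases List.mem_append.1 hu with hu | hu
          · exact hA u hu
          · exact hr u hu
        omega
    have hy := run_inv inv_one hrun
    simp only [run] at h2
    split_ifs at h2 with h3 h4 h5
    have k1 := hfix v (by omega)
    have k2 := hfix (v + 1) (by omega)
    have k3 := hfix (v - 1) (by omega)
    have hs : ∀ x, invStep y v x = y (sPerm v x) := fun x => by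
      rw [invStep_apply hy h3.1, if_pos ⟨k1, k2⟩]
    have h6 := (h5.2 rfl).2
    dsimp only at h4 h6
    rw [invStep_apply (invStep_inv _ _ hy) h4.1, if_neg] at h6
    · have e1 : sPerm (v - 1) (v + 1) = v + 1 := by rw [sPerm_apply]; split_ifs <;> omega
      have e2 : sPerm v (v + 1) = v := by rw [sPerm_apply]; split_ifs <;> omega
      have e3 : sPerm (v - 1) v = v - 1 := by rw [sPerm_apply]; split_ifs <;> omega
      rw [e1, hs, e2, k1, e3] at h6
      omega
    · dsimp only
      rw [sub_add_cancel]
      rintro ⟨-, h7⟩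
      have e2 : sPerm v v = v + 1 := by rw [sPerm_apply]; split_ifs <;> omega
      rw [hs, e2, k2] at h7
      omega

namespace Increasing

variable {e : Filling} {n : ℕ} {z : Equiv.Perm ℤ}

theorem col_ceil_lt (h : Increasing e) (hw : e.Within n)
    (hz : downW (rowW n e) n ∈ RinvPlus z) {r c : ℕ} {x y : Letter}
    (hx : e r c = some x) (hy : e (r + 1) c = some y) : x.ceil < y.ceil := by
  rcases Letter.lt_iff.1 (h.col _ _ _ _ hx hy) with h1 | ⟨h1, hxp, hyp⟩
  · exact h1
  exfalso
  obtain ⟨v, p⟩ := x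
  obtain ⟨v', q⟩ := y
  dsimp only at h1 hxp hyp
  subst h1 hxp hyp
  have hrc := h.le hy
  have hcn := hw _ _ _ hx
  have hnext : ∀ q, e (r + 1) (c + 1) = some q → v + 2 ≤ q.ceil := by
    intro q hq
    obtain ⟨p, hp⟩ := h.exists_down hq
    have k1 := h.row_ceil_lt hw hz hy hq
    have k2 := h.row_ceil_lt hw hz hx hp
    dsimp only at k1 k2
    by_contra hlt
    rcases Letter.lt_iff.1 (h.col _ _ _ _ hp hq) with k3 | ⟨k3, hpp, -⟩
    · omega
    · exact h.row_not_primed hw hz hx hp rfl hpp (by dsimp only; omega)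
  have htail : ∀ c', c + 1 ≤ c' → ∀ q, e (r + 1) c' = some q → v + 2 ≤ q.ceil := by
    intro c' hc'
    induction c', hc' using Nat.le_induction with
    | base => exact hnext
    | succ c' hc' ih =>
      intro q hq
      obtain ⟨p, hp⟩ := h.exists_left (by omega) hq
      exact (ih p hp).trans (Letter.ceil_le (h.row _ _ _ _ hp hq))
  obtain ⟨c₀, rfl⟩ : ∃ c₀, c = c₀ + 1 := ⟨c - 1, by omega⟩
  obtain ⟨w, hwx⟩ := h.exists_left (by omega) hx
  have hwv := h.row_ceil_lt hw hz hwx hx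
  dsimp only at hwv
  have hhead : ∀ i, i ≤ c₀ → ∀ u, e r i = some u → u.ceil ≤ w.ceil := by
    have k : ∀ j i, i + j = c₀ → ∀ u, e r i = some u → u.ceil ≤ w.ceil := by
      intro j
      induction j with
      | zero =>
        rintro i rfl u hu
        rw [Nat.add_zero, hu, Option.some_inj] at hwx
        rw [hwx]
      | succ j ih =>
        intro i hi u hu
        have hri := h.le hu
        have hne : e r (i + 1) ≠ none := by
          have k : ∀ m, i + 1 ≤ m → e r m ≠ none → e r (i + 1) ≠ none := by
            intro m hm
            induction m, hm using Nat.le_induction with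
            | base => exact id
            | succ m hm ihm => exact fun hne => ihm (h.shape.left r m (by omega) hne)
          exact k c₀ (by omega) (by rw [hwx]; simp)
        obtain ⟨u', hu'⟩ := Option.ne_none_iff_exists'.1 hne
        exact (Letter.ceil_le (h.row _ _ _ _ hu hu')).trans (ih (i + 1) (by omega) u' hu')
    exact fun i hi => k (c₀ - i) i (by omega)
  rw [downW_split _ (show r + 1 < n by omega), downW] at hz
  have e1 := seqW_split hcn hy
  have e2 := seqW_split hcn hx
  have e1' : rowW n e (r + 1) = _ := e1
  have e2' : rowW n e r = _ := e2
  by_cases hcase : w.ceil + 2 ≤ v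
  · rw [e1', e2'] at hz
    refine not_mem_of_dead_pair (z := z)
      (A := downTailW (rowW n e) (r + 1 + 1) (n - (r + 1 + 1)) ++ seqW (c₀ + 1) (e (r + 1)))
      (a := ⟨v, false⟩) (b := ⟨v, true⟩)
      (r := tailW (c₀ + 1 + 1) (n - (c₀ + 1) - 1) (e (r + 1)) ++ seqW (c₀ + 1) (e r))
      (B := tailW (c₀ + 1 + 1) (n - (c₀ + 1) - 1) (e r) ++ downW (rowW n e) r) rfl ?_ ?_
    · intro u hu
      rcases List.mem_append.1 hu with hu | hu
      · obtain ⟨i, hi, -, hu⟩ := mem_tailW hu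
        exact Or.inl (htail i hi u hu)
      · obtain ⟨i, hi, hu⟩ := mem_seqW.1 hu
        have := hhead i (by omega) u hu
        exact Or.inr (by dsimp only; omega)
    · simpa only [List.append_assoc, List.cons_append] using hz
  · have hr : r = c₀ := by
      by_contra hne
      obtain ⟨u, hu⟩ := h.exists_left (by omega) hy
      have hzz := hz
      rw [← downW, ← downW_split _ (show r + 1 < n by omega)] at hzz
      have k1 := h.row_ceil_lt hw hzz hu hy
      dsimp only at k1
      rcases Letter.lt_iff.1 (h.col _ _ _ _ hwx hu) with k2 | ⟨k2, hwp, -⟩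
      · omega
      · exact h.row_not_primed hw hzz hwx hx hwp rfl (by dsimp only; omega)
    subst hr
    have hwe : w = ⟨v - 1, false⟩ := by
      have := h.diag _ _ hwx
      obtain ⟨i, p⟩ := w
      dsimp only at this hwv hcase
      rw [this, show i = v - 1 by omega]
    subst hwe
    have e3 : seqW (r + 1) (e (r + 1)) = [] := seqW_eq_nil fun i hi => by
      by_contra hne
      have := h.shape.le _ _ hne
      omega
    have e4 : seqW (r + 1) (e r) = [⟨v - 1, false⟩] := by
      rw [seqW_split (Nat.lt_succ_self r) hwx, seqW_eq_nil fun i hi => by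
        by_contra hne
        have := h.shape.le _ _ hne
        omega]
      simp [tailW]
    rw [e1', e2', e3, e4] at hz
    refine not_mem_of_fixed_braid (z := z) (v := v)
      (A := downTailW (rowW n e) (r + 1 + 1) (n - (r + 1 + 1)))
      (r := tailW (r + 1 + 1) (n - (r + 1) - 1) (e (r + 1)))
      (B := tailW (r + 1 + 1) (n - (r + 1) - 1) (e r) ++ downW (rowW n e) r) ?_ ?_ ?_
    · intro u hu
      obtain ⟨i, hi, -, hu⟩ := mem_downTailW hu
      obtain ⟨j, -, hu⟩ := mem_seqW.1 hu
      obtain ⟨d, hd, hdu⟩ := h.diag_le hu hi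
      obtain ⟨q, hq⟩ := h.exists_down hd
      exact (hnext q hq).trans ((Letter.ceil_le (h.col _ _ _ _ hq hd)).trans hdu)
    · intro u hu
      obtain ⟨i, hi, -, hu⟩ := mem_tailW hu
      exact htail i hi u hu
    · simpa only [List.append_assoc, List.cons_append, List.nil_append] using hz

theorem good (h : Increasing e) (hw : e.Within n) (hz : downW (rowW n e) n ∈ RinvPlus z) :
    Good e where
  le r c x hx := h.le hx
  left r c x hrc hx := by
    obtain ⟨y, hy⟩ := h.exists_left hrc hx
    exact ⟨y, hy, h.row_ceil_lt hw hz hy hx⟩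
  down r c x hx := by
    obtain ⟨y, hy⟩ := h.exists_down hx
    exact ⟨y, hy, h.col_ceil_lt hw hz hy hx⟩
  diag := h.diag

end Increasing

theorem valid_iff {T : STab} {z : Equiv.Perm ℤ} :
    Valid T z ↔ IsShifted T ∧ IsIncreasing T ∧ NoDiagPrimes T ∧ rowWord T ∈ RinvPlus z := by
  constructor
  · rintro ⟨h1, h2, h3⟩
    refine ⟨h1, ⟨fun r c x y hx hy => ?_, fun r c x y hx hy => ?_⟩, fun r x hx => h2.diag r x hx, h3⟩
    · obtain ⟨x', hx', hlt⟩ := h2.left r c y (h2.le _ _ _ hx) hy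
      obtain rfl : x' = x := Option.some_inj.1 (hx'.symm.trans hx)
      exact Letter.lt_iff.2 (Or.inl hlt)
    · obtain ⟨x', hx', hlt⟩ := h2.down r c y hy
      obtain rfl : x' = x := Option.some_inj.1 (hx'.symm.trans hx)
      exact Letter.lt_iff.2 (Or.inl hlt)
  · rintro ⟨h1, h2, h3, h4⟩
    have hT := h1.represents
    have hi : Increasing (entries T) := ⟨hT.shapeClosed, h2.1, h2.2, h3⟩
    exact ⟨h1, hi.good hT.within (hT.rowWord_eq hT.within ▸ h4), h4⟩

/-- Append the letter `x` to row `r` of `Q`. -/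
def appendAt (Q : STab) (r : ℕ) (x : Letter) : STab := setRowG Q r (Q.getD r [] ++ [x])

/-- A box can be added at the end of row `r` of `Q`. -/
def Addable (Q : STab) (r : ℕ) : Prop :=
  ∀ r', r = r' + 1 → (Q.getD r []).length + 1 < (Q.getD r' []).length

theorem Addable.represents {Q : STab} {r : ℕ} (h : Addable Q r) (hQ : IsShifted Q) (x : Letter) :
    Represents (appendAt Q r x)
      ((entries Q).upd r (r + (Q.getD r []).length) (some x)) := by
  have hQ := hQ.represents
  refine hQ.add (Nat.le_add_right _ _) ?_ ?_ ?_ x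
  · have := (hQ.lt_length_iff r (Q.getD r []).length).not
    simpa using this
  · intro c' h1 h2
    have := (hQ.lt_length_iff r (c' - r)).1 (by omega)
    rwa [show r + (c' - r) = c' by omega] at this
  · intro r' hr'
    have h1 := h r' hr'
    have := (hQ.lt_length_iff r' (r + (Q.getD r []).length - r')).1 (by omega)
    rwa [show r' + (r + (Q.getD r []).length - r') = r + (Q.getD r []).length by omega] at this

theorem Addable.addsBox {Q : STab} {r : ℕ} (h : Addable Q r) (hQ : IsShifted Q) (x : Letter) :
    AddsBox Q (appendAt Q r x) r := by
  have hr : r ≤ Q.length := by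
    rcases Nat.eq_zero_or_pos r with rfl | hpos
    · exact Nat.zero_le _
    · obtain ⟨r', rfl⟩ : ∃ r', r = r' + 1 := ⟨r - 1, by omega⟩
      have := h r' rfl
      exact hQ.length_pos.1 (by omega)
  intro r'
  rw [appendAt, getD_setRowG hr]
  split_ifs with h1
  · rw [h1]
    simp
  · simp

theorem AddsBox.addable {P P' : STab} {r : ℕ} (h : AddsBox P P' r) (hP' : IsShifted P') :
    Addable P r := by
  rintro r' rfl
  have h1 := h (r' + 1)
  have h2 := h r'
  rw [if_pos rfl] at h1
  rw [if_neg (by omega)] at h2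
  have h3 := hP'.length_lt (r := r') (by
    by_contra h4
    have h5 := hP'.length_pos (r := r' + 1)
    have h6 := hP'.length_pos (r := r')
    omega)
  omega

/-- Two tableaux have equal row lengths. -/
def SameRows (P Q : STab) : Prop := ∀ r, (P.getD r []).length = (Q.getD r []).length

theorem SameRows.shapeOf_eq {P Q : STab} (h : SameRows P Q) (hP : IsShifted P)
    (hQ : IsShifted Q) : shapeOf P = shapeOf Q := by
  have hlen : P.length = Q.length := by
    have key : ∀ r, r < P.length ↔ r < Q.length := fun r => by
      rw [← hP.length_pos, ← hQ.length_pos, h r]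
    have h1 := key P.length
    have h2 := key Q.length
    omega
  refine List.ext_getElem (by simp [shapeOf, hlen]) fun i h1 h2 => ?_
  simp only [shapeOf, List.length_map] at h1 h2
  have := h i
  rw [List.getD_eq_getElem _ _ h1, List.getD_eq_getElem _ _ h2] at this
  simpa [shapeOf] using this

theorem sameRows_of_shapeOf_eq {P Q : STab} (h : shapeOf P = shapeOf Q) : SameRows P Q := by
  intro r
  have := congrArg (fun l : List ℕ => l[r]?.getD 0) h
  simp only [shapeOf, List.getElem?_map] at this
  rw [List.getD_eq_getElem?_getD, List.getD_eq_getElem?_getD]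
  revert this
  cases P[r]? <;> cases Q[r]? <;> simp

theorem addBox_eq {P P' : STab} {r : ℕ} (h : AddsBox P P' r) (Q : STab) (x : Letter) :
    addBox Q P P' x = appendAt Q r x := by
  have hr : r < P'.length := by
    by_contra hr
    have := h r
    rw [List.getD_eq_default _ _ (not_lt.1 hr), if_pos rfl] at this
    simp at this
  have hf : (List.range P'.length).find?
      (fun r => decide ((P.getD r []).length ≠ (P'.getD r []).length)) = some r := by
    rw [List.find?_range_eq_some]
    refine ⟨?_, List.mem_range.2 hr, fun j hj => ?_⟩
    · rw [h r]
      simp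
    · rw [h j, if_neg (by omega)]
      simp
  rw [addBox, hf, appendAt]

theorem flatten_appendAt (Q : STab) (r : ℕ) (x : Letter) :
    (appendAt Q r x).flatten.Perm (x :: Q.flatten) := by
  rw [appendAt, setRowG]
  split_ifs with h
  · obtain ⟨A, B, row, hQ, hA⟩ : ∃ A B row, Q = A ++ row :: B ∧ A.length = r :=
      ⟨Q.take r, Q.drop (r + 1), Q[r], by simp, by simp; omega⟩
    subst hA hQ
    simp only [List.getD_append_right _ _ _ _ le_rfl, Nat.sub_self, List.getD_cons_zero,
      List.set_append_right _ _ le_rfl, List.set_cons_zero, List.flatten_append,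
      List.flatten_cons]
    refine List.Perm.trans ?_ List.perm_middle
    refine List.Perm.append_left _ ?_
    rw [List.append_assoc]
    exact List.perm_middle
  · rw [List.getD_eq_default _ _ (not_lt.1 h), List.flatten_append]
    simp

theorem mem_flatten_of_entryG? {T : STab} {r c : ℕ} {x : Letter} (h : entryG? T r c = some x) :
    x ∈ T.flatten := by
  rw [entryG?_of_le _ (le_of_entryG? h)] at h
  have h1 := List.mem_of_getElem? h
  by_cases hr : r < T.length
  · rw [List.getD_eq_getElem _ _ hr] at h1
    exact List.mem_flatten.2 ⟨_, List.getElem_mem hr, h1⟩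
  · rw [List.getD_eq_default _ _ (not_lt.1 hr)] at h1
    simp at h1

theorem exists_entryG?_of_mem {T : STab} {x : Letter} (h : x ∈ T.flatten) :
    ∃ r c, entryG? T r c = some x := by
  obtain ⟨row, hrow, hx⟩ := List.mem_flatten.1 h
  obtain ⟨r, hr, rfl⟩ := List.getElem_of_mem hrow
  obtain ⟨i, hi⟩ := List.mem_iff_getElem?.1 hx
  refine ⟨r, r + i, ?_⟩
  rw [entryG?_add, List.getD_eq_getElem _ _ hr, hi]

/-- The list `1, 2, …, n` of integers. -/
def labels (n : ℕ) : List ℤ := (List.range n).map fun i : ℕ => (i : ℤ) + 1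

theorem labels_succ (n : ℕ) : labels (n + 1) = labels n ++ [(n : ℤ) + 1] := by
  simp [labels, List.range_succ]

theorem mem_labels {n : ℕ} {i : ℤ} : i ∈ labels n ↔ 1 ≤ i ∧ i ≤ n := by
  simp only [labels, List.mem_map, List.mem_range]
  constructor
  · rintro ⟨j, hj, rfl⟩
    omega
  · rintro ⟨h1, h2⟩
    exact ⟨(i - 1).toNat, by omega, by omega⟩

theorem nodup_labels (n : ℕ) : (labels n).Nodup :=
  List.Nodup.map (fun a b h => by simpa using h) List.nodup_range

theorem length_labels (n : ℕ) : (labels n).length = n := by simp [labels]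

/-- A standard shifted tableau with `n` boxes. -/
structure Recording (Q : STab) (n : ℕ) : Prop where
  shifted : IsShifted Q
  increasing : IsIncreasing Q
  perm : (Q.flatten.map Letter.ceil).Perm (labels n)

namespace Recording

variable {Q Q' : STab} {n r : ℕ}

theorem length_flatten (h : Recording Q n) : Q.flatten.length = n := by
  have := h.perm.length_eq
  rwa [List.length_map, length_labels] at this

theorem ceil_mem (h : Recording Q n) {x : Letter} (hx : x ∈ Q.flatten) :
    1 ≤ x.ceil ∧ x.ceil ≤ n :=
  mem_labels.1 (h.perm.mem_iff.1 (List.mem_map.2 ⟨x, hx, rfl⟩))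

theorem isStandard (h : Recording Q n) : IsStandard Q := by
  refine ⟨h.increasing, fun i h1 h2 => ?_⟩
  rw [h.length_flatten] at h2
  have h3 : Q.flatten.countP (fun x => decide (x.ceil = i)) =
      (Q.flatten.map Letter.ceil).count i := by
    rw [List.count, List.countP_map]
    congr 1
  rw [h3, h.perm.count_eq]
  exact List.count_eq_one_of_mem (nodup_labels n) (mem_labels.2 ⟨h1, h2⟩)

end Recording

theorem recording_of_isStandard {Q : STab} (h : IsShifted Q) (h' : IsStandard Q) :
    Recording Q Q.flatten.length := by
  refine ⟨h, h'.1, (List.Subperm.perm_of_length_le ?_ ?_).symm⟩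
  · refine (nodup_labels _).subperm fun i hi => ?_
    obtain ⟨h1, h2⟩ := mem_labels.1 hi
    have h3 := h'.2 i h1 h2
    obtain ⟨x, hx, hxi⟩ := List.countP_pos_iff.1 (h3 ▸ Nat.one_pos)
    exact List.mem_map.2 ⟨x, hx, by simpa using hxi⟩
  · rw [length_labels, List.length_map]

namespace Recording

variable {Q Q' : STab} {n r : ℕ}

theorem add (h : Recording Q n) (hr : Addable Q r) (f : Bool) :
    Recording (appendAt Q r ⟨(n : ℤ) + 1, f⟩) (n + 1) := by
  have hQ := h.shifted.represents
  have hR := hr.represents h.shifted ⟨(n : ℤ) + 1, f⟩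
  have hlast := (hQ.lt_length_iff r (Q.getD r []).length).not
  simp only [lt_irrefl, not_false_eq_true, ne_eq, not_not, true_iff] at hlast
  have hbound : ∀ {r' c' y}, entries Q r' c' = some y → y < ⟨(n : ℤ) + 1, f⟩ := fun hy => by
    have := (h.ceil_mem (mem_flatten_of_entryG? hy)).2
    exact Letter.lt_iff.2 (Or.inl (by dsimp only; omega))
  refine ⟨hR.shifted, ⟨fun r' c' x y hx hy => ?_, fun r' c' x y hx hy => ?_⟩, ?_⟩
  · have hx : entryG? _ _ _ = _ := hx
    have hy : entryG? _ _ _ = _ := hy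
    rw [hR.entry] at hx hy
    have hxy := h.increasing.1 r' c'
    simp only [Filling.upd] at hx hy
    split_ifs at hx hy with h1 h2 h2
    · omega
    · exfalso
      have := hQ.shapeClosed.left r' c' (by omega) (by rw [hy]; simp)
      rw [h1.1, h1.2] at this
      exact this hlast
    · cases hy
      exact hbound hx
    · exact hxy x y hx hy
  · have hx : entryG? _ _ _ = _ := hx
    have hy : entryG? _ _ _ = _ := hy
    rw [hR.entry] at hx hy
    have hxy := h.increasing.2 r' c'
    simp only [Filling.upd] at hx hy
    split_ifs at hx hy with h1 h2 h2
    · omega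
    · exfalso
      have := hQ.shapeClosed.down r' c' (by rw [hy]; simp)
      rw [h1.1, h1.2] at this
      exact this hlast
    · cases hy
      exact hbound hx
    · exact hxy x y hx hy
  · refine ((flatten_appendAt _ _ _).map _).trans ?_
    rw [labels_succ, List.map_cons]
    exact ((h.perm).cons _).trans (List.perm_append_comm (l₁ := [(n : ℤ) + 1]))

theorem appendAt_injective {Q₁ Q₂ : STab} {r₁ r₂ : ℕ} {f₁ f₂ : Bool} (h₁ : Recording Q₁ n)
    (h₂ : Recording Q₂ n) (hr₁ : Addable Q₁ r₁) (hr₂ : Addable Q₂ r₂)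
    (he : appendAt Q₁ r₁ ⟨(n : ℤ) + 1, f₁⟩ = appendAt Q₂ r₂ ⟨(n : ℤ) + 1, f₂⟩) :
    Q₁ = Q₂ ∧ r₁ = r₂ ∧ f₁ = f₂ := by
  have hR₁ := hr₁.represents h₁.shifted ⟨(n : ℤ) + 1, f₁⟩
  have hR₂ := hr₂.represents h₂.shifted ⟨(n : ℤ) + 1, f₂⟩
  have hu := hR₁.eq_entries
  rw [he, ← hR₂.eq_entries] at hu
  have hpos : r₁ = r₂ ∧ r₁ + (Q₁.getD r₁ []).length = r₂ + (Q₂.getD r₂ []).length := by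
    by_contra hne
    have h3 := congrFun (congrFun hu r₁) (r₁ + (Q₁.getD r₁ []).length)
    rw [Filling.upd_self, Filling.upd_of_ne _ _ (by omega)] at h3
    have := (h₂.ceil_mem (mem_flatten_of_entryG? h3.symm)).2
    dsimp only at this
    omega
  obtain ⟨rfl, hc⟩ := hpos
  rw [← hc] at hu
  have hlast : ∀ Q : STab, IsShifted Q → entries Q r₁ (r₁ + (Q.getD r₁ []).length) = none :=
    fun Q hQ => by
      have := (hQ.represents.lt_length_iff r₁ (Q.getD r₁ []).length).not
      simpa using this
  obtain ⟨h3, h4⟩ := Filling.upd_injective (hlast _ h₁.shifted)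
    (by rw [hc]; exact hlast _ h₂.shifted) hu
  refine ⟨h₁.shifted.represents.unique (h3 ▸ h₂.shifted.represents), rfl, ?_⟩
  simpa using h4

theorem exists_corner (h : Recording Q (n + 1)) :
    ∃ r c x, entries Q r c = some x ∧ x.ceil = n + 1 ∧ entries Q r (c + 1) = none ∧
      entries Q (r + 1) c = none := by
  have hle : ∀ {r c y}, entries Q r c = some y → y.ceil ≤ n + 1 := fun hy => by
    have := (h.ceil_mem (mem_flatten_of_entryG? hy)).2
    push_cast at this
    exact this
  have key : ∀ r c x, entries Q r c = some x → x.ceil = n + 1 →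
      (∀ r c y, entries Q r c = some y → y.ceil = n + 1 → y.primed = false → x.primed = false) →
      entries Q r (c + 1) = none ∧ entries Q (r + 1) c = none := by
    intro r c x hx hxn hmax
    constructor <;>
    · by_contra hne
      obtain ⟨y, hy⟩ := Option.ne_none_iff_exists'.1 hne
      have hlt : x < y := by
        first
        | exact h.increasing.1 _ _ _ _ hx hy
        | exact h.increasing.2 _ _ _ _ hx hy
      have hyn := hle hy
      rcases Letter.lt_iff.1 hlt with h1 | ⟨h1, h2, h3⟩
      · omega
      · have := hmax _ _ _ hy (by omega) h3
        rw [h2] at this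
        simp at this
  by_cases hex : ∃ r c x, entries Q r c = some x ∧ x.ceil = n + 1 ∧ x.primed = false
  · obtain ⟨r, c, x, hx, hxn, hxp⟩ := hex
    obtain ⟨h1, h2⟩ := key r c x hx hxn fun _ _ _ _ _ _ => hxp
    exact ⟨r, c, x, hx, hxn, h1, h2⟩
  · have hmem : (n : ℤ) + 1 ∈ Q.flatten.map Letter.ceil :=
      h.perm.mem_iff.2 (mem_labels.2 ⟨by omega, by push_cast; omega⟩)
    obtain ⟨x, hx, hxn⟩ := List.mem_map.1 hmem
    obtain ⟨r, c, hx⟩ := exists_entryG?_of_mem hx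
    obtain ⟨h1, h2⟩ := key r c x hx hxn fun r c y hy hyn hyp => absurd ⟨r, c, y, hy, hyn, hyp⟩ hex
    exact ⟨r, c, x, hx, hxn, h1, h2⟩

theorem exists_appendAt (h : Recording Q' (n + 1)) :
    ∃ Q r f, Recording Q n ∧ Addable Q r ∧ Q' = appendAt Q r ⟨(n : ℤ) + 1, f⟩ := by
  obtain ⟨r, c, x, hx, hxn, hr, hu⟩ := h.exists_corner
  have hQ' := h.shifted.represents
  have hrc := hQ'.shapeClosed.le r c (by rw [hx]; simp)
  obtain ⟨Q, hQ⟩ := (hQ'.shapeClosed.remove hr hu).exists_represents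
    (n := Q'.flatten.length) (fun r' c' y hy => by
      simp only [Filling.upd] at hy
      split_ifs at hy
      exact hQ'.within _ _ _ hy)
  have hlen : (Q.getD r []).length = c - r := by
    refine hQ.length_eq hrc (Filling.upd_self _ _ _ _) fun c' h1 h2 => ?_
    rw [Filling.upd_of_ne _ _ (by omega)]
    clear hr hu
    have k : ∀ m, c' ≤ m → entries Q' r m ≠ none → entries Q' r c' ≠ none := by
      intro m hm
      induction m, hm using Nat.le_induction with
      | base => exact id
      | succ m hm ihm => exact fun hne => ihm (hQ'.shapeClosed.left r m (by omega) hne)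
    exact k c h2.le (by rw [hx]; simp)
  have hadd : Addable Q r := by
    rintro r' rfl
    have h1 := hQ'.shapeClosed.down r' c (by rw [hx]; simp)
    have := (hQ.lt_length_iff r' (c - r')).2 (by
      rwa [Filling.upd_of_ne _ _ (by omega), show r' + (c - r') = c by omega])
    omega
  have hR := hadd.represents hQ.shifted x
  rw [hlen, show r + (c - r) = c by omega, ← hQ.eq_entries, Filling.upd_upd,
    Filling.upd_eq_self _ hx] at hR
  obtain rfl := hR.unique hQ'
  have hent : ∀ {r' c' y}, entryG? Q r' c' = some y →
      entryG? (appendAt Q r x) r' c' = some y := fun {r' c' y} hy => by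
    rw [hQ.entry, Filling.upd] at hy
    split_ifs at hy
    exact hy
  refine ⟨Q, r, x.primed, ⟨hQ.shifted, ⟨fun r' c' a b ha hb => ?_, fun r' c' a b ha hb => ?_⟩, ?_⟩,
    hadd, by rw [← hxn]⟩
  · exact h.increasing.1 _ _ _ _ (hent ha) (hent hb)
  · exact h.increasing.2 _ _ _ _ (hent ha) (hent hb)
  · have h1 := ((flatten_appendAt Q r x).map Letter.ceil).symm.trans h.perm
    rw [labels_succ, List.map_cons, hxn] at h1
    exact (h1.trans (List.perm_append_comm (l₁ := labels n))).cons_inv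

end Recording

theorem PEG_append_singleton (a : PWord) (u : Letter) :
    PEG (a ++ [u]) = (egInsert (PEG a) u).1 := by
  simp [PEG]

theorem QEG_append_singleton (a : PWord) (u : Letter) :
    QEG (a ++ [u]) = addBox (QEG a) (PEG a) (PEG (a ++ [u]))
      ⟨(a.length : ℤ) + 1, (egInsert (PEG a) u).2⟩ := by
  have h : ∀ (a : PWord) (P Q : STab) (n : ℕ), QEGaux P Q n (a ++ [u]) =
      addBox (QEGaux P Q n a) (a.foldl (fun T u => (egInsert T u).1) P)
        (egInsert (a.foldl (fun T u => (egInsert T u).1) P) u).1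
        ⟨(n : ℤ) + a.length, (egInsert (a.foldl (fun T u => (egInsert T u).1) P) u).2⟩ := by
    intro a
    induction a with
    | nil => intro P Q n; simp [QEGaux]
    | cons x a ih =>
      intro P Q n
      rw [List.cons_append, QEGaux, ih, QEGaux, List.foldl_cons, List.length_cons]
      push_cast
      rw [add_assoc, add_comm (1 : ℤ)]
  rw [PEG_append_singleton, QEG, h, QEG, PEG, Nat.cast_one, add_comm (1 : ℤ)]

theorem isShifted_nil {α : Type*} : IsShifted ([] : List (List α)) :=
  isShifted_iff.2 (by simp)

theorem valid_nil {z : Equiv.Perm ℤ} : Valid [] z ↔ [] ∈ RinvPlus z := by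
  refine ⟨fun h => h.mem, fun h => ⟨isShifted_nil,
    ⟨?_, ?_, ?_, ?_⟩, h⟩⟩ <;> simp [entries, entryG?]

theorem recording_nil : Recording [] 0 where
  shifted := isShifted_nil
  increasing := by constructor <;> simp [entry?, entryG?]
  perm := by simp [labels]

theorem IsShifted.eq_nil {Q : STab} (h : IsShifted Q) (h0 : (Q.getD 0 []).length = 0) :
    Q = [] := by
  have := h.length_pos (r := 0)
  exact List.length_eq_zero_iff.1 (by omega)

theorem AddsBox.sameRows {P P' Q Q' : STab} {r : ℕ} (h : AddsBox P P' r) (h' : AddsBox Q Q' r) :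
    SameRows P Q ↔ SameRows P' Q' := by
  constructor
  · intro hs r'
    rw [h r', h' r', hs r']
  · intro hs r'
    have h1 := h r'
    have h2 := h' r'
    have h3 := hs r'
    omega

theorem SameRows.addable {P Q : STab} {r : ℕ} (h : SameRows P Q) (hP : Addable P r) :
    Addable Q r := by
  intro r' hr'
  rw [← h r, ← h r']
  exact hP r' hr'

/-- The properties of the insertion and recording tableaux of a word. -/
structure Records (a : PWord) (z : Equiv.Perm ℤ) : Prop where
  valid : Valid (PEG a) z
  recording : Recording (QEG a) a.length
  sameRows : SameRows (PEG a) (QEG a)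

theorem Valid.append_mem {P : STab} {z₀ z : Equiv.Perm ℤ} {a : PWord} {u : Letter}
    (h : Valid P z₀) (ha : a ∈ RinvPlus z₀) :
    rowWord P ++ [u] ∈ RinvPlus z ↔ a ++ [u] ∈ RinvPlus z :=
  ⟨mem_RinvPlus_transfer h.mem ha [u], mem_RinvPlus_transfer ha h.mem [u]⟩

theorem Records.append {a : PWord} {z₀ z : Equiv.Perm ℤ} {u : Letter} (h : Records a z₀)
    (hu : rowWord (PEG a) ++ [u] ∈ RinvPlus z) :
    Records (a ++ [u]) z ∧ ∃ r, Addable (QEG a) r ∧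
      QEG (a ++ [u]) = appendAt (QEG a) r ⟨(a.length : ℤ) + 1, (egInsert (PEG a) u).2⟩ := by
  obtain ⟨hv, r, hr, -⟩ := h.valid.insert hu
  rw [← PEG_append_singleton] at hv hr
  have hadd := h.sameRows.addable (hr.addable hv.shifted)
  have hQ := addBox_eq hr (QEG a) ⟨(a.length : ℤ) + 1, (egInsert (PEG a) u).2⟩
  rw [← QEG_append_singleton] at hQ
  refine ⟨⟨hv, ?_, ?_⟩, r, hadd, hQ⟩
  · rw [hQ, List.length_append]
    exact h.recording.add hadd _
  · rw [hQ]
    exact (hr.sameRows (hadd.addsBox h.recording.shifted _)).1 h.sameRows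

theorem records_of_mem {a : PWord} {z : Equiv.Perm ℤ} (h : a ∈ RinvPlus z) : Records a z := by
  induction a using List.reverseRecOn generalizing z with
  | nil => exact ⟨valid_nil.2 h, recording_nil, fun _ => rfl⟩
  | append_singleton a u ih =>
    have ha := mem_RinvPlus_prefix h
    have hrec := ih ha
    exact (hrec.append ((hrec.valid.append_mem ha).2 h)).1

theorem eq_of_PEG_eq_of_QEG_eq {a b : PWord} {z : Equiv.Perm ℤ} (ha : a ∈ RinvPlus z)
    (hb : b ∈ RinvPlus z) (hP : PEG a = PEG b) (hQ : QEG a = QEG b) : a = b := by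
  induction a using List.reverseRecOn generalizing b z with
  | nil =>
    have h := length_eq_of_mem ha hb
    exact (List.length_eq_zero_iff.1 h.symm).symm
  | append_singleton a u ih =>
    have hlen := length_eq_of_mem ha hb
    rcases List.eq_nil_or_concat b with rfl | ⟨b, v, rfl⟩
    · simp at hlen
    rw [List.concat_eq_append] at *
    have hlen : b.length = a.length := by simpa using hlen.symm
    have ha' := mem_RinvPlus_prefix ha
    have hb' := mem_RinvPlus_prefix hb
    have hra := records_of_mem ha'
    have hrb := records_of_mem hb'
    have hu := (hra.valid.append_mem ha').2 ha
    have hv := (hrb.valid.append_mem hb').2 hb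
    obtain ⟨-, r₁, hr₁, hQ₁⟩ := hra.append hu
    obtain ⟨-, r₂, hr₂, hQ₂⟩ := hrb.append hv
    rw [hQ₁, hQ₂, hlen] at hQ
    obtain ⟨hQ', -, hf⟩ := hra.recording.appendAt_injective (hlen ▸ hrb.recording) hr₁ hr₂ hQ
    rw [PEG_append_singleton, PEG_append_singleton] at hP
    have hsame : SameRows (PEG a) (PEG b) := fun r => by
      rw [hra.sameRows, hQ', hrb.sameRows]
    obtain ⟨hP', rfl⟩ := hra.valid.insert_injective hrb.valid hu hv (Prod.ext hP hf)
      (hsame.shapeOf_eq hra.valid.shifted hrb.valid.shifted)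
    have hmem := hrb.valid.mem
    rw [← hP'] at hmem
    rw [← eq_of_mem_RinvPlus hra.valid.mem hmem] at hb'
    rw [ih ha' hb' hP' hQ']

theorem exists_of_recording {n : ℕ} {P Q : STab} {z : Equiv.Perm ℤ} (hP : Valid P z)
    (hQ : Recording Q n) (hs : SameRows P Q) :
    ∃ a ∈ RinvPlus z, PEG a = P ∧ QEG a = Q := by
  induction n generalizing P Q z with
  | zero =>
    have h0 : (Q.getD 0 []).length = 0 := by
      have h1 := List.length_eq_zero_iff.1 hQ.length_flatten
      rw [List.length_eq_zero_iff]
      cases Q with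
      | nil => rfl
      | cons row Q => exact List.flatten_eq_nil_iff.1 h1 row (by simp)
    obtain rfl := hQ.shifted.eq_nil h0
    obtain rfl := hP.shifted.eq_nil ((hs 0).trans h0)
    exact ⟨[], valid_nil.1 hP, rfl, rfl⟩
  | succ n ih =>
    obtain ⟨Q₀, r, f, hQ₀, hr, rfl⟩ := hQ.exists_appendAt
    have hbox := hr.addsBox hQ₀.shifted ⟨(n : ℤ) + 1, f⟩
    have hrep := hP.shifted.represents
    have hlen : ∀ r', (P.getD r' []).length = (Q₀.getD r' []).length + if r' = r then 1 else 0 :=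
      fun r' => by rw [hs r', hbox r']
    have hlr := hlen r
    rw [if_pos rfl] at hlr
    obtain ⟨c, hc⟩ : ∃ c, c = r + (Q₀.getD r []).length := ⟨_, rfl⟩
    have h1 : entries P r c ≠ none := by
      rw [hc, ← hrep.lt_length_iff]
      omega
    have h2 : entries P r (c + 1) = none := by
      have := (hrep.lt_length_iff r ((Q₀.getD r []).length + 1)).not.1 (by omega)
      rw [hc]
      simpa [add_assoc] using this
    have h3 : entries P (r + 1) c = none := by
      by_contra hne
      have hle := hrep.shapeClosed.le _ _ hne
      have h4 := (hrep.lt_length_iff (r + 1) (c - (r + 1))).2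
        (by rwa [show r + 1 + (c - (r + 1)) = c by omega])
      have h5 := hlen (r + 1)
      rw [if_neg (by omega)] at h5
      have h6 := hQ₀.shifted.length_lt (r := r) (by omega)
      omega
    obtain ⟨T, z₀, w, hT, hw, hins, hTP⟩ := hP.exists_insert h1 h2 h3 f
    obtain ⟨a, ha, hPa, hQa⟩ := ih hT hQ₀ ((hTP.sameRows hbox).2 hs)
    subst hPa
    have hPa : PEG (a ++ [w]) = P := by rw [PEG_append_singleton, hins]
    have hlen : a.length = n := by
      rw [← (records_of_mem ha).recording.length_flatten, hQa, hQ₀.length_flatten]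
    refine ⟨a ++ [w], (hT.append_mem ha).1 hw, hPa, ?_⟩
    rw [QEG_append_singleton, hPa, addBox_eq hTP, hQa, hins, hlen]

/-- Theorem 3.6: `a ↦ (P_EGᴼ(a), Q_EGᴼ(a))` is a bijection from
`R_inv⁺(z)` to pairs `(P, Q)` of shifted tableaux of the same shape with `P` increasing,
without primes on the main diagonal and with `row(P) ∈ R_inv⁺(z)`, and `Q` standard. -/
theorem stmt4 (z : Equiv.Perm ℤ) (hz : IZ z) :
    Set.BijOn (fun a => (PEG a, QEG a)) (RinvPlus z)
      {PQ : STab × STab | shapeOf PQ.1 = shapeOf PQ.2 ∧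
        IsShifted PQ.1 ∧ IsIncreasing PQ.1 ∧ NoDiagPrimes PQ.1 ∧
        rowWord PQ.1 ∈ RinvPlus z ∧ IsShifted PQ.2 ∧ IsStandard PQ.2} := by
  refine ⟨fun a ha => ?_, fun a ha b hb hab => ?_, ?_⟩
  · obtain ⟨hv, hr, hs⟩ := records_of_mem ha
    obtain ⟨h1, h2, h3, h4⟩ := valid_iff.1 hv
    exact ⟨hs.shapeOf_eq hv.shifted hr.shifted, h1, h2, h3, h4, hr.shifted, hr.isStandard⟩
  · exact eq_of_PEG_eq_of_QEG_eq ha hb (Prod.mk.inj hab).1 (Prod.mk.inj hab).2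
  · rintro ⟨P, Q⟩ ⟨hs, h1, h2, h3, h4, h5, h6⟩
    obtain ⟨a, ha, hP, hQ⟩ := exists_of_recording (valid_iff.2 ⟨h1, h2, h3, h4⟩)
      (recording_of_isStandard h5 h6) (sameRows_of_shapeOf_eq hs)
    exact ⟨a, ha, Prod.ext hP hQ⟩
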